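/- Under the a priori hypotheses, for every ε ∈ (0,T) there exists D₁ = D₁(Ω, ε, T, C_u, C_φ, C_f) such that |D²u| ≤ D₁ on ∂Ω×(ε,T), where D²u denotes the full real Hessian of u in the spatial variables. -/

import Mathlib

open Set Metric Complex Topology Filter Bornology
open scoped ComplexOrder

noncomputable section

/-- `ℂⁿ` with its Euclidean structure. -/
abbrev Cn (n : ℕ) := EuclideanSpace ℂ (Fin n)

/-- The `α`-th coordinate vector scaled by `c`. -/
def cvec (n : ℕ) (α : Fin n) (c : ℂ) : Cn n := EuclideanSpace.single α c

variable {n : ℕ}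

/-- Wirtinger derivative `∂/∂z_α` (within a set), via the real Fréchet derivative. -/
def wderW (s : Set (Cn n)) (α : Fin n) (u : Cn n → ℂ) (z : Cn n) : ℂ :=
  (fderivWithin ℝ u s z (cvec n α 1) - Complex.I * fderivWithin ℝ u s z (cvec n α Complex.I)) / 2

/-- Conjugate Wirtinger derivative `∂/∂z̄_β` (within a set). -/
def wderBarW (s : Set (Cn n)) (β : Fin n) (u : Cn n → ℂ) (z : Cn n) : ℂ :=
  (fderivWithin ℝ u s z (cvec n β 1) + Complex.I * fderivWithin ℝ u s z (cvec n β Complex.I)) / 2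

/-- The complex Hessian matrix `u_{αβ̄} = ∂²u/∂z_α ∂z̄_β` of a real valued function,
computed within a set `s`. -/
def cHessW (s : Set (Cn n)) (u : Cn n → ℝ) (z : Cn n) : Matrix (Fin n) (Fin n) ℂ :=
  Matrix.of fun α β => wderW s α (wderBarW s β fun w => (u w : ℂ)) z

/-- The complex Hessian matrix `u_{αβ̄}`. -/
def cHess (u : Cn n → ℝ) : Cn n → Matrix (Fin n) (Fin n) ℂ := cHessW univ u

/-- The Euclidean Laplacian (within a set) of `v : ℂⁿ → ℝ`, i.e. the sum of all pure second
derivatives in the `2n` underlying real coordinate directions. -/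
def lapW (s : Set (Cn n)) (v : Cn n → ℝ) (z : Cn n) : ℝ :=
  ∑ α : Fin n,
    (fderivWithin ℝ (fun y => fderivWithin ℝ v s y (cvec n α 1)) s z (cvec n α 1) +
      fderivWithin ℝ (fun y => fderivWithin ℝ v s y (cvec n α Complex.I)) s z
        (cvec n α Complex.I))

/-- The Euclidean Laplacian of `v : ℂⁿ → ℝ`. -/
def lap (v : Cn n → ℝ) : Cn n → ℝ := lapW univ v

/-- A bounded smooth strictly pseudoconvex domain of `ℂⁿ`: a bounded (nonempty) domain with a
smooth strictly plurisubharmonic defining function `ρ` on a bounded neighbourhood of its closure,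
with nonvanishing differential on the boundary. -/
def IsSPCDomain (Ω : Set (Cn n)) : Prop :=
  IsOpen Ω ∧ Ω.Nonempty ∧ IsBounded Ω ∧
    ∃ (U : Set (Cn n)) (ρ : Cn n → ℝ), IsOpen U ∧ IsBounded U ∧ closure Ω ⊆ U ∧
      ContDiffOn ℝ (⊤ : ℕ∞) ρ U ∧ (∀ z ∈ U, (cHess ρ z).PosDef) ∧
      Ω = {z ∈ U | ρ z < 0} ∧ ∀ z ∈ frontier Ω, fderiv ℝ ρ z ≠ 0

/-- Membership in `C^{2;1}(Ω̄ × [0,T))`: `u(·,t) ∈ C²(Ω̄)` for each `t ∈ [0,T)`,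
`u(z,·) ∈ C¹([0,T))` for each `z ∈ Ω̄`, and `∂u/∂t` together with all second spatial
derivatives are continuous on `Ω̄ × [0,T)`. -/
def C21 (n : ℕ) (Ω : Set (Cn n)) (T : ℝ) (u : Cn n × ℝ → ℝ) : Prop :=
  (∀ t ∈ Ico (0 : ℝ) T, ContDiffOn ℝ 2 (fun z => u (z, t)) (closure Ω)) ∧
  (∀ z ∈ closure Ω, ContDiffOn ℝ 1 (fun s => u (z, s)) (Ico (0 : ℝ) T)) ∧
  ContinuousOn (fun p : Cn n × ℝ => derivWithin (fun s => u (p.1, s)) (Ico (0 : ℝ) T) p.2)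
    (closure Ω ×ˢ Ico (0 : ℝ) T) ∧
  ∀ v w : Cn n, ContinuousOn
    (fun p : Cn n × ℝ =>
      fderivWithin ℝ (fun y => fderivWithin ℝ (fun x => u (x, p.2)) (closure Ω) y v)
        (closure Ω) p.1 w)
    (closure Ω ×ˢ Ico (0 : ℝ) T)

/-- The hypotheses of the a priori estimates theorem: `φ ∈ C^∞(Ω̄×[0,T))`,
`f ∈ C^∞([0,T)×Ω̄×ℝ)`, `u ∈ C^∞(Ω×(0,T)) ∩ C^{2;1}(Ω̄×[0,T))` is strictly plurisubharmonic
in `z` and solves `∂u/∂t = log det(u_{αβ̄}) + f(t,z,u)` on `Ω×(0,T)` with `u = φ` on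
`∂Ω×[0,T)`, `sup_Ω |u(·,0)| ≤ Cu`, `f` nonincreasing in the last variable,
`‖f‖_{C²((0,T)×Ω×ℝ)} ≤ Cf` and `‖φ‖_{C⁴(Ω×(0,T))} ≤ Cφv` (parabolic norm). -/
def AprioriHyps (n : ℕ) (Ω : Set (Cn n)) (T Cu Cφv Cf : ℝ)
    (u φ : Cn n × ℝ → ℝ) (f : ℝ × Cn n × ℝ → ℝ) : Prop :=
  ContDiffOn ℝ (⊤ : ℕ∞) φ (closure Ω ×ˢ Ico (0 : ℝ) T) ∧
  ContDiffOn ℝ (⊤ : ℕ∞) f (Ico (0 : ℝ) T ×ˢ closure Ω ×ˢ (univ : Set ℝ)) ∧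
  ContDiffOn ℝ (⊤ : ℕ∞) u (Ω ×ˢ Ioo (0 : ℝ) T) ∧
  C21 n Ω T u ∧
  (∀ t ∈ Ioo (0 : ℝ) T, ∀ z ∈ Ω, (cHess (fun w => u (w, t)) z).PosDef) ∧
  (∀ z ∈ Ω, ∀ t ∈ Ioo (0 : ℝ) T,
    deriv (fun s => u (z, s)) t
      = Real.log ((cHess (fun w => u (w, t)) z).det.re) + f (t, z, u (z, t))) ∧
  (∀ z ∈ frontier Ω, ∀ t ∈ Ico (0 : ℝ) T, u (z, t) = φ (z, t)) ∧
  (∀ z ∈ Ω, |u (z, 0)| ≤ Cu) ∧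
  (∀ t ∈ Ioo (0 : ℝ) T, ∀ z ∈ Ω, ∀ r : ℝ, deriv (fun y => f (t, z, y)) r ≤ 0) ∧
  (∀ k : ℕ, k ≤ 2 → ∀ p ∈ Ioo (0 : ℝ) T ×ˢ Ω ×ˢ (univ : Set ℝ),
    ‖iteratedFDeriv ℝ k f p‖ ≤ Cf) ∧
  (∀ j l : ℕ, j + 2 * l ≤ 4 → ∀ z ∈ Ω, ∀ t ∈ Ioo (0 : ℝ) T,
    ‖iteratedFDeriv ℝ j (fun w => iteratedDeriv l (fun s => φ (w, s)) t) z‖ ≤ Cφv)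

/-! ## Directional derivatives -/

section dirder

variable {G : Type*} [NormedAddCommGroup G] [NormedSpace ℝ G]

/-- Directional derivative. -/
def dd (X : G) (W : G → ℝ) : G → ℝ := fun p => fderiv ℝ W p X

/-- Smooth near a point. -/
def Sm (W : G → ℝ) (p : G) : Prop := ContDiffAt ℝ (⊤ : ℕ∞) W p

theorem Sm.diff {W : G → ℝ} {p : G} (h : Sm W p) : DifferentiableAt ℝ W p :=
  ContDiffAt.differentiableAt h (by simp)

theorem Sm.cont {W : G → ℝ} {p : G} (h : Sm W p) : ContinuousAt W p :=
  ContDiffAt.continuousAt h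

theorem Sm.ev {W : G → ℝ} {p : G} (h : Sm W p) : ∀ᶠ q in 𝓝 p, DifferentiableAt ℝ W q := by
  have h1 : ContDiffAt ℝ 1 W p := ContDiffAt.of_le h (by exact_mod_cast le_top)
  have := h1.eventually (by simp)
  filter_upwards [this] with q hq using hq.differentiableAt (by simp)

theorem Sm.dd {W : G → ℝ} {p : G} (h : Sm W p) (X : G) : Sm (dd X W) p := by
  have : ContDiffAt ℝ (⊤ : ℕ∞) (fderiv ℝ W) p := ContDiffAt.fderiv_right h (by simp)
  exact this.clm_apply contDiffAt_const

theorem Sm.add {a b : G → ℝ} {p : G} (ha : Sm a p) (hb : Sm b p) : Sm (fun q => a q + b q) p :=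
  ContDiffAt.add ha hb
theorem Sm.sub {a b : G → ℝ} {p : G} (ha : Sm a p) (hb : Sm b p) : Sm (fun q => a q - b q) p :=
  ContDiffAt.sub ha hb
theorem Sm.mul {a b : G → ℝ} {p : G} (ha : Sm a p) (hb : Sm b p) : Sm (fun q => a q * b q) p :=
  ContDiffAt.mul ha hb
theorem Sm.const (c : ℝ) (p : G) : Sm (fun _ => c) p := contDiffAt_const
theorem Sm.congr {a b : G → ℝ} {p : G} (ha : Sm a p) (h : b =ᶠ[𝓝 p] a) : Sm b p :=
  ContDiffAt.congr_of_eventuallyEq ha h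

theorem dd_congr {a b : G → ℝ} {p : G} (h : a =ᶠ[𝓝 p] b) (X : G) : dd X a p = dd X b p := by
  unfold dd; rw [h.fderiv_eq]

theorem dd_congr_ev {a b : G → ℝ} {p : G} (h : a =ᶠ[𝓝 p] b) (X : G) :
    dd X a =ᶠ[𝓝 p] dd X b := by
  filter_upwards [eventually_eventually_nhds.2 h] with q hq using dd_congr hq X

theorem dd_const (c : ℝ) (X p : G) : dd X (fun _ => c) p = 0 := by
  simp [dd]

theorem dd_add {a b : G → ℝ} {p : G} (ha : DifferentiableAt ℝ a p) (hb : DifferentiableAt ℝ b p)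
    (X : G) : dd X (fun q => a q + b q) p = dd X a p + dd X b p := by
  unfold dd; rw [fderiv_fun_add ha hb]; simp

theorem dd_sub {a b : G → ℝ} {p : G} (ha : DifferentiableAt ℝ a p) (hb : DifferentiableAt ℝ b p)
    (X : G) : dd X (fun q => a q - b q) p = dd X a p - dd X b p := by
  unfold dd; rw [fderiv_fun_sub ha hb]; simp

theorem dd_mul {a b : G → ℝ} {p : G} (ha : DifferentiableAt ℝ a p) (hb : DifferentiableAt ℝ b p)
    (X : G) : dd X (fun q => a q * b q) p = a p * dd X b p + b p * dd X a p := by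
  unfold dd; rw [fderiv_fun_mul ha hb]; simp

theorem dd_vadd (X Y : G) (W : G → ℝ) (p : G) : dd (X + Y) W p = dd X W p + dd Y W p := by
  simp [dd]
theorem dd_vsmul (c : ℝ) (X : G) (W : G → ℝ) (p : G) : dd (c • X) W p = c * dd X W p := by
  simp [dd]
theorem dd_vneg (X : G) (W : G → ℝ) (p : G) : dd (-X) W p = - dd X W p := by
  simp [dd]

theorem dd2_add {a b : G → ℝ} {p : G} (ha : Sm a p) (hb : Sm b p)
    (X Y : G) : dd X (dd Y (fun q => a q + b q)) p = dd X (dd Y a) p + dd X (dd Y b) p := by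
  have : dd Y (fun q => a q + b q) =ᶠ[𝓝 p] fun q => dd Y a q + dd Y b q := by
    filter_upwards [ha.ev, hb.ev] with q h1 h2 using dd_add h1 h2 Y
  rw [dd_congr this, dd_add (ha.dd Y).diff (hb.dd Y).diff]

theorem dd2_sub {a b : G → ℝ} {p : G} (ha : Sm a p) (hb : Sm b p)
    (X Y : G) : dd X (dd Y (fun q => a q - b q)) p = dd X (dd Y a) p - dd X (dd Y b) p := by
  have : dd Y (fun q => a q - b q) =ᶠ[𝓝 p] fun q => dd Y a q - dd Y b q := by
    filter_upwards [ha.ev, hb.ev] with q h1 h2 using dd_sub h1 h2 Y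
  rw [dd_congr this, dd_sub (ha.dd Y).diff (hb.dd Y).diff]

theorem dd2_mul {a b : G → ℝ} {p : G} (ha : Sm a p) (hb : Sm b p)
    (X Y : G) : dd X (dd Y (fun q => a q * b q)) p =
      a p * dd X (dd Y b) p + b p * dd X (dd Y a) p + dd X a p * dd Y b p
        + dd Y a p * dd X b p := by
  have : dd Y (fun q => a q * b q) =ᶠ[𝓝 p] fun q => a q * dd Y b q + b q * dd Y a q := by
    filter_upwards [ha.ev, hb.ev] with q h1 h2 using dd_mul h1 h2 Y
  rw [dd_congr this, dd_add (ha.mul (hb.dd Y)).diff (hb.mul (ha.dd Y)).diff,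
    dd_mul ha.diff (hb.dd Y).diff, dd_mul hb.diff (ha.dd Y).diff]
  ring

theorem dd2_const (c : ℝ) (X Y p : G) : dd X (dd Y (fun _ => c)) p = 0 := by
  have : dd Y (fun _ : G => c) = fun _ => 0 := by ext q; exact dd_const c Y q
  rw [this, dd_const]

theorem dd_comm {W : G → ℝ} {p : G} (h : Sm W p) (X Y : G) :
    dd X (dd Y W) p = dd Y (dd X W) p := by
  have hd : DifferentiableAt ℝ (fderiv ℝ W) p :=
    (ContDiffAt.fderiv_right (m := (⊤ : ℕ∞)) h (by simp)).differentiableAt (by simp)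
  have key : ∀ X Y : G, dd X (dd Y W) p = fderiv ℝ (fderiv ℝ W) p X Y := by
    intro X Y
    unfold dd
    rw [fderiv_clm_apply hd (by fun_prop)]
    simp
  rw [key, key]
  have h2 : IsSymmSndFDerivAt ℝ W p :=
    ContDiffAt.isSymmSndFDerivAt h (by
      simpa using (WithTop.coe_le_coe.2 (le_top : (2 : ℕ∞) ≤ ⊤)))
  exact h2 X Y

theorem hasDerivAt_line {W : G → ℝ} {p : G} (h : DifferentiableAt ℝ W p) (X : G) {s : ℝ} {q : G}
    (hq : q + s • X = p) :
    HasDerivAt (fun r : ℝ => W (q + r • X)) (dd X W p) s := by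
  have h1 : HasDerivAt (fun r : ℝ => q + r • X) X s := by
    simpa using ((hasDerivAt_id s).smul_const X).const_add q
  subst hq
  exact h.hasFDerivAt.comp_hasDerivAt s h1

theorem min_second {W : G → ℝ} {p X : G} (h : Sm W p)
    (hm : ∀ᶠ s in 𝓝 (0 : ℝ), W p ≤ W (p + s • X)) :
    dd X W p = 0 ∧ 0 ≤ dd X (dd X W) p := by
  set w : ℝ → ℝ := fun s => W (p + s • X) with hw
  have hc : Tendsto (fun s : ℝ => p + s • X) (𝓝 0) (𝓝 p) := by
    have : Continuous fun s : ℝ => p + s • X := by fun_prop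
    simpa using this.tendsto 0
  have hd : ∀ᶠ s in 𝓝 (0 : ℝ), HasDerivAt w (dd X W (p + s • X)) s := by
    filter_upwards [hc.eventually h.ev] with s hs using hasDerivAt_line hs X rfl
  have hmin : IsLocalMin w 0 := by
    filter_upwards [hm] with s hs
    simpa [hw] using hs
  have h0 : HasDerivAt w (dd X W p) 0 := by simpa using hd.self_of_nhds
  have hz : dd X W p = 0 := hmin.hasDerivAt_eq_zero h0
  refine ⟨hz, ?_⟩
  have hd2 : HasDerivAt (fun s : ℝ => dd X W (p + s • X)) (dd X (dd X W) p) 0 :=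
    hasDerivAt_line (h.dd X).diff X (by simp)
  have hder : deriv w =ᶠ[𝓝 0] fun s => dd X W (p + s • X) := by
    filter_upwards [hd] with s hs using hs.deriv
  have hdd : deriv (deriv w) 0 = dd X (dd X W) p := by
    rw [hder.deriv_eq]; exact hd2.deriv
  by_contra hneg
  push Not at hneg
  have hmax : IsLocalMin (fun s => - w s) 0 := by
    apply isLocalMin_of_deriv_deriv_pos
    · have : deriv (fun s => - w s) = fun s => - deriv w s := by ext s; simp
      rw [this]
      simp [hdd]; exact hneg
    · simp [h0.deriv, hz]
    · exact h0.continuousAt.neg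
  have hconst : w =ᶠ[𝓝 0] fun _ => w 0 := by
    filter_upwards [hmin, hmax] with s h1 h2
    have h2' : - w 0 ≤ - w s := h2
    have h1' : w 0 ≤ w s := h1
    linarith
  have : deriv w =ᶠ[𝓝 0] fun _ => 0 := by
    filter_upwards [eventually_eventually_nhds.2 hconst] with s hs
    rw [Filter.EventuallyEq.deriv_eq hs]; simp
  rw [this.deriv_eq] at hdd
  simp at hdd
  linarith

end dirder

/-! ## The operator `L` and the minimum principle -/

/-- Sum over a complex frame. -/
def frS (v : Fin n → Cn n) (μ : Fin n → ℝ) (F : Cn n → ℝ) : ℝ :=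
  ∑ a, μ a * (F (v a) + F (Complex.I • v a))

/-- Parabolic operator. -/
def Lop (v : Fin n → Cn n) (μ : Fin n → ℝ) (W : Cn n × ℝ → ℝ) (p : Cn n × ℝ) : ℝ :=
  dd ((0 : Cn n), (1 : ℝ)) W p -
    frS v μ (fun e => dd (e, (0 : ℝ)) (dd (e, (0 : ℝ)) W) p)

/-- Carré du champ. -/
def Gam (v : Fin n → Cn n) (μ : Fin n → ℝ) (a b : Cn n × ℝ → ℝ) (p : Cn n × ℝ) : ℝ :=
  frS v μ (fun e => dd (e, (0 : ℝ)) a p * dd (e, (0 : ℝ)) b p)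

theorem frS_add (v : Fin n → Cn n) (μ : Fin n → ℝ) (F H : Cn n → ℝ) :
    frS v μ (fun e => F e + H e) = frS v μ F + frS v μ H := by
  unfold frS; rw [← Finset.sum_add_distrib]; congr 1; ext a; ring

theorem frS_sub (v : Fin n → Cn n) (μ : Fin n → ℝ) (F H : Cn n → ℝ) :
    frS v μ (fun e => F e - H e) = frS v μ F - frS v μ H := by
  unfold frS; rw [← Finset.sum_sub_distrib]; congr 1; ext a; ring

theorem frS_smul (v : Fin n → Cn n) (μ : Fin n → ℝ) (c : ℝ) (F : Cn n → ℝ) :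
    frS v μ (fun e => c * F e) = c * frS v μ F := by
  unfold frS; rw [Finset.mul_sum]; congr 1; ext a; ring

theorem frS_mono {v : Fin n → Cn n} {μ : Fin n → ℝ} (hμ : ∀ a, 0 ≤ μ a) {F H : Cn n → ℝ}
    (h : ∀ e, F e ≤ H e) : frS v μ F ≤ frS v μ H := by
  unfold frS
  apply Finset.sum_le_sum
  intro a _
  exact mul_le_mul_of_nonneg_left (add_le_add (h _) (h _)) (hμ a)

theorem frS_nonneg {v : Fin n → Cn n} {μ : Fin n → ℝ} (hμ : ∀ a, 0 ≤ μ a) {F : Cn n → ℝ}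
    (h : ∀ e, 0 ≤ F e) : 0 ≤ frS v μ F := by
  unfold frS
  apply Finset.sum_nonneg
  intro a _
  exact mul_nonneg (hμ a) (add_nonneg (h _) (h _))

theorem Lop_add (v : Fin n → Cn n) (μ : Fin n → ℝ) {a b : Cn n × ℝ → ℝ} {p : Cn n × ℝ}
    (ha : Sm a p) (hb : Sm b p) :
    Lop v μ (fun q => a q + b q) p = Lop v μ a p + Lop v μ b p := by
  unfold Lop
  rw [dd_add ha.diff hb.diff]
  simp_rw [dd2_add ha hb]
  rw [frS_add]; ring

theorem Lop_sub (v : Fin n → Cn n) (μ : Fin n → ℝ) {a b : Cn n × ℝ → ℝ} {p : Cn n × ℝ}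
    (ha : Sm a p) (hb : Sm b p) :
    Lop v μ (fun q => a q - b q) p = Lop v μ a p - Lop v μ b p := by
  unfold Lop
  rw [dd_sub ha.diff hb.diff]
  simp_rw [dd2_sub ha hb]
  rw [frS_sub]; ring

theorem Lop_const (v : Fin n → Cn n) (μ : Fin n → ℝ) (c : ℝ) (p : Cn n × ℝ) :
    Lop v μ (fun _ => c) p = 0 := by
  unfold Lop
  rw [dd_const]
  simp_rw [dd2_const]
  simp [frS]

theorem Lop_mul (v : Fin n → Cn n) (μ : Fin n → ℝ) {a b : Cn n × ℝ → ℝ} {p : Cn n × ℝ}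
    (ha : Sm a p) (hb : Sm b p) :
    Lop v μ (fun q => a q * b q) p = a p * Lop v μ b p + b p * Lop v μ a p
      - 2 * Gam v μ a b p := by
  unfold Lop Gam
  rw [dd_mul ha.diff hb.diff]
  simp_rw [dd2_mul ha hb]
  rw [frS_add, frS_add, frS_add, frS_smul, frS_smul]; ring

theorem Lop_cmul (v : Fin n → Cn n) (μ : Fin n → ℝ) (c : ℝ) {b : Cn n × ℝ → ℝ} {p : Cn n × ℝ}
    (hb : Sm b p) :
    Lop v μ (fun q => c * b q) p = c * Lop v μ b p := by
  rw [Lop_mul v μ (Sm.const c p) hb, Lop_const]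
  simp [Gam, dd_const, frS]

theorem dt_nonpos_of_min {W : Cn n × ℝ → ℝ} {z : Cn n} {t t0 : ℝ} (h : Sm W (z, t)) (ht : t0 < t)
    (hm : ∀ s ∈ Icc t0 t, W (z, t) ≤ W (z, s)) : dd ((0 : Cn n), (1 : ℝ)) W (z, t) ≤ 0 := by
  have hd : HasDerivAt (fun r : ℝ => W ((z, t) + r • ((0 : Cn n), (1 : ℝ))))
      (dd ((0 : Cn n), (1 : ℝ)) W (z, t)) 0 := hasDerivAt_line h.diff _ (by simp)
  by_contra hpos
  push Not at hpos
  have hs := hasDerivWithinAt_iff_tendsto_slope.1 (hd.hasDerivWithinAt (s := Iio 0))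
  have hev := hs.eventually (lt_mem_nhds hpos)
  rw [show Iio (0:ℝ) \ {0} = Iio 0 by simp] at hev
  have hev2 : ∀ᶠ r in 𝓝[<] (0:ℝ), t0 - t < r :=
    (lt_mem_nhds (show t0 - t < 0 by linarith)).filter_mono nhdsWithin_le_nhds
  obtain ⟨r, hr1, hr2, hr3⟩ := (hev.and (hev2.and self_mem_nhdsWithin)).exists
  have hr3' : r < 0 := hr3
  have := hm (t + r) ⟨by linarith, by linarith⟩
  rw [slope_def_field] at hr1
  simp at hr1
  have h4 : W (z, t + r) - W (z, t) ≥ 0 := by linarith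
  have : (W (z, t + r) - W (z, t)) / r ≤ 0 := div_nonpos_of_nonneg_of_nonpos h4 hr3'.le
  linarith

theorem slice_min {W : Cn n × ℝ → ℝ} {Ω : Set (Cn n)} (hΩ : IsOpen Ω) {z : Cn n} {t : ℝ}
    (hz : z ∈ Ω) (h : Sm W (z, t)) (hm : ∀ y ∈ Ω, W (z, t) ≤ W (y, t)) (e : Cn n) :
    dd (e, (0 : ℝ)) W (z, t) = 0 ∧ 0 ≤ dd (e, (0 : ℝ)) (dd (e, (0 : ℝ)) W) (z, t) := by
  apply min_second h
  have hc : Tendsto (fun s : ℝ => z + s • e) (𝓝 0) (𝓝 z) := by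
    have : Continuous fun s : ℝ => z + s • e := by fun_prop
    simpa using this.tendsto 0
  filter_upwards [hc.eventually (hΩ.mem_nhds hz)] with s hs
  simpa using hm _ hs

/-- Parabolic minimum principle. -/
theorem min_principle {Ω : Set (Cn n)} (hΩ : IsOpen Ω) (hb : IsBounded Ω) {t0 t1 : ℝ}
    {W : Cn n × ℝ → ℝ} (hc : ContinuousOn W (closure Ω ×ˢ Icc t0 t1))
    (hs : ∀ z ∈ Ω, ∀ t ∈ Ioc t0 t1, Sm W (z, t))
    (h0 : ∀ z ∈ closure Ω, 0 ≤ W (z, t0))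
    (hbd : ∀ z ∈ frontier Ω, ∀ t ∈ Icc t0 t1, 0 ≤ W (z, t))
    (hL : ∀ z ∈ Ω, ∀ t ∈ Ioc t0 t1, W (z, t) < 0 →
      ∃ (v : Fin n → Cn n) (μ : Fin n → ℝ), (∀ a, 0 ≤ μ a) ∧ 0 < Lop v μ W (z, t)) :
    ∀ z ∈ closure Ω, ∀ t ∈ Icc t0 t1, 0 ≤ W (z, t) := by
  intro z hz t ht
  have hK : IsCompact (closure Ω ×ˢ Icc t0 t1) :=
    (hb.isCompact_closure).prod isCompact_Icc
  obtain ⟨⟨y, s⟩, hys, hmin⟩ := hK.exists_isMinOn ⟨(z, t), hz, ht⟩ hc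
  have hmin' : ∀ x ∈ closure Ω, ∀ r ∈ Icc t0 t1, W (y, s) ≤ W (x, r) :=
    fun x hx r hr => hmin (show (x, r) ∈ closure Ω ×ˢ Icc t0 t1 from ⟨hx, hr⟩)
  obtain ⟨hy, hs1⟩ : y ∈ closure Ω ∧ s ∈ Icc t0 t1 := hys
  refine le_trans ?_ (hmin' z hz t ht)
  by_contra hneg
  push Not at hneg
  have hst : t0 < s := by
    rcases lt_or_eq_of_le hs1.1 with h | h
    · exact h
    · rw [← h] at hneg; exact absurd (h0 y hy) (not_le.2 hneg)
  have hyΩ : y ∈ Ω := by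
    by_contra hno
    have : y ∈ frontier Ω := ⟨hy, by rwa [hΩ.interior_eq]⟩
    exact absurd (hbd y this s hs1) (not_le.2 hneg)
  obtain ⟨v, μ, hμ, hLp⟩ := hL y hyΩ s ⟨hst, hs1.2⟩ hneg
  have hsm := hs y hyΩ s ⟨hst, hs1.2⟩
  have h1 : dd ((0 : Cn n), (1 : ℝ)) W (y, s) ≤ 0 :=
    dt_nonpos_of_min hsm hst fun r hr => hmin' y hy r ⟨hr.1, hr.2.trans hs1.2⟩
  have h2 : 0 ≤ frS v μ (fun e => dd (e, (0 : ℝ)) (dd (e, (0 : ℝ)) W) (y, s)) :=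
    frS_nonneg hμ fun e => (slice_min hΩ hyΩ hsm
      (fun x hx => hmin' x (subset_closure hx) s hs1) e).2
  unfold Lop at hLp
  linarith

section linalg
open scoped Matrix
/-! ## Linear algebra: complex frames -/

/-- Sesquilinear form of a matrix. -/
def hf (M : Matrix (Fin n) (Fin n) ℂ) (X Y : Cn n) : ℂ :=
  ∑ α, ∑ β, M α β * X α * (starRingEnd ℂ) (Y β)

theorem hasDerivAt_det_diag {G : ℝ → Matrix (Fin n) (Fin n) ℂ} {G' : Matrix (Fin n) (Fin n) ℂ}
    {d : Fin n → ℂ} (hG : ∀ i j, HasDerivAt (fun s => G s i j) (G' i j) 0)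
    (h0 : G 0 = Matrix.diagonal d) :
    HasDerivAt (fun s => (G s).det) (∑ a, (∏ b ∈ Finset.univ.erase a, d b) * G' a a) 0 := by
  let D : ContinuousMultilinearMap ℂ (fun _ : Fin n => Fin n → ℂ) ℂ :=
    { toMultilinearMap := (Matrix.detRowAlternating (n := Fin n) (R := ℂ)).toMultilinearMap
      cont := by
        change Continuous fun M : Matrix (Fin n) (Fin n) ℂ => M.det
        exact continuous_id.matrix_det }
  have hD : ∀ M : Matrix (Fin n) (Fin n) ℂ, D M = M.det := fun M => rfl
  let g : ℝ → Fin n → Fin n → ℂ := fun s i j => G s i j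
  let g' : Fin n → Fin n → ℂ := fun i j => G' i j
  have h1 : HasFDerivAt D (D.linearDeriv (g 0)) (g 0) := D.hasFDerivAt (x := (g 0))
  have h2 : HasDerivAt g g' 0 := by
    rw [hasDerivAt_pi]
    intro i
    rw [hasDerivAt_pi]
    intro j
    exact hG i j
  have h3 := (h1.restrictScalars ℝ).comp_hasDerivAt (0 : ℝ) h2
  refine HasDerivAt.congr_deriv (f' := D.linearDeriv (g 0) g') h3 ?_
  rw [ContinuousMultilinearMap.linearDeriv_apply]
  refine Finset.sum_congr rfl fun a _ => ?_
  change (Matrix.updateRow (G 0) a (G' a)).det = _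
  rw [← Matrix.cramer_transpose_apply, Matrix.cramer_eq_adjugate_mulVec, h0,
    Matrix.diagonal_transpose, Matrix.adjugate_diagonal, Matrix.mulVec_diagonal]

theorem frame_alg (H : Matrix (Fin n) (Fin n) ℂ) (hH : H.PosDef) :
    ∃ (v : OrthonormalBasis (Fin n) ℂ (Cn n)) (lam : Fin n → ℝ), (∀ a, 0 < lam a) ∧
      H.det = ∏ a, (lam a : ℂ) ∧
      (∀ X a, hf H X (v a) = lam a * inner ℂ (v a) X) ∧
      (∀ (M : ℝ → Matrix (Fin n) (Fin n) ℂ) (M' : Matrix (Fin n) (Fin n) ℂ), M 0 = H →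
        (∀ i j, HasDerivAt (fun s => M s i j) (M' i j) 0) →
        HasDerivAt (fun s => (M s).det)
          (∑ a, (∏ b ∈ Finset.univ.erase a, (lam b : ℂ)) * hf M' (v a) (v a)) 0) := by
  have hT : (Hᵀ).PosDef := hH.transpose
  have hA := hT.1
  have hself : ∀ Y a, hf H (hA.eigenvectorBasis a) Y =
      hA.eigenvalues a * inner ℂ Y (hA.eigenvectorBasis a) := by
    intro Y a
    have h := hA.mulVec_eigenvectorBasis a
    have hβ : ∀ β, ∑ α, H α β * hA.eigenvectorBasis a α =
        hA.eigenvalues a * hA.eigenvectorBasis a β := by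
      intro β
      have := congrFun h β
      simpa [Matrix.mulVec, dotProduct] using this
    unfold hf
    rw [Finset.sum_comm]
    simp_rw [← Finset.sum_mul, hβ]
    rw [PiLp.inner_apply, Finset.mul_sum]
    refine Finset.sum_congr rfl fun β _ => ?_
    simp; ring
  have hconj : ∀ X Y, hf H X Y = (starRingEnd ℂ) (hf H Y X) := by
    intro X Y
    unfold hf
    rw [map_sum, Finset.sum_comm]
    refine Finset.sum_congr rfl fun β _ => ?_
    rw [map_sum]
    refine Finset.sum_congr rfl fun α _ => ?_
    have : H α β = (starRingEnd ℂ) (H β α) := by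
      have := congrFun (congrFun hH.1 α) β
      simpa [Matrix.conjTranspose_apply] using this.symm
    rw [this]; simp; ring
  refine ⟨hA.eigenvectorBasis, hA.eigenvalues, fun a => hT.eigenvalues_pos a, ?_, ?_, ?_⟩
  · rw [← Matrix.det_transpose, hA.det_eq_prod_eigenvalues]; rfl
  · intro X a
    rw [hconj, hself, map_mul, inner_conj_symm, Complex.conj_ofReal]
  · intro M M' hM0 hM
    set U : Matrix (Fin n) (Fin n) ℂ := (hA.eigenvectorUnitary : Matrix (Fin n) (Fin n) ℂ) with hU
    have hUU : Uᴴ * U = 1 := by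
      have := Unitary.coe_star_mul_self hA.eigenvectorUnitary
      simpa [Matrix.star_eq_conjTranspose] using this
    have hG : ∀ N : Matrix (Fin n) (Fin n) ℂ, ∀ a b, (Uᴴ * Nᵀ * U) a b =
        hf N (hA.eigenvectorBasis b) (hA.eigenvectorBasis a) := by
      intro N a b
      simp only [Matrix.mul_apply, hf, Matrix.conjTranspose_apply, Matrix.transpose_apply, hU,
        Matrix.IsHermitian.eigenvectorUnitary_apply, Finset.sum_mul]
      refine Finset.sum_congr rfl fun α _ => Finset.sum_congr rfl fun β _ => ?_
      simp; ring
    have hdet : ∀ N : Matrix (Fin n) (Fin n) ℂ, (Uᴴ * Nᵀ * U).det = N.det := by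
      intro N
      rw [Matrix.det_mul, Matrix.det_mul, Matrix.det_transpose]
      have : Uᴴ.det * U.det = 1 := by rw [← Matrix.det_mul, hUU, Matrix.det_one]
      linear_combination N.det * this
    have := hasDerivAt_det_diag (G := fun s => Uᴴ * (M s)ᵀ * U) (G' := Uᴴ * M'ᵀ * U)
      (d := fun a => (hA.eigenvalues a : ℂ)) ?_ ?_
    · simp_rw [hdet, hG] at this
      exact this
    · intro i j
      simp_rw [hG]
      unfold hf
      refine HasDerivAt.fun_sum fun α _ => HasDerivAt.fun_sum fun β _ => ?_
      exact ((hM α β).mul_const _).mul_const _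
    · ext a b
      rw [hM0, hG, hself, OrthonormalBasis.inner_eq_ite]
      by_cases hab : a = b
      · subst hab; simp
      · simp [hab]
end linalg

/-! ## Complex Hessian in terms of directional derivatives -/

/-- Spatial second derivative as a bilinear map. -/
def Bil (u : Cn n × ℝ → ℝ) (p : Cn n × ℝ) (h : Sm u p) : Cn n →ₗ[ℝ] Cn n →ₗ[ℝ] ℝ :=
  LinearMap.mk₂ ℝ (fun X Y => dd (X, (0 : ℝ)) (dd (Y, (0 : ℝ)) u) p)
    (by
      intro X X' Y
      rw [show (X + X', (0 : ℝ)) = (X, 0) + (X', 0) by simp, dd_vadd])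
    (by
      intro c X Y
      rw [show (c • X, (0 : ℝ)) = c • (X, (0 : ℝ)) by simp, dd_vsmul]; rfl)
    (by
      intro X Y Y'
      rw [dd_comm h, show (Y + Y', (0 : ℝ)) = (Y, 0) + (Y', 0) by simp, dd_vadd, dd_comm h,
        dd_comm h (Y', 0)])
    (by
      intro c X Y
      rw [dd_comm h, show (c • Y, (0 : ℝ)) = c • (Y, (0 : ℝ)) by simp, dd_vsmul, dd_comm h]; rfl)

theorem Bil_apply (u : Cn n × ℝ → ℝ) (p : Cn n × ℝ) (h : Sm u p) (X Y : Cn n) :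
    Bil u p h X Y = dd (X, (0 : ℝ)) (dd (Y, (0 : ℝ)) u) p := rfl

/-- Sesquilinear form associated with a real bilinear form. -/
def sesq (b : Cn n →ₗ[ℝ] Cn n →ₗ[ℝ] ℝ) (X Y : Cn n) : ℂ :=
  ((b X Y + b (Complex.I • X) (Complex.I • Y) : ℝ) +
    Complex.I * (b X (Complex.I • Y) - b (Complex.I • X) Y : ℝ)) / 4

theorem csmul_decomp (c : ℂ) (X : Cn n) : c • X = c.re • X + c.im • (Complex.I • X) := by
  conv_lhs => rw [← Complex.re_add_im c]
  rw [add_smul, mul_smul]; rfl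

theorem I_I_smul (X : Cn n) : Complex.I • (Complex.I • X) = - X := by
  rw [smul_smul, Complex.I_mul_I]; simp

theorem I_rsmul (r : ℝ) (X : Cn n) : Complex.I • (r • X) = r • (Complex.I • X) :=
  smul_comm _ _ _

theorem sesq_add_left (b : Cn n →ₗ[ℝ] Cn n →ₗ[ℝ] ℝ) (X X' Y : Cn n) :
    sesq b (X + X') Y = sesq b X Y + sesq b X' Y := by
  unfold sesq
  simp only [smul_add, map_add, LinearMap.add_apply]
  push_cast; ring

theorem sesq_add_right (b : Cn n →ₗ[ℝ] Cn n →ₗ[ℝ] ℝ) (X Y Y' : Cn n) :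
    sesq b X (Y + Y') = sesq b X Y + sesq b X Y' := by
  unfold sesq
  simp only [smul_add, map_add]
  push_cast; ring

theorem sesq_smul_left (b : Cn n →ₗ[ℝ] Cn n →ₗ[ℝ] ℝ) (c : ℂ) (X Y : Cn n) :
    sesq b (c • X) Y = c * sesq b X Y := by
  unfold sesq
  rw [csmul_decomp c X]
  simp only [smul_add, map_add, LinearMap.add_apply, I_rsmul, I_I_smul, map_smul, map_neg,
    LinearMap.smul_apply, LinearMap.neg_apply, smul_eq_mul]
  push_cast
  apply Complex.ext <;> simp <;> ring

theorem sesq_smul_right (b : Cn n →ₗ[ℝ] Cn n →ₗ[ℝ] ℝ) (c : ℂ) (X Y : Cn n) :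
    sesq b X (c • Y) = (starRingEnd ℂ) c * sesq b X Y := by
  unfold sesq
  rw [csmul_decomp c Y]
  simp only [smul_add, map_add, LinearMap.add_apply, I_rsmul, I_I_smul, map_smul, map_neg,
    LinearMap.smul_apply, LinearMap.neg_apply, smul_eq_mul]
  push_cast
  apply Complex.ext <;> simp <;> ring

theorem cvec_smul (α : Fin n) (c : ℂ) : cvec n α c = c • cvec n α 1 := by
  unfold cvec; ext i; simp [Pi.single_apply]

theorem cvec_sum (X : Cn n) : X = ∑ α, X α • cvec n α 1 := by
  ext i
  simp [cvec, Pi.single_apply]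

theorem sesq_sum_left (b : Cn n →ₗ[ℝ] Cn n →ₗ[ℝ] ℝ) (X : Fin n → Cn n) (Y : Cn n) :
    sesq b (∑ α, X α) Y = ∑ α, sesq b (X α) Y := by
  have := map_sum (AddMonoidHom.mk' (fun X => sesq b X Y) (fun X X' => sesq_add_left b X X' Y))
    X Finset.univ
  exact this

theorem sesq_sum_right (b : Cn n →ₗ[ℝ] Cn n →ₗ[ℝ] ℝ) (X : Cn n) (Y : Fin n → Cn n) :
    sesq b X (∑ α, Y α) = ∑ α, sesq b X (Y α) := by
  have := map_sum (AddMonoidHom.mk' (fun Y => sesq b X Y) (fun Y Y' => sesq_add_right b X Y Y'))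
    Y Finset.univ
  exact this

theorem hf_eq_sesq (b : Cn n →ₗ[ℝ] Cn n →ₗ[ℝ] ℝ) (M : Matrix (Fin n) (Fin n) ℂ)
    (h : ∀ α β, M α β = sesq b (cvec n α 1) (cvec n β 1)) (X Y : Cn n) :
    hf M X Y = sesq b X Y := by
  conv_rhs => rw [cvec_sum X, cvec_sum Y]
  rw [sesq_sum_left]
  unfold hf
  refine Finset.sum_congr rfl fun α _ => ?_
  rw [sesq_sum_right]
  refine Finset.sum_congr rfl fun β _ => ?_
  rw [sesq_smul_left, sesq_smul_right, h]; ring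

theorem slice_fderiv {a : Cn n × ℝ → ℝ} {z : Cn n} {t : ℝ} (h : DifferentiableAt ℝ a (z, t)) :
    HasFDerivAt (fun w => a (w, t)) ((fderiv ℝ a (z, t)).comp (ContinuousLinearMap.inl ℝ _ _)) z :=
  by
    have h1 : HasFDerivAt (fun w : Cn n => (w, t)) (ContinuousLinearMap.inl ℝ (Cn n) ℝ) z :=
      hasFDerivAt_prodMk_left z t
    exact h.hasFDerivAt.comp z h1

theorem slice_fderiv_apply {a : Cn n × ℝ → ℝ} {z : Cn n} {t : ℝ}
    (h : DifferentiableAt ℝ a (z, t)) (e : Cn n) :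
    fderiv ℝ (fun w => a (w, t)) z e = dd (e, (0 : ℝ)) a (z, t) := by
  rw [(slice_fderiv h).fderiv]; simp [dd]

theorem ofReal_fderiv {a : Cn n → ℝ} {z : Cn n} (h : DifferentiableAt ℝ a z) (e : Cn n) :
    fderiv ℝ (fun w => (a w : ℂ)) z e = (fderiv ℝ a z e : ℝ) := by
  have h1 : HasFDerivAt (fun w => (a w : ℂ)) (Complex.ofRealCLM.comp (fderiv ℝ a z)) z :=
    Complex.ofRealCLM.hasFDerivAt.comp z h.hasFDerivAt
  rw [h1.fderiv]; simp

theorem cHess_entry {u : Cn n × ℝ → ℝ} {z : Cn n} {t : ℝ} (h : Sm u (z, t)) (α β : Fin n) :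
    cHess (fun w => u (w, t)) z α β =
      sesq (Bil u (z, t) h) (cvec n α 1) (cvec n β 1) := by
  have hI : ∀ γ : Fin n, cvec n γ Complex.I = Complex.I • cvec n γ 1 := fun γ => cvec_smul γ _
  have hev : ∀ᶠ w in 𝓝 z, DifferentiableAt ℝ u (w, t) := by
    have hc : Tendsto (fun w : Cn n => (w, t)) (𝓝 z) (𝓝 (z, t)) := by
      have : Continuous fun w : Cn n => (w, t) := by fun_prop
      exact this.tendsto z
    exact hc.eventually h.ev
  set e := cvec n β 1
  have h1 : (wderBarW univ β fun w => ((u (w, t) : ℝ) : ℂ)) =ᶠ[𝓝 z] fun w =>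
      (1/2 : ℂ) * ((dd (e, (0 : ℝ)) u (w, t) : ℝ) : ℂ) +
      (Complex.I / 2) * ((dd (Complex.I • e, (0 : ℝ)) u (w, t) : ℝ) : ℂ) := by
    filter_upwards [hev] with w hw
    have hs := (slice_fderiv hw).differentiableAt
    unfold wderBarW
    rw [fderivWithin_univ, ofReal_fderiv hs, ofReal_fderiv hs, slice_fderiv_apply hw,
      slice_fderiv_apply hw, hI]
    ring
  have hd1 := (h.dd (e, (0 : ℝ))).diff
  have hd2 := (h.dd (Complex.I • e, (0 : ℝ))).diff
  have hs1 := (slice_fderiv hd1).differentiableAt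
  have hs2 := (slice_fderiv hd2).differentiableAt
  have hf1 : ∀ x, fderiv ℝ (wderBarW univ β fun w => ((u (w, t) : ℝ) : ℂ)) z x =
      (1/2 : ℂ) * ((dd (x, (0 : ℝ)) (dd (e, (0 : ℝ)) u) (z, t) : ℝ) : ℂ) +
      (Complex.I / 2) * ((dd (x, (0 : ℝ)) (dd (Complex.I • e, (0 : ℝ)) u) (z, t) : ℝ) : ℂ) := by
    intro x
    have hc1 : DifferentiableAt ℝ (fun w => ((dd (e, (0 : ℝ)) u (w, t) : ℝ) : ℂ)) z :=
      Complex.ofRealCLM.differentiableAt.comp z hs1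
    have hc2 : DifferentiableAt ℝ (fun w => ((dd (Complex.I • e, (0 : ℝ)) u (w, t) : ℝ) : ℂ)) z :=
      Complex.ofRealCLM.differentiableAt.comp z hs2
    rw [h1.fderiv_eq, fderiv_fun_add (hc1.const_mul _) (hc2.const_mul _),
      fderiv_const_mul hc1, fderiv_const_mul hc2]
    simp only [ContinuousLinearMap.add_apply, ContinuousLinearMap.smul_apply, smul_eq_mul]
    rw [ofReal_fderiv hs1, ofReal_fderiv hs2, slice_fderiv_apply hd1, slice_fderiv_apply hd2]
  have : cHess (fun w => u (w, t)) z α β =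
      wderW univ α (wderBarW univ β fun w => ((u (w, t) : ℝ) : ℂ)) z := rfl
  rw [this]
  unfold wderW sesq
  rw [fderivWithin_univ, hf1, hf1, hI]
  simp only [Bil_apply]
  apply Complex.ext <;> simp <;> ring

/-- The real Hermitian-symmetrised Hessian. -/
def Qf (u : Cn n × ℝ → ℝ) (p : Cn n × ℝ) (X Y : Cn n) : ℝ :=
  dd (X, (0 : ℝ)) (dd (Y, (0 : ℝ)) u) p +
    dd (Complex.I • X, (0 : ℝ)) (dd (Complex.I • Y, (0 : ℝ)) u) p

theorem hf_re {u : Cn n × ℝ → ℝ} {z : Cn n} {t : ℝ} (h : Sm u (z, t)) (X Y : Cn n) :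
    4 * (hf (cHess (fun w => u (w, t)) z) X Y).re = Qf u (z, t) X Y := by
  rw [hf_eq_sesq _ _ (cHess_entry h)]
  unfold sesq Qf
  simp only [Bil_apply]
  simp
  ring

theorem sesq_self {u : Cn n × ℝ → ℝ} {p : Cn n × ℝ} (h : Sm u p) (X : Cn n) :
    sesq (Bil u p h) X X = ((Qf u p X X / 4 : ℝ) : ℂ) := by
  unfold sesq Qf
  simp only [Bil_apply]
  rw [dd_comm h (X, 0) (Complex.I • X, 0)]
  simp

/-- Existence of adapted frames. -/
theorem frame_exists {O : Set (Cn n × ℝ)} (hO : IsOpen O) {u F : Cn n × ℝ → ℝ}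
    (hu : ∀ p ∈ O, Sm u p)
    (hpos : ∀ z t, (z, t) ∈ O → (cHess (fun w => u (w, t)) z).PosDef)
    (hpde : ∀ z t, (z, t) ∈ O → dd ((0 : Cn n), (1 : ℝ)) u (z, t) =
      Real.log ((cHess (fun w => u (w, t)) z).det.re) + F (z, t))
    {p : Cn n × ℝ} (hp : p ∈ O) (hF : DifferentiableAt ℝ F p) :
    ∃ (v : OrthonormalBasis (Fin n) ℂ (Cn n)) (μ : Fin n → ℝ), (∀ a, 0 < μ a) ∧
      (∀ X a, Qf u p X (v a) = (inner ℂ (v a) X : ℂ).re / μ a) ∧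
      (∀ X a, Qf u p X (Complex.I • v a) = (inner ℂ (v a) X : ℂ).im / μ a) ∧
      dd ((0 : Cn n), (1 : ℝ)) u p = - ∑ a, Real.log (4 * μ a) + F p ∧
      ∀ X, Lop v μ (dd X u) p = dd X F p := by
  obtain ⟨z, t⟩ := p
  have hsm := hu _ hp
  obtain ⟨v, lam, hlam, hdet, hv, hder⟩ := frame_alg _ (hpos z t hp)
  have hdetre : (cHess (fun w => u (w, t)) z).det = ((∏ a, lam a : ℝ) : ℂ) := by
    rw [hdet]; push_cast; rfl
  have hprodpos : 0 < ∏ a, lam a := Finset.prod_pos fun a _ => hlam a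
  refine ⟨v, fun a => 1 / (4 * lam a), fun a => by have := hlam a; positivity, ?_, ?_, ?_, ?_⟩
  · intro X a
    rw [← hf_re hsm, hv]
    have := (hlam a).ne'
    simp
    field_simp
  · intro X a
    rw [← hf_re hsm, hf_eq_sesq _ _ (cHess_entry hsm), sesq_smul_right,
      ← hf_eq_sesq _ _ (cHess_entry hsm), hv]
    have := (hlam a).ne'
    simp
    field_simp
  · rw [hpde z t hp, hdetre, Complex.ofReal_re, Real.log_prod (fun a _ => (hlam a).ne')]
    congr 1
    rw [← Finset.sum_neg_distrib]
    refine Finset.sum_congr rfl fun a _ => ?_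
    have := (hlam a).ne'
    rw [show 4 * (1 / (4 * lam a)) = (lam a)⁻¹ by field_simp, Real.log_inv]; ring
  · intro X
    have hline : Tendsto (fun s : ℝ => (z, t) + s • X) (𝓝 0) (𝓝 (z, t)) := by
      have : Continuous fun s : ℝ => (z, t) + s • X := by fun_prop
      simpa using this.tendsto 0
    have hevO : ∀ᶠ s in 𝓝 (0 : ℝ), (z, t) + s • X ∈ O := hline.eventually (hO.mem_nhds hp)
    -- the matrix along the line
    set M : ℝ → Matrix (Fin n) (Fin n) ℂ := fun s =>
      cHess (fun w => u (w, t + s * X.2)) (z + s • X.1) with hM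
    have hXsm : Sm (dd X u) (z, t) := hsm.dd X
    set M' : Matrix (Fin n) (Fin n) ℂ := Matrix.of fun α β =>
      sesq (Bil (dd X u) (z, t) hXsm) (cvec n α 1) (cvec n β 1) with hM'
    have hM0 : M 0 = cHess (fun w => u (w, t)) z := by simp [hM]
    have hthird : ∀ e e' : Cn n, HasDerivAt (fun s : ℝ =>
        dd (e, (0 : ℝ)) (dd (e', (0 : ℝ)) u) ((z, t) + s • X))
        (dd (e, (0 : ℝ)) (dd (e', (0 : ℝ)) (dd X u)) (z, t)) 0 := by
      intro e e'
      have h1 := hasDerivAt_line (p := (z, t)) (q := (z, t)) (s := 0)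
        (((hsm.dd (e', (0:ℝ))).dd (e, (0 : ℝ))).diff) X (by simp)
      refine h1.congr_deriv ?_
      rw [dd_comm (hsm.dd _)]
      apply dd_congr
      filter_upwards [hO.mem_nhds hp] with q hq
      exact dd_comm (hu q hq) _ _
    have hMder : ∀ i j, HasDerivAt (fun s => M s i j) (M' i j) 0 := by
      intro α β
      have hev : (fun s => M s α β) =ᶠ[𝓝 0] fun s =>
          (((dd (cvec n α 1, (0 : ℝ)) (dd (cvec n β 1, (0 : ℝ)) u) ((z, t) + s • X) +
          dd (Complex.I • cvec n α 1, (0 : ℝ)) (dd (Complex.I • cvec n β 1, (0 : ℝ)) u)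
            ((z, t) + s • X) : ℝ) : ℂ) +
          Complex.I * ((dd (cvec n α 1, (0 : ℝ)) (dd (Complex.I • cvec n β 1, (0 : ℝ)) u)
            ((z, t) + s • X) -
          dd (Complex.I • cvec n α 1, (0 : ℝ)) (dd (cvec n β 1, (0 : ℝ)) u)
            ((z, t) + s • X) : ℝ) : ℂ)) / 4 := by
        filter_upwards [hevO] with s hs
        have hs' : (z, t) + s • X = (z + s • X.1, t + s * X.2) := by
          ext <;> simp
        rw [hs'] at hs ⊢
        simp only [hM]
        rw [cHess_entry (hu _ hs)]
        rfl
      refine HasDerivAt.congr_of_eventuallyEq ?_ hev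
      have := ((((hthird (cvec n α 1) (cvec n β 1)).add
        (hthird (Complex.I • cvec n α 1) (Complex.I • cvec n β 1))).ofReal_comp).add
        (((hthird (cvec n α 1) (Complex.I • cvec n β 1)).sub
        (hthird (Complex.I • cvec n α 1) (cvec n β 1))).ofReal_comp.const_mul
          Complex.I)).div_const 4
      exact this
    have hd := hder M M' hM0 hMder
    have hval : ∀ a, hf M' (v a) (v a) = ((Qf (dd X u) (z, t) (v a) (v a) / 4 : ℝ) : ℂ) := by
      intro a
      rw [hf_eq_sesq (Bil (dd X u) (z, t) hXsm) M' (fun α β => rfl), sesq_self]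
    simp_rw [hval] at hd
    have hdre : HasDerivAt (fun s => ((M s).det).re)
        (∑ a, (∏ b ∈ Finset.univ.erase a, lam b) * (Qf (dd X u) (z, t) (v a) (v a) / 4)) 0 := by
      have h1 := (Complex.reCLM.hasFDerivAt).comp_hasDerivAt (0 : ℝ) hd
      refine h1.congr_deriv ?_
      simp only [← Complex.ofReal_prod, ← Complex.ofReal_mul, ← Complex.ofReal_sum]
      simp only [Complex.reCLM_apply, Complex.ofReal_re]
    have hM0re : ((M 0).det).re = ∏ a, lam a := by
      rw [hM0, hdetre, Complex.ofReal_re]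
    have hlog := hdre.log (by rw [hM0re]; exact hprodpos.ne')
    have hFd := hasDerivAt_line (p := (z, t)) (q := (z, t)) (s := 0) hF X (by simp)
    have hrhs := hlog.add hFd
    have hlhs := hasDerivAt_line (p := (z, t)) (q := (z, t)) (s := 0)
      ((hsm.dd ((0 : Cn n), (1 : ℝ))).diff) X (by simp)
    have heq : (fun s : ℝ => dd ((0 : Cn n), (1 : ℝ)) u ((z, t) + s • X)) =ᶠ[𝓝 0]
        fun s => Real.log (((M s).det).re) + F ((z, t) + s • X) := by
      filter_upwards [hevO] with s hs
      have hs' : (z, t) + s • X = (z + s • X.1, t + s * X.2) := by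
        ext <;> simp
      rw [hs'] at hs ⊢
      rw [hpde _ _ hs]
    have hfin := hlhs.unique (hrhs.congr_of_eventuallyEq heq)
    rw [dd_comm hsm] at hfin
    unfold Lop
    rw [hfin]
    have : (∑ a, (∏ b ∈ Finset.univ.erase a, lam b) * (Qf (dd X u) (z, t) (v a) (v a) / 4)) /
        ((M 0).det).re = frS v (fun a => 1 / (4 * lam a))
          (fun e => dd (e, (0 : ℝ)) (dd (e, (0 : ℝ)) (dd X u)) (z, t)) := by
      rw [hM0re, Finset.sum_div]
      unfold frS
      refine Finset.sum_congr rfl fun a _ => ?_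
      rw [← Finset.mul_prod_erase Finset.univ lam (Finset.mem_univ a)]
      have h1 := (hlam a).ne'
      have h2 : ∏ b ∈ Finset.univ.erase a, lam b ≠ 0 :=
        (Finset.prod_pos fun b _ => hlam b).ne'
      unfold Qf
      field_simp
    rw [this]; ring

/-! ### Domain data -/

section iter
variable {G : Type*} [NormedAddCommGroup G] [NormedSpace ℝ G]

theorem dd_iter {h : G → ℝ} {z : G} (hs : Sm h z) (k : ℕ) (X : G) (m : Fin k → G) :
    dd X (fun y => iteratedFDeriv ℝ k h y m) z = iteratedFDeriv ℝ (k + 1) h z (Fin.cons X m) := by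
  have hd : DifferentiableAt ℝ (iteratedFDeriv ℝ k h) z :=
    ContDiffAt.differentiableAt_iteratedFDeriv (n := (⊤ : ℕ∞)) hs
      (by exact_mod_cast WithTop.coe_lt_top k)
  rw [iteratedFDeriv_succ_apply_left]
  unfold dd
  rw [fderiv_continuousMultilinear_apply_const_apply hd]
  simp

theorem dd1_le {h : G → ℝ} {z : G} (X : G) {K : ℝ}
    (hK : ‖iteratedFDeriv ℝ 1 h z‖ ≤ K) : |dd X h z| ≤ K * ‖X‖ := by
  have h1 : ‖fderiv ℝ h z‖ ≤ K := by
    rwa [← norm_iteratedFDeriv_zero (𝕜 := ℝ) (f := fderiv ℝ h), norm_iteratedFDeriv_fderiv]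
  exact ((fderiv ℝ h z).le_opNorm X).trans (by gcongr)

theorem ddk_le {h : G → ℝ} {z : G} (hs : ∀ᶠ y in 𝓝 z, Sm h y)
    (k : ℕ) (m : Fin k → G) (W : G → ℝ)
    (hW : W =ᶠ[𝓝 z] fun y => iteratedFDeriv ℝ k h y m)
    (X : G) :
    (dd X W) =ᶠ[𝓝 z] (fun y => iteratedFDeriv ℝ (k + 1) h y (Fin.cons X m)) := by
  filter_upwards [hs, hW.eventually_nhds] with y hy hy2
  rw [← dd_iter hy]
  exact dd_congr hy2 X

theorem dd_bound {h : G → ℝ} {z : G} (hs : ∀ᶠ y in 𝓝 z, Sm h y) {K : ℝ} :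
    (‖iteratedFDeriv ℝ 2 h z‖ ≤ K → ∀ X Y, |dd X (dd Y h) z| ≤ K * (‖X‖ * ‖Y‖)) ∧
    (‖iteratedFDeriv ℝ 3 h z‖ ≤ K → ∀ X Y Z, |dd X (dd Y (dd Z h)) z| ≤ K * (‖X‖ * (‖Y‖ * ‖Z‖))) ∧
    (‖iteratedFDeriv ℝ 4 h z‖ ≤ K →
      ∀ X Y Z V, |dd X (dd Y (dd Z (dd V h))) z| ≤ K * (‖X‖ * (‖Y‖ * (‖Z‖ * ‖V‖)))) := by
  have h0 : h =ᶠ[𝓝 z] fun y => iteratedFDeriv ℝ 0 h y (![] : Fin 0 → G) := by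
    filter_upwards with y
    simp
  refine ⟨fun hK X Y => ?_, fun hK X Y Z => ?_, fun hK X Y Z V => ?_⟩
  · have h2 := ddk_le hs _ _ _ (ddk_le hs _ _ _ h0 Y) X
    rw [h2.self_of_nhds]
    refine (ContinuousMultilinearMap.le_of_opNorm_le hK _).trans ?_
    simp [Fin.prod_univ_succ]
  · have h2 := ddk_le hs _ _ _ (ddk_le hs _ _ _ (ddk_le hs _ _ _ h0 Z) Y) X
    rw [h2.self_of_nhds]
    refine (ContinuousMultilinearMap.le_of_opNorm_le hK _).trans ?_
    simp [Fin.prod_univ_succ]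
  · have h2 := ddk_le hs _ _ _ (ddk_le hs _ _ _ (ddk_le hs _ _ _
      (ddk_le hs _ _ _ h0 V) Z) Y) X
    rw [h2.self_of_nhds]
    refine (ContinuousMultilinearMap.le_of_opNorm_le hK _).trans ?_
    simp [Fin.prod_univ_succ]

end iter

/-- Analytic data of a strictly pseudoconvex domain. -/
structure Dom (Ω : Set (Cn n)) (ρ : Cn n → ℝ) (c K : ℝ) : Prop where
  op : IsOpen Ω
  ne : Ω.Nonempty
  bdd : IsBounded Ω
  cpos : 0 < c
  Kpos : 1 ≤ K
  sm : ContDiff ℝ (⊤ : ℕ∞) ρ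
  neg : ∀ z ∈ Ω, ρ z < 0
  zero : ∀ z ∈ frontier Ω, ρ z = 0
  loc : ∀ p ∈ frontier Ω, ∀ᶠ z in 𝓝 p, (ρ z < 0 ↔ z ∈ Ω)
  psh : ∀ z ∈ closure Ω, ∀ X, c * ‖X‖ ^ 2 ≤ dd X (dd X ρ) z +
    dd (Complex.I • X) (dd (Complex.I • X) ρ) z
  bnd : ∀ j ≤ 4, ∀ z, ‖iteratedFDeriv ℝ j ρ z‖ ≤ K
  nor : ∀ p ∈ frontier Ω, ∃ N : Cn n, ‖N‖ = 1 ∧ c ≤ dd N ρ p ∧ dd (Complex.I • N) ρ p = 0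

theorem cutoff {Ω U : Set (Cn n)} {ρ : Cn n → ℝ} (hU : IsOpen U) (hUb : IsBounded U)
    (hcl : closure Ω ⊆ U) (hρ : ContDiffOn ℝ (⊤ : ℕ∞) ρ U) :
    ∃ ρ' : Cn n → ℝ, ContDiff ℝ (⊤ : ℕ∞) ρ' ∧ HasCompactSupport ρ' ∧
      ∀ z ∈ closure Ω, ρ' =ᶠ[𝓝 z] ρ := by
  obtain ⟨f, h0, h1, -⟩ := exists_contMDiffMap_zero_one_nhds_of_isClosed
    (n := (⊤ : ℕ∞)) (modelWithCornersSelf ℝ (Cn n))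
    (s := Uᶜ) (t := closure Ω) hU.isClosed_compl isClosed_closure
    (by rw [Set.disjoint_left]; intro x hx hx2; exact hx (hcl hx2))
  have hf : ContDiff ℝ (⊤ : ℕ∞) f := f.contMDiff.contDiff
  refine ⟨fun z => f z * ρ z, ?_, ?_, ?_⟩
  · rw [contDiff_iff_contDiffAt]
    intro z
    by_cases hz : z ∈ U
    · exact hf.contDiffAt.mul (hρ.contDiffAt (hU.mem_nhds hz))
    · have : ∀ᶠ y in 𝓝 z, f y = 0 := (eventually_nhdsSet_iff_forall.1 h0) z hz
      refine (contDiffAt_const (c := (0 : ℝ))).congr_of_eventuallyEq ?_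
      filter_upwards [this] with y hy
      simp [hy]
  · refine HasCompactSupport.of_support_subset_isCompact hUb.isCompact_closure ?_
    intro z hz
    apply subset_closure
    by_contra hzU
    have : f z = 0 := h0.self_of_nhdsSet z hzU
    simp [this] at hz
  · intro z hz
    filter_upwards [(eventually_nhdsSet_iff_forall.1 h1) z hz] with y hy
    simp [hy]

theorem dd_continuous {ρ : Cn n → ℝ} (h : ContDiff ℝ (⊤ : ℕ∞) ρ) (X : Cn n) :
    ContDiff ℝ (⊤ : ℕ∞) (dd X ρ) :=
  contDiff_iff_contDiffAt.2 fun z => Sm.dd (contDiff_iff_contDiffAt.1 h z) X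

theorem dd2_eq {ρ : Cn n → ℝ} {z : Cn n} (h : Sm ρ z) (X Y : Cn n) :
    dd X (dd Y ρ) z = fderiv ℝ (fderiv ℝ ρ) z X Y := by
  have h1 : DifferentiableAt ℝ (fderiv ℝ ρ) z :=
    (ContDiffAt.fderiv_right (m := 1) h (by
      rw [one_add_one_eq_two]
      simpa using (WithTop.coe_le_coe.2 (le_top : (2 : ℕ∞) ≤ ⊤)))).differentiableAt (by simp)
  have : dd X (dd Y ρ) z = fderiv ℝ (fun y => fderiv ℝ ρ y Y) z X := rfl
  rw [this, fderiv_clm_apply h1 (differentiableAt_const Y)]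
  simp

theorem hf_pos {M : Matrix (Fin n) (Fin n) ℂ} (hM : M.PosDef) {X : Cn n} (hX : X ≠ 0) :
    0 < (hf M X X).re := by
  have h := hM.re_dotProduct_pos (x := fun i => (starRingEnd ℂ) (X i)) (by
    intro h0
    apply hX
    ext i
    have := congrFun h0 i
    simpa using this)
  have e : hf M X X = dotProduct (star fun i => (starRingEnd ℂ) (X i))
      (M.mulVec fun i => (starRingEnd ℂ) (X i)) := by
    unfold hf
    simp only [dotProduct, Matrix.mulVec, Finset.mul_sum, Pi.star_apply]
    refine Finset.sum_congr rfl fun i _ => Finset.sum_congr rfl fun j _ => ?_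
    simp
    ring
  rw [e]
  exact h

theorem dd_fst {h : Cn n → ℝ} {p : Cn n × ℝ} (hd : DifferentiableAt ℝ h p.1) (X : Cn n × ℝ) :
    dd X (fun q : Cn n × ℝ => h q.1) p = dd X.1 h p.1 := by
  have h1 : HasFDerivAt (fun q : Cn n × ℝ => h q.1)
      ((fderiv ℝ h p.1).comp (ContinuousLinearMap.fst ℝ (Cn n) ℝ)) p :=
    hd.hasFDerivAt.comp p hasFDerivAt_fst
  unfold dd
  rw [h1.fderiv]
  simp

theorem Sm_fst {h : Cn n → ℝ} (hd : ContDiff ℝ (⊤ : ℕ∞) h) (p : Cn n × ℝ) :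
    Sm (fun q : Cn n × ℝ => h q.1) p := (hd.comp contDiff_fst).contDiffAt

theorem dd_fst_fun {h : Cn n → ℝ} (hd : ContDiff ℝ (⊤ : ℕ∞) h) (X : Cn n × ℝ) :
    dd X (fun q : Cn n × ℝ => h q.1) = fun p => dd X.1 h p.1 := by
  funext p
  exact dd_fst (hd.contDiffAt.differentiableAt (by simp)) X

theorem exists_dom {Ω : Set (Cn n)} (h : IsSPCDomain Ω) :
    ∃ (ρ : Cn n → ℝ) (c K : ℝ), Dom Ω ρ c K := by
  obtain ⟨hop, hne, hb, U, ρ0, hU, hUb, hcl, hρ0, hpd, hΩ, hD⟩ := h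
  obtain ⟨ρ, hsm, hcs, heq⟩ := cutoff hU hUb hcl hρ0
  have hcomp : IsCompact (closure Ω) := hb.isCompact_closure
  have hfr : IsCompact (frontier Ω) := hcomp.of_isClosed_subset isClosed_frontier
    frontier_subset_closure
  have hval : ∀ z ∈ closure Ω, ρ z = ρ0 z := fun z hz => (heq z hz).self_of_nhds
  have hSm : ∀ z, Sm ρ z := fun z => hsm.contDiffAt
  -- derivative bounds
  have hbd : ∀ j : ℕ, ∃ K : ℝ, ∀ z, ‖iteratedFDeriv ℝ j ρ z‖ ≤ K := by
    intro j
    have hc : Continuous (iteratedFDeriv ℝ j ρ) :=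
      hsm.continuous_iteratedFDeriv (by exact_mod_cast le_top)
    obtain ⟨K, hK⟩ := (hcs.iteratedFDeriv (𝕜 := ℝ) j).exists_bound_of_continuous hc
    exact ⟨K, hK⟩
  choose Kj hKj using hbd
  -- plurisubharmonicity
  have hpsh0 : ∀ z ∈ closure Ω, ∀ X : Cn n, X ≠ 0 → 0 < fderiv ℝ (fderiv ℝ ρ) z X X +
      fderiv ℝ (fderiv ℝ ρ) z (Complex.I • X) (Complex.I • X) := by
    intro z hz X hX
    have h1 : 0 < (hf (cHess ρ0 z) X X).re := hf_pos (hpd z (hcl hz)) hX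
    have h2 : cHess ρ0 z = cHess (fun w => (fun q : Cn n × ℝ => ρ q.1) (w, 0)) z := by
      have e1 : ∀ β, wderBarW univ β (fun w => ((ρ0 w : ℝ) : ℂ)) =ᶠ[𝓝 z]
          wderBarW univ β (fun w => ((ρ w : ℝ) : ℂ)) := by
        intro β
        filter_upwards [(heq z hz).eventually_nhds] with y hy
        have : (fun w => ((ρ0 w : ℝ) : ℂ)) =ᶠ[𝓝 y] fun w => ((ρ w : ℝ) : ℂ) := by
          filter_upwards [hy] with x hx
          rw [hx]
        unfold wderBarW
        rw [fderivWithin_univ, fderivWithin_univ, this.fderiv_eq]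
      ext α β
      change wderW univ α _ z = wderW univ α _ z
      unfold wderW
      rw [fderivWithin_univ, fderivWithin_univ, (e1 β).fderiv_eq]
    rw [h2] at h1
    have h3 := hf_re (u := fun q : Cn n × ℝ => ρ q.1) (z := z) (t := 0) (Sm_fst hsm _) X X
    unfold Qf at h3
    rw [dd_fst_fun hsm, dd_fst_fun hsm, dd_fst_fun (dd_continuous hsm _),
      dd_fst_fun (dd_continuous hsm _)] at h3
    simp only at h3
    rw [dd2_eq (hSm z), dd2_eq (hSm z)] at h3
    linarith
  have hcD1 : Continuous (fderiv ℝ ρ) := hsm.continuous_fderiv (by simp)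
  have hcD2 : Continuous (fderiv ℝ (fderiv ℝ ρ)) :=
    (hsm.fderiv_right (m := (⊤ : ℕ∞)) (by simp)).continuous_fderiv (by simp)
  have hpsh : ∃ c > 0, ∀ z ∈ closure Ω, ∀ X : Cn n, c * ‖X‖ ^ 2 ≤ fderiv ℝ (fderiv ℝ ρ) z X X +
      fderiv ℝ (fderiv ℝ ρ) z (Complex.I • X) (Complex.I • X) := by
    have hS : IsCompact (closure Ω ×ˢ sphere (0 : Cn n) 1) := hcomp.prod (isCompact_sphere 0 1)
    have hcont : Continuous fun q : Cn n × Cn n => fderiv ℝ (fderiv ℝ ρ) q.1 q.2 q.2 +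
      fderiv ℝ (fderiv ℝ ρ) q.1 (Complex.I • q.2) (Complex.I • q.2) := by fun_prop
    have key : ∃ c > 0, ∀ q ∈ closure Ω ×ˢ sphere (0 : Cn n) 1, c ≤
        fderiv ℝ (fderiv ℝ ρ) q.1 q.2 q.2 +
        fderiv ℝ (fderiv ℝ ρ) q.1 (Complex.I • q.2) (Complex.I • q.2) := by
      by_cases hne' : (closure Ω ×ˢ sphere (0 : Cn n) 1).Nonempty
      · obtain ⟨q, hq, hmin⟩ := hS.exists_isMinOn hne' hcont.continuousOn
        refine ⟨_, hpsh0 q.1 hq.1 q.2 ?_, fun q' hq' => hmin hq'⟩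
        intro h0
        have := hq.2
        simp [h0] at this
      · exact ⟨1, one_pos, fun q hq => absurd ⟨q, hq⟩ hne'⟩
    obtain ⟨c, hc, hk⟩ := key
    refine ⟨c, hc, fun z hz X => ?_⟩
    by_cases hX : X = 0
    · simp [hX]
    have hX' : ‖X‖ ≠ 0 := norm_ne_zero_iff.2 hX
    have := hk (z, (‖X‖⁻¹ : ℝ) • X) ⟨hz, by simp [norm_smul, hX']⟩
    simp only [I_rsmul, map_smul, smul_apply, smul_eq_mul] at this
    have h2 : c * ‖X‖ ^ 2 ≤ (‖X‖⁻¹ * (‖X‖⁻¹ * ((fderiv ℝ (fderiv ℝ ρ) z) X) X) +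
      ‖X‖⁻¹ * (‖X‖⁻¹ * ((fderiv ℝ (fderiv ℝ ρ) z) (Complex.I • X)) (Complex.I • X))) * ‖X‖ ^ 2 := by
      gcongr
    refine h2.trans (le_of_eq ?_)
    field_simp
  obtain ⟨c1, hc1, hpsh⟩ := hpsh
  -- normals
  have hD' : ∀ z ∈ frontier Ω, fderiv ℝ ρ z ≠ 0 := by
    intro z hz
    rw [(heq z (frontier_subset_closure hz)).fderiv_eq]
    exact hD z hz
  have hDc : ∃ c > 0, ∀ z ∈ frontier Ω, c ≤ ‖fderiv ℝ ρ z‖ := by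
    by_cases hne' : (frontier Ω).Nonempty
    · obtain ⟨q, hq, hmin⟩ := hfr.exists_isMinOn hne' hcD1.norm.continuousOn
      exact ⟨_, norm_pos_iff.2 (hD' q hq), fun q' hq' => hmin hq'⟩
    · exact ⟨1, one_pos, fun q hq => absurd ⟨q, hq⟩ hne'⟩
  obtain ⟨c2, hc2, hDc⟩ := hDc
  refine ⟨ρ, min c1 (c2 / 2), 1 + ∑ j ∈ Finset.range 5, |Kj j|, hop, hne, hb, by positivity, ?_,
    hsm, ?_, ?_, ?_, ?_, ?_, ?_⟩
  · have : 0 ≤ ∑ j ∈ Finset.range 5, |Kj j| := Finset.sum_nonneg fun _ _ => abs_nonneg _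
    linarith
  · intro z hz
    rw [hval z (subset_closure hz)]
    rw [hΩ] at hz
    exact hz.2
  · intro z hz
    have hz' := frontier_subset_closure hz
    rw [hval z hz']
    apply le_antisymm
    · have : ∀ y ∈ closure Ω, ρ y ≤ 0 := by
        intro y hy
        refine closure_minimal (s := Ω) (t := {y | ρ y ≤ 0}) ?_
          (isClosed_le hsm.continuous continuous_const) hy
        intro x hx
        change ρ x ≤ 0
        rw [hval x (subset_closure hx)]
        rw [hΩ] at hx
        exact hx.2.le
      rw [← hval z hz']
      exact this z hz'
    · by_contra hlt
      have : z ∈ Ω := by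
        rw [hΩ]
        exact ⟨hcl hz', not_le.1 hlt⟩
      rw [hop.frontier_eq] at hz
      exact hz.2 this
  · intro z hz
    have hz' := frontier_subset_closure hz
    filter_upwards [heq z hz', hU.mem_nhds (hcl hz')] with y hy hyU
    rw [hy, hΩ]
    simp [hyU]
  · intro z hz X
    rw [dd2_eq (hSm z), dd2_eq (hSm z)]
    refine le_trans ?_ (hpsh z hz X)
    gcongr
    exact min_le_left _ _
  · intro j hj z
    have : |Kj j| ≤ ∑ j ∈ Finset.range 5, |Kj j| :=
      Finset.single_le_sum (f := fun j => |Kj j|) (fun _ _ => abs_nonneg _)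
        (Finset.mem_range.2 (by omega))
    linarith [hKj j z, le_abs_self (Kj j)]
  · intro p hp
    obtain ⟨X, hX1, hX2⟩ : ∃ X : Cn n, ‖X‖ = 1 ∧ c2 / 2 ≤ |fderiv ℝ ρ p X| := by
      by_contra hcon
      push Not at hcon
      have : ‖fderiv ℝ ρ p‖ ≤ c2 / 2 := by
        refine ContinuousLinearMap.opNorm_le_bound _ (by positivity) fun X => ?_
        by_cases hX : X = 0
        · simp [hX]
        have hX' : ‖X‖ ≠ 0 := norm_ne_zero_iff.2 hX
        have := hcon ((‖X‖⁻¹ : ℝ) • X) (by simp [norm_smul, hX'])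
        rw [map_smul, smul_eq_mul, abs_mul, abs_inv, abs_norm] at this
        have h3 : 0 < ‖X‖ := norm_pos_iff.2 hX
        rw [inv_mul_lt_iff₀ h3] at this
        rw [Real.norm_eq_abs]
        linarith
      linarith [hDc p hp]
    set a := fderiv ℝ ρ p X with ha
    set b := fderiv ℝ ρ p (Complex.I • X) with hb'
    set l : ℂ := ⟨a, -b⟩ with hl
    have hl0 : l ≠ 0 := by
      intro h0
      have : a = 0 := congrArg Complex.re h0
      rw [this, abs_zero] at hX2
      linarith
    have hlpos : 0 < ‖l‖ := norm_pos_iff.2 hl0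
    have hsq : ‖l‖ ^ 2 = a ^ 2 + b ^ 2 := by
      rw [← Complex.normSq_eq_norm_sq, Complex.normSq_apply]
      simp [hl]; ring
    refine ⟨((‖l‖⁻¹ : ℝ) : ℂ) • ((starRingEnd ℂ l) • X), ?_, ?_, ?_⟩
    · rw [norm_smul, norm_smul, hX1]
      simp [hlpos.ne']
    · have : dd (((‖l‖⁻¹ : ℝ) : ℂ) • ((starRingEnd ℂ l) • X)) ρ p = ‖l‖ := by
        unfold dd
        rw [Complex.coe_smul, csmul_decomp, map_smul, map_add, map_smul, map_smul, ← ha, ← hb']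
        simp only [Complex.conj_re, Complex.conj_im, smul_eq_mul, hl, neg_neg]
        rw [← hl, inv_mul_eq_iff_eq_mul₀ hlpos.ne']
        nlinarith [hsq]
      rw [this]
      refine (min_le_right _ _).trans (hX2.trans ?_)
      exact Complex.abs_re_le_norm l
    · unfold dd
      rw [Complex.coe_smul, I_rsmul, csmul_decomp (starRingEnd ℂ l) X, smul_add, I_rsmul, I_rsmul,
        I_I_smul, smul_neg, (fderiv ℝ ρ p).map_smul, map_add, map_neg, (fderiv ℝ ρ p).map_smul,
        (fderiv ℝ ρ p).map_smul, ← ha, ← hb']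
      simp only [Complex.conj_re, Complex.conj_im, smul_eq_mul, hl, neg_neg]
      ring

namespace Dom

variable {Ω : Set (Cn n)} {ρ : Cn n → ℝ} {c K : ℝ}

theorem Sm (D : Dom Ω ρ c K) (z : Cn n) : Sm ρ z := D.sm.contDiffAt

theorem cdd (D : Dom Ω ρ c K) (X : Cn n) : ContDiff ℝ (⊤ : ℕ∞) (dd X ρ) := dd_continuous D.sm X

theorem le0 (D : Dom Ω ρ c K) {z : Cn n} (hz : z ∈ closure Ω) : ρ z ≤ 0 := by
  refine closure_minimal (s := Ω) (t := {y | ρ y ≤ 0}) ?_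
    (isClosed_le D.sm.continuous continuous_const) hz
  intro x hx
  exact (D.neg x hx).le

theorem b0 (D : Dom Ω ρ c K) (z : Cn n) : |ρ z| ≤ K := by
  have := D.bnd 0 (by norm_num) z
  simpa using this

theorem b1 (D : Dom Ω ρ c K) (z X : Cn n) : |dd X ρ z| ≤ K * ‖X‖ :=
  dd1_le X (D.bnd 1 (by norm_num) z)

theorem b2 (D : Dom Ω ρ c K) (z X Y : Cn n) : |dd X (dd Y ρ) z| ≤ K * (‖X‖ * ‖Y‖) :=
  (dd_bound (Eventually.of_forall D.Sm)).1 (D.bnd 2 (by norm_num) z) X Y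

theorem b3 (D : Dom Ω ρ c K) (z X Y Z : Cn n) :
    |dd X (dd Y (dd Z ρ)) z| ≤ K * (‖X‖ * (‖Y‖ * ‖Z‖)) :=
  (dd_bound (Eventually.of_forall D.Sm)).2.1 (D.bnd 3 (by norm_num) z) X Y Z

theorem b4 (D : Dom Ω ρ c K) (z X Y Z V : Cn n) :
    |dd X (dd Y (dd Z (dd V ρ))) z| ≤ K * (‖X‖ * (‖Y‖ * (‖Z‖ * ‖V‖))) :=
  (dd_bound (Eventually.of_forall D.Sm)).2.2 (D.bnd 4 (by norm_num) z) X Y Z V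

theorem lip (D : Dom Ω ρ c K) (S z p : Cn n) : |dd S ρ z - dd S ρ p| ≤ K * ‖S‖ * ‖z - p‖ := by
  have hK : 0 ≤ K := by linarith [D.Kpos]
  refine Convex.norm_image_sub_le_of_norm_fderiv_le (s := univ) (𝕜 := ℝ) (f := dd S ρ)
    (fun x _ => (D.cdd S).contDiffAt.differentiableAt (by simp)) (fun x _ => ?_) convex_univ
    (mem_univ p) (mem_univ z)
  refine ContinuousLinearMap.opNorm_le_bound _ (by positivity) fun X => ?_
  have := D.b2 x X S
  calc ‖fderiv ℝ (dd S ρ) x X‖ = |dd X (dd S ρ) x| := rfl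
    _ ≤ _ := by linarith

theorem mvt (D : Dom Ω ρ c K) (z S : Cn n) {r : ℝ} (hr : 0 < r) :
    ∃ s ∈ Ioo 0 r, ρ (z + r • S) = ρ z + r * dd S ρ (z + s • S) := by
  have hd : ∀ s : ℝ, HasDerivAt (fun s : ℝ => ρ (z + s • S)) (dd S ρ (z + s • S)) s := fun s =>
    hasDerivAt_line ((D.Sm _).diff) S rfl
  obtain ⟨s, hs, he⟩ := exists_hasDerivAt_eq_slope (fun s : ℝ => ρ (z + s • S))
    (fun s => dd S ρ (z + s • S)) hr
    (fun s _ => (hd s).continuousAt.continuousWithinAt) (fun s _ => hd s)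
  refine ⟨s, hs, ?_⟩
  rw [he]
  simp
  field_simp
  ring

theorem nbhd (D : Dom Ω ρ c K) {p S : Cn n} (hp : p ∈ frontier Ω) (a : ℝ) (b : ℝ)
    (hab : dd S ρ p ∈ Ioo a b) :
    ∃ δ > 0, ∀ z, dist z p < δ → ∀ r ∈ Ico 0 δ,
      (ρ (z + r • S) < 0 ↔ z + r • S ∈ Ω) ∧ dd S ρ (z + r • S) ∈ Ioo a b := by
  have h1 : ∀ᶠ z in 𝓝 p, (ρ z < 0 ↔ z ∈ Ω) ∧ dd S ρ z ∈ Ioo a b :=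
    (D.loc p hp).and ((D.cdd S).continuous.continuousAt.eventually (isOpen_Ioo.mem_nhds hab))
  have h2 : Tendsto (fun q : Cn n × ℝ => q.1 + q.2 • S) (𝓝 (p, 0)) (𝓝 p) := by
    have : Continuous (fun q : Cn n × ℝ => q.1 + q.2 • S) := by fun_prop
    simpa using this.tendsto (p, 0)
  obtain ⟨δ, hδ, hb⟩ := Metric.eventually_nhds_iff.1 (h2.eventually h1)
  refine ⟨δ, hδ, fun z hz r hr => hb (y := (z, r)) ?_⟩
  rw [Prod.dist_eq]
  simp only [max_lt_iff]
  refine ⟨hz, ?_⟩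
  rw [Real.dist_eq, sub_zero, abs_of_nonneg hr.1]
  exact hr.2

theorem inward (D : Dom Ω ρ c K) {p S : Cn n} (hp : p ∈ frontier Ω) (hS : dd S ρ p < 0) :
    ∃ δ > 0, ∀ z ∈ closure Ω, dist z p < δ → ∀ r ∈ Ioo 0 δ, z + r • S ∈ Ω := by
  obtain ⟨δ, hδ, h⟩ := D.nbhd hp (dd S ρ p - 1) 0 ⟨by linarith, hS⟩
  refine ⟨δ, hδ, fun z hz hd r hr => ?_⟩
  rw [← (h z hd r ⟨hr.1.le, hr.2⟩).1]
  obtain ⟨s, hs, he⟩ := D.mvt z S hr.1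
  have h2 := (h z hd s ⟨hs.1.le, hs.2.trans hr.2⟩).2.2
  rw [he]
  nlinarith [D.le0 hz, hr.1]

theorem outward (D : Dom Ω ρ c K) {p S : Cn n} (hp : p ∈ frontier Ω) (hS : 0 < dd S ρ p) :
    ∃ δ > (0 : ℝ), ∀ r ∈ Ioo (0 : ℝ) δ, p + r • S ∉ Ω := by
  obtain ⟨δ, hδ, h⟩ := D.nbhd hp 0 (dd S ρ p + 1) ⟨hS, by linarith⟩
  refine ⟨δ, hδ, fun r hr => ?_⟩
  rw [← (h p (by simpa using hδ) r ⟨hr.1.le, hr.2⟩).1]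
  obtain ⟨s, hs, he⟩ := D.mvt p S hr.1
  have h2 := (h p (by simpa using hδ) s ⟨hs.1.le, hs.2.trans hr.2⟩).2.1
  rw [he, D.zero p hp]
  nlinarith [hr.1]

theorem uniqueDiff (D : Dom Ω ρ c K) : UniqueDiffOn ℝ (closure Ω) := by
  intro p hp
  by_cases hpi : p ∈ Ω
  · exact (D.op.uniqueDiffWithinAt hpi).mono subset_closure
  have hpf : p ∈ frontier Ω := by
    rw [D.op.frontier_eq]
    exact ⟨hp, hpi⟩
  refine ⟨?_, subset_closure hp⟩
  have hcone : ∀ S, dd S ρ p < 0 → S ∈ tangentConeAt ℝ (closure Ω) p := by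
    intro S hS
    obtain ⟨δ, hδ, h⟩ := D.inward hpf hS
    refine mem_tangentConeAt_of_add_smul_mem (α := ℝ) (l := 𝓝[>] (0 : ℝ)) (c := fun r => r)
      (tendsto_id'.mpr <| nhdsGT_le_nhdsNE 0) ?_
    filter_upwards [Ioo_mem_nhdsGT hδ] with r hr
    exact subset_closure (h p hp (by simpa using hδ) r hr)
  obtain ⟨N, hN1, hN2, -⟩ := D.nor p hpf
  have hc := D.cpos
  have htop : Submodule.span ℝ (tangentConeAt ℝ (closure Ω) p) = ⊤ := by
    rw [eq_top_iff]
    intro X _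
    have hNm : -N ∈ Submodule.span ℝ (tangentConeAt ℝ (closure Ω) p) :=
      Submodule.subset_span (hcone _ (by rw [dd_vneg]; linarith))
    set k : ℝ := (|dd X ρ p| + 1) / dd N ρ p with hk
    have h1 : X + k • (-N) ∈ Submodule.span ℝ (tangentConeAt ℝ (closure Ω) p) := by
      refine Submodule.subset_span (hcone _ ?_)
      rw [dd_vadd, dd_vsmul, dd_vneg, hk]
      have : dd N ρ p ≠ 0 := by linarith
      field_simp
      linarith [le_abs_self (dd X ρ p)]
    have h2 := Submodule.sub_mem _ h1 (Submodule.smul_mem _ k hNm)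
    simpa using h2
  rw [htop]
  simp

/-- Tangential derivatives of functions vanishing on the boundary vanish. -/
theorem tang (D : Dom Ω ρ c K) {p τ : Cn n} (hp : p ∈ frontier Ω) (hτ : dd τ ρ p = 0)
    {h : Cn n → ℝ} {h' : Cn n →L[ℝ] ℝ} (hd : HasFDerivWithinAt h h' (closure Ω) p)
    (h0 : ∀ z ∈ frontier Ω, h z = 0) : h' τ = 0 := by
  obtain ⟨N, hN1, hN2, -⟩ := D.nor p hp
  have hc := D.cpos
  have key : ∀ δ : ℝ, 0 < δ → |h' τ| ≤ δ * (|h' N| + ‖τ‖ + δ) := by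
    intro δ hδ
    have hd' := hd.isLittleO.def hδ
    rw [Metric.nhdsWithin_basis_ball.eventually_iff] at hd'
    obtain ⟨η, hη, hb⟩ := hd'
    obtain ⟨δ1, hδ1, h1⟩ := D.inward hp (S := τ + δ • (-N)) (by
      rw [dd_vadd, dd_vsmul, dd_vneg, hτ]; nlinarith)
    obtain ⟨δ2, hδ2, h2⟩ := D.outward hp (S := τ + δ • N) (by
      rw [dd_vadd, dd_vsmul, hτ]; nlinarith)
    set M := ‖τ‖ + δ with hM
    have hMpos : 0 < M := by positivity
    obtain ⟨r, hr0, hr⟩ : ∃ r : ℝ, 0 < r ∧ r < min δ1 (min δ2 (η / M)) :=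
      exists_between (by positivity)
    simp only [lt_min_iff] at hr
    have hin := h1 p (frontier_subset_closure hp) (by simpa using hδ1) r ⟨hr0, hr.1⟩
    have hout := h2 r ⟨hr0, hr.2.1⟩
    have hpre : IsPreconnected ((fun s : ℝ => p + r • (τ + s • N)) '' Icc (-δ) δ) :=
      (isPreconnected_Icc).image _ (by fun_prop)
    obtain ⟨q, ⟨s, hs, rfl⟩, hq⟩ : (((fun s : ℝ => p + r • (τ + s • N)) '' Icc (-δ) δ) ∩
        frontier Ω).Nonempty := by
      by_contra hemp
      have hnf : ∀ q ∈ (fun s : ℝ => p + r • (τ + s • N)) '' Icc (-δ) δ, q ∉ Ω →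
          q ∉ closure Ω := by
        intro q hq hqΩ hqc
        exact hemp ⟨q, hq, by rw [D.op.frontier_eq]; exact ⟨hqc, hqΩ⟩⟩
      obtain ⟨q, -, hq1, hq2⟩ := hpre Ω (closure Ω)ᶜ D.op isClosed_closure.isOpen_compl
        (fun q hq => by
          by_cases hqΩ : q ∈ Ω
          · exact Or.inl hqΩ
          · exact Or.inr (hnf q hq hqΩ))
        ⟨_, ⟨-δ, ⟨le_refl _, by linarith⟩, rfl⟩, by simpa using hin⟩
        ⟨_, ⟨δ, ⟨by linarith, le_refl _⟩, rfl⟩, hnf _ ⟨δ, ⟨by linarith, le_refl _⟩, rfl⟩ hout⟩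
      exact hq2 (subset_closure hq1)
    have hsa : |s| ≤ δ := abs_le.2 hs
    have hnorm : ‖r • (τ + s • N)‖ ≤ r * M := by
      rw [norm_smul, Real.norm_of_nonneg hr0.le]
      gcongr
      refine (norm_add_le _ _).trans ?_
      rw [norm_smul, hN1, Real.norm_eq_abs]
      linarith
    have hrM : r * M < η := by
      have := hr.2.2
      rwa [lt_div_iff₀ hMpos] at this
    have hb' := hb (x := p + r • (τ + s • N)) ⟨by
      rw [mem_ball, dist_eq_norm]
      simpa using lt_of_le_of_lt hnorm hrM, frontier_subset_closure hq⟩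
    rw [h0 _ hq, h0 _ hp] at hb'
    simp only [sub_self, zero_sub, norm_neg, add_sub_cancel_left] at hb'
    rw [map_smul, map_add, map_smul, norm_smul, Real.norm_of_nonneg hr0.le] at hb'
    have h5 : r * ‖h' τ + s • h' N‖ ≤ r * (δ * M) := by
      calc _ ≤ _ := hb'
        _ ≤ δ * (r * M) := by gcongr
        _ = _ := by ring
    have h6 := le_of_mul_le_mul_left h5 hr0
    rw [Real.norm_eq_abs, smul_eq_mul] at h6
    have h7 : |h' τ| ≤ |h' τ + s * h' N| + |s| * |h' N| := by
      rw [← abs_mul]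
      have := abs_sub (h' τ + s * h' N) (s * h' N)
      simpa using this
    have h8 : |s| * |h' N| ≤ δ * |h' N| := by gcongr
    rw [hM] at h6
    linarith
  by_contra hne
  have hpos : 0 < |h' τ| := abs_pos.2 hne
  have hlim : Tendsto (fun δ : ℝ => δ * (|h' N| + ‖τ‖ + δ)) (𝓝[>] 0) (𝓝 0) := by
    have : Continuous fun δ : ℝ => δ * (|h' N| + ‖τ‖ + δ) := by fun_prop
    have h2 := this.tendsto 0
    simp only [zero_mul] at h2
    exact h2.mono_left nhdsWithin_le_nhds
  have := ge_of_tendsto hlim (by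
    filter_upwards [self_mem_nhdsWithin] with δ hδ
    exact key δ hδ)
  linarith

end Dom

/-- Spatial gradient up to the boundary. -/
def D1 (Ω : Set (Cn n)) (v : Cn n × ℝ → ℝ) (p : Cn n × ℝ) : Cn n →L[ℝ] ℝ :=
  fderivWithin ℝ (fun x => v (x, p.2)) (closure Ω) p.1

/-- Spatial Hessian up to the boundary. -/
def D2 (Ω : Set (Cn n)) (v : Cn n × ℝ → ℝ) (p : Cn n × ℝ) : Cn n →L[ℝ] Cn n →L[ℝ] ℝ :=
  fderivWithin ℝ (fun y => D1 Ω v (y, p.2)) (closure Ω) p.1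

/-- Time derivative up to the boundary. -/
def Dt (T : ℝ) (v : Cn n × ℝ → ℝ) (p : Cn n × ℝ) : ℝ :=
  derivWithin (fun s => v (p.1, s)) (Ico (0 : ℝ) T) p.2

/-- Regularity package. -/
structure Reg (Ω : Set (Cn n)) (T : ℝ) (v : Cn n × ℝ → ℝ) : Prop where
  sm : ∀ z ∈ Ω, ∀ t ∈ Ioo (0 : ℝ) T, Sm v (z, t)
  c0 : ContinuousOn v (closure Ω ×ˢ Ico (0 : ℝ) T)
  ct : ContinuousOn (Dt T v) (closure Ω ×ˢ Ico (0 : ℝ) T)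
  c1 : ContinuousOn (D1 Ω v) (closure Ω ×ˢ Ioo (0 : ℝ) T)
  c2 : ContinuousOn (D2 Ω v) (closure Ω ×ˢ Ioo (0 : ℝ) T)
  h1 : ∀ z ∈ closure Ω, ∀ t ∈ Ioo (0 : ℝ) T,
    HasFDerivWithinAt (fun x => v (x, t)) (D1 Ω v (z, t)) (closure Ω) z
  h2 : ∀ z ∈ closure Ω, ∀ t ∈ Ioo (0 : ℝ) T,
    HasFDerivWithinAt (fun x => D1 Ω v (x, t)) (D2 Ω v (z, t)) (closure Ω) z
  e1 : ∀ z ∈ Ω, ∀ t ∈ Ioo (0 : ℝ) T, ∀ X, D1 Ω v (z, t) X = dd (X, (0 : ℝ)) v (z, t)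
  e2 : ∀ z ∈ Ω, ∀ t ∈ Ioo (0 : ℝ) T, ∀ X Y,
    D2 Ω v (z, t) X Y = dd (X, (0 : ℝ)) (dd (Y, (0 : ℝ)) v) (z, t)
  et : ∀ z ∈ Ω, ∀ t ∈ Ioo (0 : ℝ) T, Dt T v (z, t) = dd ((0 : Cn n), (1 : ℝ)) v (z, t)
  symm : ∀ z ∈ closure Ω, ∀ t ∈ Ioo (0 : ℝ) T, ∀ X Y, D2 Ω v (z, t) X Y = D2 Ω v (z, t) Y X

theorem reg_of {Ω : Set (Cn n)} {ρ : Cn n → ℝ} {c K T : ℝ} (D : Dom Ω ρ c K)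
    {v : Cn n × ℝ → ℝ} (hsm : ∀ z ∈ Ω, ∀ t ∈ Ioo (0 : ℝ) T, Sm v (z, t)) (h : C21 n Ω T v) :
    Reg Ω T v := by
  obtain ⟨hC2, hC1, hct, hc2⟩ := h
  have hUD := D.uniqueDiff
  have hΩt : ∀ t ∈ Ioo (0 : ℝ) T, t ∈ Ico (0 : ℝ) T := fun t ht => ⟨ht.1.le, ht.2⟩
  have hD1 : ∀ z ∈ closure Ω, ∀ t ∈ Ico (0 : ℝ) T,
      HasFDerivWithinAt (fun x => v (x, t)) (D1 Ω v (z, t)) (closure Ω) z := by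
    intro z hz t ht
    exact ((hC2 t ht).differentiableOn (by simp) z hz).hasFDerivWithinAt
  have hD2 : ∀ z ∈ closure Ω, ∀ t ∈ Ico (0 : ℝ) T,
      HasFDerivWithinAt (fun x => D1 Ω v (x, t)) (D2 Ω v (z, t)) (closure Ω) z := by
    intro z hz t ht
    have := ((hC2 t ht).fderivWithin (m := 1) hUD (by rw [one_add_one_eq_two])).differentiableOn
      (by simp) z hz
    exact this.hasFDerivWithinAt
  have hnh : ∀ z ∈ Ω, closure Ω ∈ 𝓝 z := fun z hz =>
    mem_of_superset (D.op.mem_nhds hz) subset_closure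
  have he1 : ∀ z ∈ Ω, ∀ t ∈ Ioo (0 : ℝ) T, ∀ X,
      D1 Ω v (z, t) X = dd (X, (0 : ℝ)) v (z, t) := by
    intro z hz t ht X
    unfold D1
    simp only
    rw [fderivWithin_of_mem_nhds (hnh z hz), slice_fderiv_apply (hsm z hz t ht).diff]
  have he2 : ∀ z ∈ Ω, ∀ t ∈ Ioo (0 : ℝ) T, ∀ X Y,
      D2 Ω v (z, t) X Y = dd (X, (0 : ℝ)) (dd (Y, (0 : ℝ)) v) (z, t) := by
    intro z hz t ht X Y
    have h1 := (hD2 z (subset_closure hz) t (hΩt t ht)).hasFDerivAt (hnh z hz)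
    have h2 := (ContinuousLinearMap.apply ℝ ℝ Y).hasFDerivAt.comp z h1
    have h3 : (fun x => dd (Y, (0 : ℝ)) v (x, t)) =ᶠ[𝓝 z]
        (ContinuousLinearMap.apply ℝ ℝ Y) ∘ fun x => D1 Ω v (x, t) := by
      filter_upwards [D.op.mem_nhds hz] with x hx
      simp [he1 x hx t ht]
    have h4 := (h2.congr_of_eventuallyEq h3).unique
      (slice_fderiv ((hsm z hz t ht).dd (Y, (0 : ℝ))).diff)
    have h5 := congrArg (fun L => L X) h4
    simpa [dd] using h5
  have hc2' : ContinuousOn (D2 Ω v) (closure Ω ×ˢ Ico (0 : ℝ) T) := by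
    rw [continuousOn_clm_apply]
    intro X
    rw [continuousOn_clm_apply]
    intro Y
    refine (hc2 Y X).congr ?_
    rintro ⟨z, t⟩ ⟨hz, ht⟩
    have h2 := (ContinuousLinearMap.apply ℝ ℝ Y).hasFDerivAt.comp_hasFDerivWithinAt z
      (hD2 z hz t ht)
    have h3 := congrArg (fun L => L X) (h2.fderivWithin (hUD z hz))
    simp only [ContinuousLinearMap.comp_apply, ContinuousLinearMap.apply_apply] at h3
    exact h3.symm
  have hHt : ∀ z ∈ closure Ω, ∀ t ∈ Ico (0 : ℝ) T,
      HasDerivWithinAt (fun s => v (z, s)) (Dt T v (z, t)) (Ico (0 : ℝ) T) t := by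
    intro z hz t ht
    exact ((hC1 z hz).differentiableOn (by simp) t ht).hasDerivWithinAt
  have hcomp := D.bdd.isCompact_closure
  have hc1int : ContinuousOn (D1 Ω v) (Ω ×ˢ Ioo (0 : ℝ) T) := by
    rw [continuousOn_clm_apply]
    intro X
    have : ContinuousOn (dd (X, (0 : ℝ)) v) (Ω ×ˢ Ioo (0 : ℝ) T) := by
      rintro ⟨z, t⟩ ⟨hz, ht⟩
      exact ((hsm z hz t ht).dd _).cont.continuousWithinAt
    refine this.congr ?_
    rintro ⟨z, t⟩ ⟨hz, ht⟩
    exact he1 z hz t ht X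
  have hO : IsOpen (Ω ×ˢ Ioo (0 : ℝ) T) := D.op.prod isOpen_Ioo
  refine ⟨hsm, ?_, hct, ?_, hc2'.mono (prod_mono subset_rfl Ioo_subset_Ico_self),
    fun z hz t ht => hD1 z hz t (hΩt t ht), fun z hz t ht => hD2 z hz t (hΩt t ht), he1, he2,
    ?_, ?_⟩
  · rintro ⟨z, t⟩ ⟨hz, ht⟩
    obtain ⟨t1, ht1, ht1T⟩ := exists_between ht.2
    have hsub : Icc 0 t1 ⊆ Ico (0 : ℝ) T := fun s hs => ⟨hs.1, lt_of_le_of_lt hs.2 ht1T⟩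
    obtain ⟨M, hM⟩ := (hcomp.prod (isCompact_Icc (a := (0 : ℝ)) (b := t1))).exists_bound_of_continuousOn
      (hct.mono (prod_mono subset_rfl hsub))
    have hlip : ∀ q ∈ closure Ω, ∀ s ∈ Icc 0 t1, ‖v (q, s) - v (q, t)‖ ≤ M * ‖s - t‖ := by
      intro q hq s hs
      exact Convex.norm_image_sub_le_of_norm_hasDerivWithin_le (s := Icc 0 t1)
        (f := fun s => v (q, s)) (f' := fun s => Dt T v (q, s))
        (fun x hx => (hHt q hq x (hsub hx)).mono hsub)
        (fun x hx => hM (q, x) ⟨hq, hx⟩) (convex_Icc _ _) ⟨ht.1, ht1.le⟩ hs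
    have hA : Tendsto (fun p : Cn n × ℝ => v (p.1, t)) (𝓝[closure Ω ×ˢ Ico (0 : ℝ) T] (z, t))
        (𝓝 (v (z, t))) := by
      have h1 : ContinuousWithinAt (fun x => v (x, t)) (closure Ω) z :=
        ((hC2 t ht).continuousOn) z hz
      have h2 : Tendsto (fun p : Cn n × ℝ => p.1) (𝓝[closure Ω ×ˢ Ico (0 : ℝ) T] (z, t))
          (𝓝[closure Ω] z) := by
        refine tendsto_nhdsWithin_of_tendsto_nhds_of_eventually_within _
          (continuous_fst.continuousAt.mono_left nhdsWithin_le_nhds) ?_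
        filter_upwards [self_mem_nhdsWithin] with p hp using hp.1
      exact h1.tendsto.comp h2
    have hB : Tendsto (fun p : Cn n × ℝ => v p - v (p.1, t))
        (𝓝[closure Ω ×ˢ Ico (0 : ℝ) T] (z, t)) (𝓝 0) := by
      have h3 : Tendsto (fun p : Cn n × ℝ => M * ‖p.2 - t‖)
          (𝓝[closure Ω ×ˢ Ico (0 : ℝ) T] (z, t)) (𝓝 0) := by
        have : Continuous fun p : Cn n × ℝ => M * ‖p.2 - t‖ := by fun_prop
        have h4 := this.tendsto (z, t)
        simp only [sub_self, norm_zero, mul_zero] at h4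
        exact h4.mono_left nhdsWithin_le_nhds
      refine squeeze_zero_norm' ?_ h3
      have h5 : ∀ᶠ p : Cn n × ℝ in 𝓝[closure Ω ×ˢ Ico (0 : ℝ) T] (z, t), p.2 < t1 :=
        (continuous_snd.continuousAt.eventually (gt_mem_nhds ht1)).filter_mono nhdsWithin_le_nhds
      filter_upwards [h5, self_mem_nhdsWithin] with p hp1 hp2
      exact hlip p.1 hp2.1 p.2 ⟨hp2.2.1, hp1.le⟩
    have h9 := hB.add hA
    have h10 : Tendsto v (𝓝[closure Ω ×ˢ Ico (0 : ℝ) T] (z, t)) (𝓝 (v (z, t))) := by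
      refine (h9.congr ?_).trans (by rw [zero_add])
      intro p
      ring
    exact h10
  · rintro ⟨p, t⟩ ⟨hp, ht⟩
    by_cases hpi : p ∈ Ω
    · exact (hc1int.continuousAt (hO.mem_nhds ⟨hpi, ht⟩)).continuousWithinAt
    have hpf : p ∈ frontier Ω := by
      rw [D.op.frontier_eq]
      exact ⟨hp, hpi⟩
    obtain ⟨N, hN1, hN2, -⟩ := D.nor p hpf
    obtain ⟨δ, hδ, hin⟩ := D.inward hpf (S := -N) (by
      rw [dd_vneg]; linarith [D.cpos])
    obtain ⟨t1, ht1, ht1T⟩ := exists_between ht.2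
    have hsub : Icc 0 t1 ⊆ Ico (0 : ℝ) T := fun s hs => ⟨hs.1, lt_of_le_of_lt hs.2 ht1T⟩
    obtain ⟨M, hM⟩ : ∃ M, ∀ x ∈ closure Ω ×ˢ Icc 0 t1, ‖D2 Ω v x‖ ≤ M := by
      have h7 : ContinuousOn (fun x => ‖D2 Ω v x‖) (closure Ω ×ˢ Icc 0 t1) :=
        (continuous_norm (E := Cn n →L[ℝ] Cn n →L[ℝ] ℝ)).comp_continuousOn
          (hc2'.mono (prod_mono subset_rfl hsub))
      obtain ⟨M, hM⟩ := (hcomp.prod isCompact_Icc).exists_bound_of_continuousOn h7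
      exact ⟨M, fun x hx => (le_abs_self _).trans (hM x hx)⟩
    have hlip : ∀ q ∈ closure Ω, dist q p < δ → ∀ s ∈ Icc 0 t1, ∀ r ∈ Ioo 0 δ,
        ‖D1 Ω v (q + r • (-N), s) - D1 Ω v (q, s)‖ ≤ |M| * r := by
      intro q hq hqd s hs r hr
      have hseg : segment ℝ q (q + r • (-N)) ⊆ closure Ω := by
        intro x hx
        rw [segment_eq_image'] at hx
        obtain ⟨θ, hθ, rfl⟩ := hx
        rcases eq_or_lt_of_le hθ.1 with h0 | h0
        · simpa [← h0] using hq
        · have := hin q hq hqd (θ * r) ⟨mul_pos h0 hr.1, by nlinarith [hθ.2, hr.1, hr.2]⟩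
          apply subset_closure
          simpa [smul_smul] using this
      have h1 := Convex.norm_image_sub_le_of_norm_hasFDerivWithin_le
        (s := segment ℝ q (q + r • (-N))) (f := fun x => D1 Ω v (x, s))
        (f' := fun x => D2 Ω v (x, s)) (C := |M|)
        (fun x hx => (hD2 x (hseg hx) s (hsub hs)).mono hseg)
        (fun x hx => (hM (x, s) ⟨hseg hx, hs⟩).trans (le_abs_self M)) (convex_segment _ _)
        (left_mem_segment ℝ _ _) (right_mem_segment ℝ _ _)
      refine h1.trans (le_of_eq ?_)
      simp [norm_smul, hN1, abs_of_pos hr.1]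
    rw [ContinuousWithinAt, Metric.tendsto_nhds]
    intro ε hε
    obtain ⟨r, hr0, hr⟩ : ∃ r : ℝ, 0 < r ∧ r < min δ (ε / (4 * (|M| + 1))) :=
      exists_between (by positivity)
    rw [lt_min_iff] at hr
    have hMr : |M| * r < ε / 3 := by
      have h1 := hr.2
      rw [lt_div_iff₀ (by positivity)] at h1
      nlinarith [abs_nonneg M]
    have hmid : ContinuousAt (fun q : Cn n × ℝ => D1 Ω v (q.1 + r • (-N), q.2)) (p, t) := by
      have h1 : ContinuousAt (D1 Ω v) (p + r • (-N), t) := hc1int.continuousAt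
        (hO.mem_nhds ⟨hin p hp (by simpa using hδ) r ⟨hr0, hr.1⟩, ht⟩)
      exact ContinuousAt.comp (x := (p, t)) (f := fun q : Cn n × ℝ => (q.1 + r • (-N), q.2)) h1
        (by fun_prop)
    have e1 : ∀ᶠ q : Cn n × ℝ in 𝓝[closure Ω ×ˢ Ioo (0 : ℝ) T] (p, t),
        dist (D1 Ω v (q.1 + r • (-N), q.2)) (D1 Ω v (p + r • (-N), t)) < ε / 3 :=
      ((Metric.tendsto_nhds.1 hmid.tendsto) (ε / 3) (by positivity)).filter_mono nhdsWithin_le_nhds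
    have e2 : ∀ᶠ q : Cn n × ℝ in 𝓝[closure Ω ×ˢ Ioo (0 : ℝ) T] (p, t), q.2 < t1 :=
      (continuous_snd.continuousAt.eventually (gt_mem_nhds ht1)).filter_mono nhdsWithin_le_nhds
    have e3 : ∀ᶠ q : Cn n × ℝ in 𝓝[closure Ω ×ˢ Ioo (0 : ℝ) T] (p, t), dist q.1 p < δ :=
      ((continuous_fst.continuousAt (x := (p, t))).eventually
        (Metric.ball_mem_nhds p hδ)).filter_mono nhdsWithin_le_nhds
    filter_upwards [e1, e2, e3, self_mem_nhdsWithin] with q h1 h2 h3 h4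
    have a1 := hlip q.1 h4.1 h3 q.2 ⟨h4.2.1.le, h2.le⟩ r ⟨hr0, hr.1⟩
    have a2 := hlip p hp (by simpa using hδ) t ⟨ht.1.le, ht1.le⟩ r ⟨hr0, hr.1⟩
    rw [← dist_eq_norm] at a1 a2
    have t1' := dist_triangle (D1 Ω v q) (D1 Ω v (q.1 + r • (-N), q.2)) (D1 Ω v (p, t))
    have t2' := dist_triangle (D1 Ω v (q.1 + r • (-N), q.2)) (D1 Ω v (p + r • (-N), t))
      (D1 Ω v (p, t))
    rw [dist_comm] at a1
    have : D1 Ω v (q.1, q.2) = D1 Ω v q := rfl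
    rw [this] at a1
    linarith
  · intro z hz t ht
    have h1 : HasDerivAt (fun s => v (z, s)) (Dt T v (z, t)) t :=
      (hHt z (subset_closure hz) t (hΩt t ht)).hasDerivAt (Ico_mem_nhds ht.1 ht.2)
    have h2 : HasFDerivAt v (fderiv ℝ v (z, t)) (z, t) := (hsm z hz t ht).diff.hasFDerivAt
    have h3 : HasDerivAt (fun s : ℝ => (z, s)) ((0 : Cn n), (1 : ℝ)) t :=
      (hasDerivAt_const t z).prodMk (hasDerivAt_id t)
    exact h1.unique (h2.comp_hasDerivAt t h3)
  · intro z hz t ht X Y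
    have hcc : ∀ X Y, ContinuousOn (fun x => D2 Ω v (x, t) X Y) (closure Ω) := by
      intro X Y
      have h1 := hc2'
      rw [continuousOn_clm_apply] at h1
      have h2 := h1 X
      rw [continuousOn_clm_apply] at h2
      refine (h2 Y).comp (f := fun x => (x, t)) (by fun_prop) ?_
      intro x hx
      exact ⟨hx, hΩt t ht⟩
    refine Set.EqOn.of_subset_closure (s := Ω) (t := closure Ω) ?_ (hcc X Y) (hcc Y X)
      subset_closure subset_rfl hz
    intro x hx
    simp only
    rw [he2 x hx t ht, he2 x hx t ht]
    exact dd_comm (hsm x hx t ht) _ _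

/-- Smooth functions with controlled derivatives. -/
structure Bd (Ω : Set (Cn n)) (T K : ℝ) (a : Cn n × ℝ → ℝ) : Prop where
  k0 : 0 ≤ K
  sm : ∀ z ∈ Ω, ∀ t ∈ Ioo (0 : ℝ) T, Sm a (z, t)
  b0 : ∀ z ∈ Ω, ∀ t ∈ Ioo (0 : ℝ) T, |a (z, t)| ≤ K
  b1 : ∀ z ∈ Ω, ∀ t ∈ Ioo (0 : ℝ) T, ∀ X, |dd (X, (0 : ℝ)) a (z, t)| ≤ K * ‖X‖
  b2 : ∀ z ∈ Ω, ∀ t ∈ Ioo (0 : ℝ) T, ∀ X,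
    |dd (X, (0 : ℝ)) (dd (X, (0 : ℝ)) a) (z, t)| ≤ K * ‖X‖ ^ 2
  bt : ∀ z ∈ Ω, ∀ t ∈ Ioo (0 : ℝ) T, |dd ((0 : Cn n), (1 : ℝ)) a (z, t)| ≤ K
  cont : ContinuousOn a (closure Ω ×ˢ Ioo (0 : ℝ) T)

namespace Bd

variable {Ω : Set (Cn n)} {T K K' : ℝ} {a b : Cn n × ℝ → ℝ}

theorem mono (h : Bd Ω T K a) (hK : K ≤ K') : Bd Ω T K' a where
  k0 := h.k0.trans hK
  sm := h.sm
  b0 z hz t ht := (h.b0 z hz t ht).trans hK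
  b1 z hz t ht X := (h.b1 z hz t ht X).trans (by gcongr)
  b2 z hz t ht X := (h.b2 z hz t ht X).trans (by gcongr)
  bt z hz t ht := (h.bt z hz t ht).trans hK
  cont := h.cont

theorem const (Ω : Set (Cn n)) (T c : ℝ) : Bd Ω T |c| (fun _ => c) where
  k0 := abs_nonneg c
  sm z _ t _ := Sm.const c _
  b0 z _ t _ := le_rfl
  b1 z _ t _ X := by rw [dd_const, abs_zero]; positivity
  b2 z _ t _ X := by rw [dd2_const, abs_zero]; positivity
  bt z _ t _ := by rw [dd_const, abs_zero]; positivity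
  cont := continuousOn_const

theorem add (ha : Bd Ω T K a) (hb : Bd Ω T K' b) : Bd Ω T (K + K') (fun q => a q + b q) where
  k0 := add_nonneg ha.k0 hb.k0
  sm z hz t ht := (ha.sm z hz t ht).add (hb.sm z hz t ht)
  b0 z hz t ht := (abs_add_le _ _).trans (add_le_add (ha.b0 z hz t ht) (hb.b0 z hz t ht))
  b1 z hz t ht X := by
    rw [dd_add (ha.sm z hz t ht).diff (hb.sm z hz t ht).diff, add_mul]
    exact (abs_add_le _ _).trans (add_le_add (ha.b1 z hz t ht X) (hb.b1 z hz t ht X))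
  b2 z hz t ht X := by
    rw [dd2_add (ha.sm z hz t ht) (hb.sm z hz t ht), add_mul]
    exact (abs_add_le _ _).trans (add_le_add (ha.b2 z hz t ht X) (hb.b2 z hz t ht X))
  bt z hz t ht := by
    rw [dd_add (ha.sm z hz t ht).diff (hb.sm z hz t ht).diff]
    exact (abs_add_le _ _).trans (add_le_add (ha.bt z hz t ht) (hb.bt z hz t ht))
  cont := ha.cont.add hb.cont

theorem abs_mul_le {x y X Y : ℝ} (hx : |x| ≤ X) (hy : |y| ≤ Y) : |x * y| ≤ X * Y := by
  rw [abs_mul]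
  exact mul_le_mul hx hy (abs_nonneg _) ((abs_nonneg _).trans hx)

theorem mul (ha : Bd Ω T K a) (hb : Bd Ω T K' b) :
    Bd Ω T (4 * (K * K')) (fun q => a q * b q) where
  k0 := by have := ha.k0; have := hb.k0; positivity
  sm z hz t ht := (ha.sm z hz t ht).mul (hb.sm z hz t ht)
  b0 z hz t ht := by
    have := abs_mul_le (ha.b0 z hz t ht) (hb.b0 z hz t ht)
    have := mul_nonneg ha.k0 hb.k0
    linarith
  b1 z hz t ht X := by
    rw [dd_mul (ha.sm z hz t ht).diff (hb.sm z hz t ht).diff]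
    have h1 := abs_mul_le (ha.b0 z hz t ht) (hb.b1 z hz t ht X)
    have h2 := abs_mul_le (hb.b0 z hz t ht) (ha.b1 z hz t ht X)
    have h3 := mul_nonneg (mul_nonneg ha.k0 hb.k0) (norm_nonneg X)
    refine (abs_add_le _ _).trans ?_
    nlinarith
  b2 z hz t ht X := by
    rw [dd2_mul (ha.sm z hz t ht) (hb.sm z hz t ht)]
    have h1 := abs_mul_le (ha.b0 z hz t ht) (hb.b2 z hz t ht X)
    have h2 := abs_mul_le (hb.b0 z hz t ht) (ha.b2 z hz t ht X)
    have h3 := abs_mul_le (ha.b1 z hz t ht X) (hb.b1 z hz t ht X)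
    refine (abs_add_le _ _).trans ?_
    refine (add_le_add (abs_add_three _ _ _) le_rfl).trans ?_
    nlinarith
  bt z hz t ht := by
    rw [dd_mul (ha.sm z hz t ht).diff (hb.sm z hz t ht).diff]
    have h1 := abs_mul_le (ha.b0 z hz t ht) (hb.bt z hz t ht)
    have h2 := abs_mul_le (hb.b0 z hz t ht) (ha.bt z hz t ht)
    have h3 := mul_nonneg ha.k0 hb.k0
    refine (abs_add_le _ _).trans ?_
    nlinarith
  cont := ha.cont.mul hb.cont

theorem cmul (c : ℝ) (ha : Bd Ω T K a) : Bd Ω T (4 * (|c| * K)) (fun q => c * a q) :=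
  (const Ω T c).mul ha

theorem congr (hΩ : IsOpen Ω) (ha : Bd Ω T K a)
    (h : ∀ z ∈ closure Ω, ∀ t ∈ Ioo (0 : ℝ) T, b (z, t) = a (z, t)) : Bd Ω T K b := by
  have he : ∀ z ∈ Ω, ∀ t ∈ Ioo (0 : ℝ) T, b =ᶠ[𝓝 (z, t)] a := by
    intro z hz t ht
    filter_upwards [(hΩ.prod isOpen_Ioo).mem_nhds (show (z, t) ∈ Ω ×ˢ Ioo (0 : ℝ) T from ⟨hz, ht⟩)]
      with q hq
    exact h q.1 (subset_closure hq.1) q.2 hq.2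
  refine ⟨ha.k0, fun z hz t ht => (ha.sm z hz t ht).congr (he z hz t ht), ?_, ?_, ?_, ?_, ?_⟩
  · intro z hz t ht
    rw [h z (subset_closure hz) t ht]
    exact ha.b0 z hz t ht
  · intro z hz t ht X
    rw [dd_congr (he z hz t ht)]
    exact ha.b1 z hz t ht X
  · intro z hz t ht X
    rw [dd_congr (dd_congr_ev (he z hz t ht) _)]
    exact ha.b2 z hz t ht X
  · intro z hz t ht
    rw [dd_congr (he z hz t ht)]
    exact ha.bt z hz t ht
  · refine ha.cont.congr ?_
    rintro ⟨z, t⟩ ⟨hz, ht⟩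
    exact h z hz t ht

theorem sum {ι : Type*} (s : Finset ι) {Kf : ι → ℝ} {A : ι → Cn n × ℝ → ℝ}
    (h : ∀ i ∈ s, Bd Ω T (Kf i) (A i)) :
    Bd Ω T (∑ i ∈ s, Kf i) (fun q => ∑ i ∈ s, A i q) := by
  classical
  induction s using Finset.induction_on with
  | empty => simpa using const Ω T 0
  | insert i s hi ih =>
    have h1 := (h i (Finset.mem_insert_self i s)).add
      (ih fun j hj => h j (Finset.mem_insert_of_mem hj))
    simpa only [Finset.sum_insert hi] using h1

theorem b0c (ha : Bd Ω T K a) : ∀ z ∈ closure Ω, ∀ t ∈ Ioo (0 : ℝ) T, |a (z, t)| ≤ K := by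
  intro z hz t ht
  have h1 : ContinuousWithinAt (fun x => a (x, t)) (closure Ω) z :=
    (ha.cont.comp (f := fun x => (x, t)) (by fun_prop) (fun x hx => ⟨hx, ht⟩)) z hz
  have h2 : (𝓝[Ω] z).NeBot := mem_closure_iff_nhdsWithin_neBot.1 hz
  refine le_of_tendsto (h1.mono subset_closure).tendsto.abs ?_
  filter_upwards [self_mem_nhdsWithin] with x hx
  exact ha.b0 x hx t ht

theorem Lop_le (ha : Bd Ω T K a) {z : Cn n} (hz : z ∈ Ω) {t : ℝ} (ht : t ∈ Ioo (0 : ℝ) T)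
    {v : Fin n → Cn n} (hv : ∀ i, ‖v i‖ = 1) {μ : Fin n → ℝ} (hμ : ∀ i, 0 < μ i) :
    |Lop v μ a (z, t)| ≤ K * (1 + 2 * ∑ i, μ i) := by
  have h1 := ha.bt z hz t ht
  have h2 : |frS v μ (fun e => dd (e, (0 : ℝ)) (dd (e, (0 : ℝ)) a) (z, t))| ≤
      K * (2 * ∑ i, μ i) := by
    unfold frS
    refine (Finset.abs_sum_le_sum_abs _ _).trans ?_
    rw [Finset.mul_sum, Finset.mul_sum]
    refine Finset.sum_le_sum fun i _ => ?_
    have h3 := ha.b2 z hz t ht (v i)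
    have h4 := ha.b2 z hz t ht (Complex.I • v i)
    have h5 : ‖Complex.I • v i‖ = 1 := by rw [norm_smul, hv i]; simp
    rw [hv i] at h3
    rw [h5] at h4
    rw [abs_mul, abs_of_pos (hμ i)]
    have h6 := (abs_add_le (dd (v i, (0 : ℝ)) (dd (v i, (0 : ℝ)) a) (z, t))
      (dd (Complex.I • v i, (0 : ℝ)) (dd (Complex.I • v i, (0 : ℝ)) a) (z, t)))
    have := hμ i
    nlinarith
  unfold Lop
  refine (abs_sub _ _).trans ?_
  linarith

end Bd

theorem slice_fdw {Ω : Set (Cn n)} {I : Set ℝ} (hU : UniqueDiffOn ℝ (closure Ω))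
    {g : Cn n × ℝ → ℝ} (hg : ContDiffOn ℝ (⊤ : ℕ∞) g (closure Ω ×ˢ I)) {z : Cn n} {t : ℝ}
    (hz : z ∈ closure Ω) (ht : t ∈ I) (w : Cn n) :
    fderivWithin ℝ (fun x => g (x, t)) (closure Ω) z w =
      fderivWithin ℝ g (closure Ω ×ˢ I) (z, t) (w, 0) := by
  have h1 : HasFDerivWithinAt g (fderivWithin ℝ g (closure Ω ×ˢ I) (z, t)) (closure Ω ×ˢ I) (z, t) :=
    (hg.differentiableOn (by simp) (z, t) ⟨hz, ht⟩).hasFDerivWithinAt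
  have h2 : HasFDerivWithinAt (fun x : Cn n => (x, t)) (ContinuousLinearMap.inl ℝ (Cn n) ℝ)
      (closure Ω) z := (hasFDerivAt_prodMk_left z t).hasFDerivWithinAt
  have h3 := HasFDerivWithinAt.comp (t := closure Ω ×ˢ I) z h1 h2 (fun x hx => ⟨hx, ht⟩)
  have h4 := h3.fderivWithin (hU z hz)
  have h5 := congrArg (fun L => L w) h4
  simpa [Function.comp_def] using h5

theorem slice_dw {Ω : Set (Cn n)} {I : Set ℝ} (hI : UniqueDiffOn ℝ I)
    {g : Cn n × ℝ → ℝ} (hg : ContDiffOn ℝ (⊤ : ℕ∞) g (closure Ω ×ˢ I)) {z : Cn n} {t : ℝ}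
    (hz : z ∈ closure Ω) (ht : t ∈ I) :
    derivWithin (fun s => g (z, s)) I t =
      fderivWithin ℝ g (closure Ω ×ˢ I) (z, t) (0, 1) := by
  have h1 : HasFDerivWithinAt g (fderivWithin ℝ g (closure Ω ×ˢ I) (z, t)) (closure Ω ×ˢ I) (z, t) :=
    (hg.differentiableOn (by simp) (z, t) ⟨hz, ht⟩).hasFDerivWithinAt
  have h2 : HasDerivWithinAt (fun s : ℝ => (z, s)) ((0 : Cn n), (1 : ℝ)) I t :=
    ((hasDerivAt_const t z).prodMk (hasDerivAt_id t)).hasDerivWithinAt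
  have h3 := HasFDerivWithinAt.comp_hasDerivWithinAt t h1 h2 (fun x hx => ⟨hz, hx⟩)
  exact h3.derivWithin (hI t ht)

theorem C21_of_smooth {Ω : Set (Cn n)} {T : ℝ} (hU : UniqueDiffOn ℝ (closure Ω))
    {φ : Cn n × ℝ → ℝ} (hφ : ContDiffOn ℝ (⊤ : ℕ∞) φ (closure Ω ×ˢ Ico (0 : ℝ) T)) :
    C21 n Ω T φ := by
  have hI : UniqueDiffOn ℝ (Ico (0 : ℝ) T) := uniqueDiffOn_Ico 0 T
  have hS := hU.prod hI
  have hfd : ContDiffOn ℝ (⊤ : ℕ∞) (fderivWithin ℝ φ (closure Ω ×ˢ Ico (0 : ℝ) T))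
      (closure Ω ×ˢ Ico (0 : ℝ) T) := hφ.fderivWithin hS (by simp)
  have h2 : (2 : WithTop ℕ∞) ≤ ((⊤ : ℕ∞) : WithTop ℕ∞) := by
    simpa using (WithTop.coe_le_coe.2 (le_top : (2 : ℕ∞) ≤ ⊤))
  refine ⟨?_, ?_, ?_, ?_⟩
  · intro t ht
    refine (hφ.of_le h2).comp (f := fun z => (z, t)) (by fun_prop) (fun x hx => ⟨hx, ht⟩)
  · intro z hz
    refine (hφ.of_le (by simp)).comp (f := fun s => (z, s)) (by fun_prop) (fun x hx => ⟨hz, hx⟩)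
  · have h3 : ContinuousOn (fun p => fderivWithin ℝ φ (closure Ω ×ˢ Ico (0 : ℝ) T) p
        ((0 : Cn n), (1 : ℝ))) (closure Ω ×ˢ Ico (0 : ℝ) T) :=
      hfd.continuousOn.clm_apply continuousOn_const
    refine h3.congr ?_
    rintro ⟨z, t⟩ ⟨hz, ht⟩
    exact slice_dw hI hφ hz ht
  · intro v w
    have hg : ContDiffOn ℝ (⊤ : ℕ∞) (fun p => fderivWithin ℝ φ (closure Ω ×ˢ Ico (0 : ℝ) T) p
        (v, (0 : ℝ))) (closure Ω ×ˢ Ico (0 : ℝ) T) := hfd.clm_apply contDiffOn_const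
    have h3 : ContDiffOn ℝ (⊤ : ℕ∞) (fderivWithin ℝ (fun p => fderivWithin ℝ φ
        (closure Ω ×ˢ Ico (0 : ℝ) T) p (v, (0 : ℝ))) (closure Ω ×ˢ Ico (0 : ℝ) T))
        (closure Ω ×ˢ Ico (0 : ℝ) T) := hg.fderivWithin hS (by simp)
    have h4 := h3.continuousOn.clm_apply (continuousOn_const (c := (w, (0 : ℝ))))
    refine h4.congr ?_
    rintro ⟨z, t⟩ ⟨hz, ht⟩
    simp only
    rw [← slice_fdw hU hg hz ht w]
    congr 1
    refine fderivWithin_congr (fun y hy => ?_) ?_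
    · exact slice_fdw hU hφ hy ht v
    · exact slice_fdw hU hφ hz ht v

theorem Bd_fst {Ω : Set (Cn n)} {T K : ℝ} {h : Cn n → ℝ} (hd : ContDiff ℝ (⊤ : ℕ∞) h)
    (hK : 0 ≤ K) (b0 : ∀ z ∈ Ω, |h z| ≤ K) (b1 : ∀ z ∈ Ω, ∀ X, |dd X h z| ≤ K * ‖X‖)
    (b2 : ∀ z ∈ Ω, ∀ X, |dd X (dd X h) z| ≤ K * ‖X‖ ^ 2) : Bd Ω T K (fun q => h q.1) where
  k0 := hK
  sm z _ t _ := Sm_fst hd _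
  b0 z hz t _ := b0 z hz
  b1 z hz t _ X := by rw [dd_fst_fun hd]; exact b1 z hz X
  b2 z hz t _ X := by
    rw [dd_fst_fun hd, dd_fst_fun (dd_continuous hd _)]; exact b2 z hz X
  bt z hz t _ := by
    rw [dd_fst_fun hd]
    simpa [dd] using hK
  cont := (hd.continuous.comp continuous_fst).continuousOn

namespace Dom
variable {Ω : Set (Cn n)} {ρ : Cn n → ℝ} {c K : ℝ}

theorem bd0 (D : Dom Ω ρ c K) (T : ℝ) : Bd Ω T K (fun q => ρ q.1) :=
  Bd_fst D.sm (by linarith [D.Kpos]) (fun z _ => D.b0 z) (fun z _ X => D.b1 z X)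
    (fun z _ X => (D.b2 z X X).trans (by rw [sq]))

theorem bd1 (D : Dom Ω ρ c K) (T : ℝ) (X : Cn n) : Bd Ω T (K * ‖X‖) (fun q => dd X ρ q.1) := by
  have hK := D.Kpos
  refine Bd_fst (D.cdd X) (by positivity) (fun z _ => D.b1 z X)
    (fun z _ Y => (D.b2 z Y X).trans (le_of_eq (by ring)))
    (fun z _ Y => (D.b3 z Y Y X).trans (le_of_eq (by ring)))

theorem bd2 (D : Dom Ω ρ c K) (T : ℝ) (X Y : Cn n) :
    Bd Ω T (K * (‖X‖ * ‖Y‖)) (fun q => dd X (dd Y ρ) q.1) := by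
  have hK := D.Kpos
  refine Bd_fst (dd_continuous (D.cdd Y) X) (by positivity) (fun z _ => D.b2 z X Y)
    (fun z _ Z => (D.b3 z Z X Y).trans (le_of_eq (by ring)))
    (fun z _ Z => (D.b4 z Z Z X Y).trans (le_of_eq (by ring)))

end Dom

theorem Bd_time (Ω : Set (Cn n)) (T s : ℝ) (hs : 0 ≤ s) (hT : 0 < T) :
    Bd Ω T (s + T + 1) (fun q => s - q.2) := by
  have hd : ∀ X : Cn n × ℝ, dd X (fun q : Cn n × ℝ => s - q.2) = fun _ => - X.2 := by
    intro X
    funext p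
    have h1 : HasFDerivAt (fun q : Cn n × ℝ => s - q.2) (-(ContinuousLinearMap.snd ℝ (Cn n) ℝ)) p :=
      (ContinuousLinearMap.snd ℝ (Cn n) ℝ).hasFDerivAt.const_sub s
    simp [dd, h1.fderiv]
  refine ⟨by positivity, ?_, ?_, ?_, ?_, ?_, ?_⟩
  · intro z _ t _
    exact (contDiff_const.sub contDiff_snd).contDiffAt
  · intro z _ t ht
    rw [abs_le]
    constructor <;> simp <;> linarith [ht.1, ht.2]
  · intro z _ t ht X
    rw [hd]
    simp
    positivity
  · intro z _ t ht X
    rw [hd, dd_const]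
    simp
    positivity
  · intro z _ t ht
    rw [hd]
    simp
    positivity
  · fun_prop

theorem Bd_sq {Ω : Set (Cn n)} {R : ℝ} (hR : 0 ≤ R) (T : ℝ) (hΩ : ∀ z ∈ Ω, ‖z‖ ≤ R) {p : Cn n}
    (hp : ‖p‖ ≤ R) : Bd Ω T (4 * R ^ 2 + 4 * R + 2) (fun q => ‖q.1 - p‖ ^ 2) := by
  have hd : ContDiff ℝ (⊤ : ℕ∞) (fun z : Cn n => ‖z - p‖ ^ 2) :=
    (contDiff_norm_sq ℂ).comp (contDiff_id.sub contDiff_const) |>.of_le le_rfl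
  have h1 : ∀ X, dd X (fun z : Cn n => ‖z - p‖ ^ 2) = fun z => 2 * (inner ℂ (z - p) X : ℂ).re := by
    intro X
    funext z
    have hl : HasDerivAt (fun r : ℝ => ‖z + r • X - p‖ ^ 2) (dd X (fun z : Cn n => ‖z - p‖ ^ 2) z) 0 :=
      hasDerivAt_line (W := fun z : Cn n => ‖z - p‖ ^ 2) (p := z) (hd.differentiable (by simp) z) X
        (by simp)
    have he : (fun r : ℝ => ‖z + r • X - p‖ ^ 2) = fun r : ℝ =>
        ‖z - p‖ ^ 2 + 2 * (r * (inner ℂ (z - p) X : ℂ).re) + r ^ 2 * ‖X‖ ^ 2 := by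
      funext r
      have : z + r • X - p = (z - p) + r • X := by abel
      rw [this, norm_add_sq (𝕜 := ℂ)]
      have h2 : (inner ℂ (z - p) (r • X) : ℂ) = (r : ℂ) * inner ℂ (z - p) X := by
        rw [← inner_smul_right]
        rfl
      rw [h2, norm_smul]
      simp [mul_pow]
    rw [he] at hl
    have hl2 : HasDerivAt (fun r : ℝ => ‖z - p‖ ^ 2 + 2 * (r * (inner ℂ (z - p) X : ℂ).re)
        + r ^ 2 * ‖X‖ ^ 2) (2 * (inner ℂ (z - p) X : ℂ).re) 0 := by
      have := (((hasDerivAt_id (0 : ℝ)).mul_const (inner ℂ (z - p) X : ℂ).re).const_mul 2).const_add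
        (‖z - p‖ ^ 2) |>.add (((hasDerivAt_id (0 : ℝ)).pow 2).mul_const (‖X‖ ^ 2))
      refine HasDerivAt.congr_deriv this ?_
      simp
    exact hl.unique hl2
  have h2 : ∀ X, dd X (dd X (fun z : Cn n => ‖z - p‖ ^ 2)) = fun z => 2 * ‖X‖ ^ 2 := by
    intro X
    funext z
    have hl : HasDerivAt (fun r : ℝ => dd X (fun z : Cn n => ‖z - p‖ ^ 2) (z + r • X))
        (dd X (dd X (fun z : Cn n => ‖z - p‖ ^ 2)) z) 0 :=
      hasDerivAt_line ((dd_continuous hd X).differentiable (by simp) z) X (by simp)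
    rw [h1] at hl ⊢
    have he : (fun r : ℝ => 2 * (inner ℂ (z + r • X - p) X : ℂ).re) = fun r : ℝ =>
        2 * (inner ℂ (z - p) X : ℂ).re + r * (2 * ‖X‖ ^ 2) := by
      funext r
      have : z + r • X - p = (z - p) + (r : ℂ) • X := by
        have : (r : ℂ) • X = r • X := rfl
        rw [this]; abel
      rw [this, inner_add_left, inner_smul_left, inner_self_eq_norm_sq_to_K]
      have h5 : (((starRingEnd ℂ) (r : ℂ)) * ((‖X‖ : ℝ) : ℂ) ^ 2).re = r * ‖X‖ ^ 2 := by
        rw [Complex.conj_ofReal, ← Complex.ofReal_pow, ← Complex.ofReal_mul, Complex.ofReal_re]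
      rw [Complex.add_re]
      erw [h5]
      ring
    rw [he] at hl
    have hl2 : HasDerivAt (fun r : ℝ => 2 * (inner ℂ (z - p) X : ℂ).re + r * (2 * ‖X‖ ^ 2))
        (2 * ‖X‖ ^ 2) 0 := by
      simpa using ((hasDerivAt_id (0 : ℝ)).mul_const (2 * ‖X‖ ^ 2)).const_add
        (2 * (inner ℂ (z - p) X : ℂ).re)
    exact hl.unique hl2
  have h3 : ∀ z ∈ Ω, ‖z - p‖ ≤ 2 * R := fun z hz => (norm_sub_le _ _).trans (by linarith [hΩ z hz])
  refine Bd_fst hd (by positivity) ?_ ?_ ?_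
  · intro z hz
    rw [abs_of_nonneg (by positivity)]
    have := h3 z hz
    nlinarith [norm_nonneg (z - p)]
  · intro z hz X
    rw [h1]
    have h4 := (Complex.abs_re_le_norm (inner ℂ (z - p) X)).trans (norm_inner_le_norm (z - p) X)
    have h5 := mul_le_mul_of_nonneg_right (h3 z hz) (norm_nonneg X)
    rw [abs_mul, abs_two]
    nlinarith [norm_nonneg X, mul_nonneg (sq_nonneg R) (norm_nonneg X)]
  · intro z hz X
    rw [h2, abs_of_nonneg (by positivity)]
    nlinarith [mul_nonneg (sq_nonneg R) (sq_nonneg ‖X‖), mul_nonneg hR (sq_nonneg ‖X‖)]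

/-- The packaged hypotheses. -/
structure Sol (Ω : Set (Cn n)) (T M : ℝ) (u φ : Cn n × ℝ → ℝ) : Prop where
  M1 : 1 ≤ M
  T0 : 0 < T
  ru : Reg Ω T u
  rφ : Reg Ω T φ
  bdry : ∀ z ∈ frontier Ω, ∀ t ∈ Ico (0 : ℝ) T, u (z, t) = φ (z, t)
  bdt : ∀ z ∈ frontier Ω, ∀ t ∈ Ico (0 : ℝ) T, Dt T u (z, t) = Dt T φ (z, t)
  init : ∀ z ∈ closure Ω, |u (z, 0)| ≤ M
  bφ0 : Bd Ω T M φ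
  bφ1 : ∀ X, Bd Ω T (M * ‖X‖) (fun p => D1 Ω φ p X)
  bφ2 : ∀ X Y, Bd Ω T (M * (‖X‖ * ‖Y‖)) (fun p => D2 Ω φ p X Y)
  fr : ∀ z ∈ Ω, ∀ t ∈ Ioo (0 : ℝ) T, ∃ (v : OrthonormalBasis (Fin n) ℂ (Cn n)) (μ : Fin n → ℝ)
    (k F : ℝ), (∀ a, 0 < μ a) ∧
      (∀ X a, Qf u (z, t) X (v a) = (inner ℂ (v a) X : ℂ).re / μ a) ∧
      (∀ X a, Qf u (z, t) X (Complex.I • v a) = (inner ℂ (v a) X : ℂ).im / μ a) ∧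
      |F| ≤ M ∧ -M ≤ k ∧ k ≤ 0 ∧
      dd ((0 : Cn n), (1 : ℝ)) u (z, t) = - ∑ a, Real.log (4 * μ a) + F ∧
      ∀ X, |Lop v μ (dd X u) (z, t) - k * dd X u (z, t)| ≤ M * ‖X‖

theorem slice_dd_ev {Ω : Set (Cn n)} (hΩ : IsOpen Ω) {t : ℝ} {a : Cn n × ℝ → ℝ}
    (ha : ∀ z ∈ Ω, Sm a (z, t)) {h : Cn n → ℝ} {z : Cn n} (hz : z ∈ Ω)
    (hh : h =ᶠ[𝓝 z] fun w => a (w, t)) (X : Cn n) :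
    dd X h =ᶠ[𝓝 z] fun w => dd (X, (0 : ℝ)) a (w, t) := by
  refine (dd_congr_ev hh X).trans ?_
  filter_upwards [hΩ.mem_nhds hz] with w hw
  exact slice_fderiv_apply (ha w hw).diff X

theorem slice_bounds {Ω : Set (Cn n)} (hΩ : IsOpen Ω) {t K : ℝ} {a : Cn n × ℝ → ℝ}
    (ha : ∀ z ∈ Ω, Sm a (z, t)) {h : Cn n → ℝ} {z : Cn n} (hz : z ∈ Ω)
    (hh : h =ᶠ[𝓝 z] fun w => a (w, t)) :
    (‖iteratedFDeriv ℝ 0 h z‖ ≤ K → |a (z, t)| ≤ K) ∧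
    (‖iteratedFDeriv ℝ 1 h z‖ ≤ K → ∀ X, |dd (X, (0 : ℝ)) a (z, t)| ≤ K * ‖X‖) ∧
    (‖iteratedFDeriv ℝ 2 h z‖ ≤ K → ∀ X Y,
      |dd (X, (0 : ℝ)) (dd (Y, (0 : ℝ)) a) (z, t)| ≤ K * (‖X‖ * ‖Y‖)) ∧
    (‖iteratedFDeriv ℝ 3 h z‖ ≤ K → ∀ X Y Z,
      |dd (X, (0 : ℝ)) (dd (Y, (0 : ℝ)) (dd (Z, (0 : ℝ)) a)) (z, t)|
        ≤ K * (‖X‖ * (‖Y‖ * ‖Z‖))) ∧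
    (‖iteratedFDeriv ℝ 4 h z‖ ≤ K → ∀ X Y Z V,
      |dd (X, (0 : ℝ)) (dd (Y, (0 : ℝ)) (dd (Z, (0 : ℝ)) (dd (V, (0 : ℝ)) a))) (z, t)|
        ≤ K * (‖X‖ * (‖Y‖ * (‖Z‖ * ‖V‖)))) := by
  have hs : ∀ᶠ y in 𝓝 z, Sm h y := by
    filter_upwards [hΩ.mem_nhds hz, hh.eventually_nhds] with y hy hy2
    refine Sm.congr ?_ hy2
    exact ContDiffAt.comp (f := fun w : Cn n => (w, t)) y (ha y hy) (by fun_prop)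
  obtain ⟨h2, h3, h4⟩ := dd_bound hs (K := K)
  have e1 := fun X => slice_dd_ev hΩ ha hz hh X
  have e2 := fun X Y => slice_dd_ev hΩ (fun w hw => (ha w hw).dd (Y, (0 : ℝ))) hz (e1 Y) X
  have e3 := fun X Y Z => slice_dd_ev hΩ
    (fun w hw => ((ha w hw).dd (Z, (0 : ℝ))).dd (Y, (0 : ℝ))) hz (e2 Y Z) X
  have e4 := fun X Y Z V => slice_dd_ev hΩ
    (fun w hw => (((ha w hw).dd (V, (0 : ℝ))).dd (Z, (0 : ℝ))).dd (Y, (0 : ℝ))) hz (e3 Y Z V) X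
  refine ⟨?_, ?_, ?_, ?_, ?_⟩
  · intro hk
    rw [norm_iteratedFDeriv_zero, hh.self_of_nhds] at hk
    exact hk
  · intro hk X
    have := dd1_le X hk
    rwa [(e1 X).self_of_nhds] at this
  · intro hk X Y
    have := h2 hk X Y
    rwa [(e2 X Y).self_of_nhds] at this
  · intro hk X Y Z
    have := h3 hk X Y Z
    rwa [(e3 X Y Z).self_of_nhds] at this
  · intro hk X Y Z V
    have := h4 hk X Y Z V
    rwa [(e4 X Y Z V).self_of_nhds] at this

theorem phi_bd {Ω : Set (Cn n)} {T M : ℝ} (hΩ : IsOpen Ω) {φ : Cn n × ℝ → ℝ} (hM : 0 ≤ M)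
    (hT : 0 < T)
    (rφ : Reg Ω T φ) (hb : ∀ j l : ℕ, j + 2 * l ≤ 4 → ∀ z ∈ Ω, ∀ t ∈ Ioo (0 : ℝ) T,
    ‖iteratedFDeriv ℝ j (fun w => iteratedDeriv l (fun s => φ (w, s)) t) z‖ ≤ M) :
    Bd Ω T M φ ∧ (∀ X, Bd Ω T (M * ‖X‖) (fun p => D1 Ω φ p X)) ∧
    (∀ X Y, Bd Ω T (M * (‖X‖ * ‖Y‖)) (fun p => D2 Ω φ p X Y)) := by
  have hO : IsOpen (Ω ×ˢ Ioo (0 : ℝ) T) := hΩ.prod isOpen_Ioo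
  have B0 : ∀ z ∈ Ω, ∀ t ∈ Ioo (0 : ℝ) T, _ := fun z hz t ht => slice_bounds (K := M) hΩ
    (fun w hw => rφ.sm w hw t ht) hz (Filter.EventuallyEq.refl (𝓝 z) fun w => φ (w, t))
  have hb0 : ∀ j ≤ 4, ∀ z ∈ Ω, ∀ t ∈ Ioo (0 : ℝ) T,
      ‖iteratedFDeriv ℝ j (fun w => φ (w, t)) z‖ ≤ M := by
    intro j hj z hz t ht
    simpa using hb j 0 (by omega) z hz t ht
  have hdt : ∀ z ∈ Ω, ∀ t ∈ Ioo (0 : ℝ) T,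
      deriv (fun s => φ (z, s)) t = dd ((0 : Cn n), (1 : ℝ)) φ (z, t) := by
    intro z hz t ht
    have h2 : HasFDerivAt φ (fderiv ℝ φ (z, t)) (z, t) := (rφ.sm z hz t ht).diff.hasFDerivAt
    have h3 : HasDerivAt (fun s : ℝ => (z, s)) ((0 : Cn n), (1 : ℝ)) t :=
      (hasDerivAt_const t z).prodMk (hasDerivAt_id t)
    exact (h2.comp_hasDerivAt t h3).deriv
  have B1 : ∀ z ∈ Ω, ∀ t ∈ Ioo (0 : ℝ) T, _ := fun z hz t ht => slice_bounds (K := M) hΩ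
    (a := dd ((0 : Cn n), (1 : ℝ)) φ)
    (fun w hw => (rφ.sm w hw t ht).dd _) hz (h := fun w => iteratedDeriv 1 (fun s => φ (w, s)) t)
    (by
      filter_upwards [hΩ.mem_nhds hz] with w hw
      simp only [iteratedDeriv_one]
      exact hdt w hw t ht)
  have E1 : ∀ z ∈ Ω, ∀ t ∈ Ioo (0 : ℝ) T, ∀ X,
      (fun p => D1 Ω φ p X) =ᶠ[𝓝 (z, t)] dd (X, (0 : ℝ)) φ := by
    intro z hz t ht X
    filter_upwards [hO.mem_nhds (show (z, t) ∈ Ω ×ˢ Ioo (0 : ℝ) T from ⟨hz, ht⟩)] with q hq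
    exact rφ.e1 q.1 hq.1 q.2 hq.2 X
  have E2 : ∀ z ∈ Ω, ∀ t ∈ Ioo (0 : ℝ) T, ∀ X Y,
      (fun p => D2 Ω φ p X Y) =ᶠ[𝓝 (z, t)] dd (X, (0 : ℝ)) (dd (Y, (0 : ℝ)) φ) := by
    intro z hz t ht X Y
    filter_upwards [hO.mem_nhds (show (z, t) ∈ Ω ×ˢ Ioo (0 : ℝ) T from ⟨hz, ht⟩)] with q hq
    exact rφ.e2 q.1 hq.1 q.2 hq.2 X Y
  refine ⟨⟨hM, rφ.sm, ?_, ?_, ?_, ?_, ?_⟩, fun X => ⟨by positivity, ?_, ?_, ?_, ?_, ?_, ?_⟩,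
    fun X Y => ⟨by positivity, ?_, ?_, ?_, ?_, ?_, ?_⟩⟩
  · exact fun z hz t ht => (B0 z hz t ht).1 (hb0 0 (by norm_num) z hz t ht)
  · exact fun z hz t ht => (B0 z hz t ht).2.1 (hb0 1 (by norm_num) z hz t ht)
  · exact fun z hz t ht X => ((B0 z hz t ht).2.2.1 (hb0 2 (by norm_num) z hz t ht) X X).trans
      (by rw [sq])
  · exact fun z hz t ht => (B1 z hz t ht).1 (hb 0 1 (by norm_num) z hz t ht)
  · exact rφ.c0.mono (prod_mono subset_rfl Ioo_subset_Ico_self)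
  · exact fun z hz t ht => ((rφ.sm z hz t ht).dd _).congr (E1 z hz t ht X)
  · intro z hz t ht
    rw [rφ.e1 z hz t ht X]
    exact (B0 z hz t ht).2.1 (hb0 1 (by norm_num) z hz t ht) X
  · intro z hz t ht Y
    rw [dd_congr (E1 z hz t ht X)]
    exact ((B0 z hz t ht).2.2.1 (hb0 2 (by norm_num) z hz t ht) Y X).trans (le_of_eq (by ring))
  · intro z hz t ht Y
    rw [dd_congr (dd_congr_ev (E1 z hz t ht X) _)]
    exact ((B0 z hz t ht).2.2.2.1 (hb0 3 (by norm_num) z hz t ht) Y Y X).trans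
      (le_of_eq (by ring))
  · intro z hz t ht
    rw [dd_congr (E1 z hz t ht X), dd_comm (rφ.sm z hz t ht)]
    exact ((B1 z hz t ht).2.1 (hb 1 1 (by norm_num) z hz t ht) X)
  · exact rφ.c1.clm_apply continuousOn_const
  · exact fun z hz t ht => (((rφ.sm z hz t ht).dd _).dd _).congr (E2 z hz t ht X Y)
  · intro z hz t ht
    rw [rφ.e2 z hz t ht X Y]
    exact (B0 z hz t ht).2.2.1 (hb0 2 (by norm_num) z hz t ht) X Y
  · intro z hz t ht Z
    rw [dd_congr (E2 z hz t ht X Y)]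
    exact ((B0 z hz t ht).2.2.2.1 (hb0 3 (by norm_num) z hz t ht) Z X Y).trans
      (le_of_eq (by ring))
  · intro z hz t ht Z
    rw [dd_congr (dd_congr_ev (E2 z hz t ht X Y) _)]
    exact ((B0 z hz t ht).2.2.2.2 (hb0 4 (by norm_num) z hz t ht) Z Z X Y).trans
      (le_of_eq (by ring))
  · intro z hz t ht
    have h1 : dd ((0 : Cn n), (1 : ℝ)) (dd (Y, (0 : ℝ)) φ) =ᶠ[𝓝 (z, t)]
        dd (Y, (0 : ℝ)) (dd ((0 : Cn n), (1 : ℝ)) φ) := by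
      filter_upwards [hO.mem_nhds (show (z, t) ∈ Ω ×ˢ Ioo (0 : ℝ) T from ⟨hz, ht⟩)] with q hq
      exact dd_comm (rφ.sm q.1 hq.1 q.2 hq.2) _ _
    rw [dd_congr (E2 z hz t ht X Y), dd_comm ((rφ.sm z hz t ht).dd _), dd_congr h1]
    exact ((B1 z hz t ht).2.2.1 (hb 2 1 (by norm_num) z hz t ht) X Y)
  · exact (rφ.c2.clm_apply continuousOn_const).clm_apply continuousOn_const

theorem sol_of {Ω : Set (Cn n)} {ρ : Cn n → ℝ} {c K T Cu Cφ Cf : ℝ} (D : Dom Ω ρ c K)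
    (hT : 0 < T) {u φ : Cn n × ℝ → ℝ} {f : ℝ × Cn n × ℝ → ℝ}
    (h : AprioriHyps n Ω T Cu Cφ Cf u φ f) : Sol Ω T (1 + |Cu| + |Cφ| + |Cf|) u φ := by
  obtain ⟨hφ, hf, hu, hC, hpos, hpde, hbd, hin, hmon, hfb, hφb⟩ := h
  have hO : IsOpen (Ω ×ˢ Ioo (0 : ℝ) T) := D.op.prod isOpen_Ioo
  set M := 1 + |Cu| + |Cφ| + |Cf| with hMdef
  have hCu : Cu ≤ M := by
    linarith [le_abs_self Cu, abs_nonneg Cu, abs_nonneg Cφ, abs_nonneg Cf]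
  have hCφ : Cφ ≤ M := by
    linarith [le_abs_self Cφ, abs_nonneg Cu, abs_nonneg Cφ, abs_nonneg Cf]
  have hCf : Cf ≤ M := by
    linarith [le_abs_self Cf, abs_nonneg Cu, abs_nonneg Cφ, abs_nonneg Cf]
  have hM1 : (1 : ℝ) ≤ M := by linarith [abs_nonneg Cu, abs_nonneg Cφ, abs_nonneg Cf]
  have hmem : ∀ z ∈ Ω, ∀ t ∈ Ioo (0 : ℝ) T, (z, t) ∈ Ω ×ˢ Ioo (0 : ℝ) T :=
    fun z hz t ht => ⟨hz, ht⟩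
  have husm : ∀ z ∈ Ω, ∀ t ∈ Ioo (0 : ℝ) T, Sm u (z, t) := fun z hz t ht =>
    hu.contDiffAt (hO.mem_nhds (hmem z hz t ht))
  have hφsm : ∀ z ∈ Ω, ∀ t ∈ Ioo (0 : ℝ) T, Sm φ (z, t) := fun z hz t ht =>
    hφ.contDiffAt (mem_of_superset (hO.mem_nhds (hmem z hz t ht))
      (prod_mono subset_closure Ioo_subset_Ico_self))
  have ru := reg_of D husm hC
  have rφ := reg_of D hφsm (C21_of_smooth D.uniqueDiff hφ)
  obtain ⟨B0, B1, B2⟩ := phi_bd D.op (by linarith) hT rφ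
    (fun j l hjl z hz t ht => (hφb j l hjl z hz t ht).trans hCφ)
  refine ⟨hM1, hT, ru, rφ, hbd, ?_, ?_, B0, B1, B2, ?_⟩
  · intro z hz t ht
    exact derivWithin_congr (fun s hs => hbd z hz s hs) (hbd z hz t ht)
  · intro z hz
    have h1 : ContinuousWithinAt (fun x => u (x, (0 : ℝ))) (closure Ω) z :=
      (ru.c0.comp (f := fun x => (x, (0 : ℝ))) (by fun_prop) (fun x hx => ⟨hx, le_rfl, hT⟩)) z hz
    have h2 : (𝓝[Ω] z).NeBot := mem_closure_iff_nhdsWithin_neBot.1 hz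
    refine le_of_tendsto (h1.mono subset_closure).tendsto.abs ?_
    filter_upwards [self_mem_nhdsWithin] with x hx
    exact (hin x hx).trans hCu
  · intro z hz t ht
    have hfo : ∀ r : ℝ, Sm f (t, z, r) := by
      intro r
      refine hf.contDiffAt ?_
      refine mem_of_superset ((isOpen_Ioo.prod (D.op.prod isOpen_univ)).mem_nhds
        (show (t, z, r) ∈ Ioo (0 : ℝ) T ×ˢ Ω ×ˢ (univ : Set ℝ) from ⟨ht, hz, mem_univ _⟩))
        (prod_mono Ioo_subset_Ico_self (prod_mono subset_closure subset_rfl))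
    have hfd := (hfo (u (z, t))).diff
    have hF : HasFDerivAt (fun q : Cn n × ℝ => f (q.2, q.1, u q))
        ((fderiv ℝ f (t, z, u (z, t))).comp ((ContinuousLinearMap.snd ℝ (Cn n) ℝ).prod
          ((ContinuousLinearMap.fst ℝ (Cn n) ℝ).prod (fderiv ℝ u (z, t))))) (z, t) := by
      have h1 : HasFDerivAt (fun q : Cn n × ℝ => (q.2, q.1, u q))
          ((ContinuousLinearMap.snd ℝ (Cn n) ℝ).prod
          ((ContinuousLinearMap.fst ℝ (Cn n) ℝ).prod (fderiv ℝ u (z, t)))) (z, t) :=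
        hasFDerivAt_snd.prodMk (hasFDerivAt_fst.prodMk (husm z hz t ht).diff.hasFDerivAt)
      exact HasFDerivAt.comp (z, t) (f := fun q : Cn n × ℝ => (q.2, q.1, u q)) hfd.hasFDerivAt h1
    have hpde' : ∀ z t, (z, t) ∈ Ω ×ˢ Ioo (0 : ℝ) T → dd ((0 : Cn n), (1 : ℝ)) u (z, t) =
        Real.log ((cHess (fun w => u (w, t)) z).det.re) +
          (fun q : Cn n × ℝ => f (q.2, q.1, u q)) (z, t) := by
      intro z t h
      rw [← hpde z h.1 t h.2]
      have h2 : HasFDerivAt u (fderiv ℝ u (z, t)) (z, t) := (husm z h.1 t h.2).diff.hasFDerivAt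
      have h3 : HasDerivAt (fun s : ℝ => (z, s)) ((0 : Cn n), (1 : ℝ)) t :=
        (hasDerivAt_const t z).prodMk (hasDerivAt_id t)
      exact (h2.comp_hasDerivAt t h3).deriv.symm
    obtain ⟨v, μ, hμ, q1, q2, e1, e2⟩ := frame_exists hO
      (fun p hp => husm p.1 hp.1 p.2 hp.2) (fun z t h => hpos t h.2 z h.1) hpde'
      (hmem z hz t ht) hF.differentiableAt
    have hk : deriv (fun y => f (t, z, y)) (u (z, t)) =
        dd ((0 : ℝ), ((0 : Cn n), (1 : ℝ))) f (t, z, u (z, t)) := by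
      have h3 : HasDerivAt (fun s : ℝ => (t, z, s)) ((0 : ℝ), ((0 : Cn n), (1 : ℝ))) (u (z, t)) :=
        (hasDerivAt_const _ t).prodMk ((hasDerivAt_const _ z).prodMk (hasDerivAt_id _))
      exact (hfd.hasFDerivAt.comp_hasDerivAt (u (z, t)) h3).deriv
    have hfb' : ∀ k ≤ 2, ‖iteratedFDeriv ℝ k f (t, z, u (z, t))‖ ≤ M := fun k hk =>
      (hfb k hk _ ⟨ht, hz, mem_univ _⟩).trans hCf
    have hd := fun X => dd1_le (h := f) X (hfb' 1 (by norm_num))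
    refine ⟨v, μ, dd ((0 : ℝ), ((0 : Cn n), (1 : ℝ))) f (t, z, u (z, t)), f (t, z, u (z, t)),
      hμ, q1, q2, ?_, ?_, ?_, e1, ?_⟩
    · have := hfb' 0 (by norm_num)
      rwa [norm_iteratedFDeriv_zero] at this
    · have h5 := (abs_le.1 (hd ((0 : ℝ), ((0 : Cn n), (1 : ℝ))))).1
      simpa [Prod.norm_def] using h5
    · rw [← hk]
      exact hmon t ht z hz _
    · intro X
      rw [e2 X]
      have h6 : dd X (fun q : Cn n × ℝ => f (q.2, q.1, u q)) (z, t) =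
          dd (X.2, (X.1, (0 : ℝ))) f (t, z, u (z, t)) +
            dd ((0 : ℝ), ((0 : Cn n), (1 : ℝ))) f (t, z, u (z, t)) * dd X u (z, t) := by
        have h7 : dd X (fun q : Cn n × ℝ => f (q.2, q.1, u q)) (z, t) =
            dd (X.2, (X.1, dd X u (z, t))) f (t, z, u (z, t)) := by
          unfold dd
          rw [hF.fderiv]
          rfl
        have h8 : (X.2, (X.1, dd X u (z, t))) = (X.2, (X.1, (0 : ℝ))) +
            dd X u (z, t) • ((0 : ℝ), ((0 : Cn n), (1 : ℝ))) := by
          ext <;> simp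
        rw [h7, h8, dd_vadd, dd_vsmul]
        ring
      rw [h6, add_sub_cancel_right]
      refine (hd _).trans (le_of_eq ?_)
      congr 1
      simp only [Prod.norm_def, norm_zero]
      rw [max_eq_left (norm_nonneg X.1), max_comm]

/-- A diagonalising frame at a point. -/
structure DFr (M : ℝ) (u : Cn n × ℝ → ℝ) (p : Cn n × ℝ) (v : OrthonormalBasis (Fin n) ℂ (Cn n))
    (μ : Fin n → ℝ) (k F : ℝ) : Prop where
  sm : Sm u p
  pos : ∀ a, 0 < μ a
  q1 : ∀ X a, Qf u p X (v a) = (inner ℂ (v a) X : ℂ).re / μ a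
  q2 : ∀ X a, Qf u p X (Complex.I • v a) = (inner ℂ (v a) X : ℂ).im / μ a
  hF : |F| ≤ M
  k1 : -M ≤ k
  k0 : k ≤ 0
  ut : dd ((0 : Cn n), (1 : ℝ)) u p = - ∑ a, Real.log (4 * μ a) + F
  L : ∀ X, |Lop v μ (dd X u) p - k * dd X u p| ≤ M * ‖X‖

theorem Sol.frm {Ω : Set (Cn n)} {T M : ℝ} {u φ : Cn n × ℝ → ℝ} (S : Sol Ω T M u φ)
    {z : Cn n} (hz : z ∈ Ω) {t : ℝ} (ht : t ∈ Ioo (0 : ℝ) T) :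
    ∃ (v : OrthonormalBasis (Fin n) ℂ (Cn n)) (μ : Fin n → ℝ) (k F : ℝ),
      DFr M u (z, t) v μ k F := by
  obtain ⟨v, μ, k, F, h1, h2, h3, h4, h5, h6, h7, h8⟩ := S.fr z hz t ht
  exact ⟨v, μ, k, F, S.ru.sm z hz t ht, h1, h2, h3, h4, h5, h6, h7, h8⟩

theorem Lop_congr (v : Fin n → Cn n) (μ : Fin n → ℝ) {a b : Cn n × ℝ → ℝ} {p : Cn n × ℝ}
    (h : a =ᶠ[𝓝 p] b) : Lop v μ a p = Lop v μ b p := by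
  unfold Lop frS
  rw [dd_congr h]
  congr 1
  refine Finset.sum_congr rfl fun i _ => ?_
  simp only [dd_congr (dd_congr_ev h _)]

theorem dd_snd (X : Cn n × ℝ) : dd X (fun q : Cn n × ℝ => q.2) = fun _ => X.2 := by
  funext p
  have h1 : HasFDerivAt (fun q : Cn n × ℝ => q.2) (ContinuousLinearMap.snd ℝ (Cn n) ℝ) p :=
    (ContinuousLinearMap.snd ℝ (Cn n) ℝ).hasFDerivAt
  simp [dd, h1.fderiv]

theorem Sm_snd (p : Cn n × ℝ) : Sm (fun q : Cn n × ℝ => q.2) p := contDiff_snd.contDiffAt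

theorem Lop_snd (v : Fin n → Cn n) (μ : Fin n → ℝ) (p : Cn n × ℝ) :
    Lop v μ (fun q : Cn n × ℝ => q.2) p = 1 := by
  unfold Lop frS
  simp [dd_snd, dd_const]

theorem Lop_tmul (v : Fin n → Cn n) (μ : Fin n → ℝ) {b : Cn n × ℝ → ℝ} {p : Cn n × ℝ}
    (hb : Sm b p) :
    Lop v μ (fun q => q.2 * b q) p = p.2 * Lop v μ b p + b p := by
  rw [Lop_mul v μ (Sm_snd p) hb, Lop_snd]
  have : Gam v μ (fun q : Cn n × ℝ => q.2) b p = 0 := by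
    unfold Gam frS
    simp [dd_snd]
  rw [this]
  ring

theorem Lop_rho {Ω : Set (Cn n)} {ρ : Cn n → ℝ} {c K : ℝ} (D : Dom Ω ρ c K)
    {v : Fin n → Cn n} (hv : ∀ i, ‖v i‖ = 1) {μ : Fin n → ℝ} (hμ : ∀ i, 0 < μ i)
    {z : Cn n} (hz : z ∈ closure Ω) (t : ℝ) :
    Lop v μ (fun q => ρ q.1) (z, t) ≤ - (c * ∑ i, μ i) := by
  unfold Lop frS
  rw [dd_fst_fun D.sm]
  have h0 : dd (0 : Cn n) ρ z = 0 := by simp [dd]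
  simp only [h0, zero_sub]
  rw [neg_le_neg_iff, Finset.mul_sum]
  refine Finset.sum_le_sum fun i _ => ?_
  have h1 := D.psh z hz (v i)
  rw [dd_fst_fun D.sm, dd_fst_fun (D.cdd _), dd_fst_fun D.sm, dd_fst_fun (D.cdd _)]
  rw [hv i] at h1
  have := hμ i
  simp only
  nlinarith

theorem log_sum_le {ι : Type*} (s : Finset ι) (x : ι → ℝ) (hx : ∀ i ∈ s, 0 < x i) :
    (s.card : ℝ) + ∑ i ∈ s, Real.log (x i) ≤ ∑ i ∈ s, x i := by
  have : ∀ i ∈ s, 1 + Real.log (x i) ≤ x i := fun i hi => by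
    linarith [Real.log_le_sub_one_of_pos (hx i hi)]
  have h := Finset.sum_le_sum this
  rw [Finset.sum_add_distrib] at h
  simpa using h

theorem trace_log {μ : Fin n → ℝ} (hμ : ∀ i, 0 < μ i) {s : ℝ} (hs : 0 < s) :
    n + n * Real.log s + ∑ i, Real.log (4 * μ i) ≤ 4 * s * ∑ i, μ i := by
  have h := log_sum_le Finset.univ (fun i => s * (4 * μ i)) (fun i _ => by
    have := hμ i; positivity)
  have h2 : ∀ i, Real.log (s * (4 * μ i)) = Real.log s + Real.log (4 * μ i) := fun i => by
    have := hμ i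
    rw [Real.log_mul hs.ne' (by positivity)]
  simp only [h2, Finset.sum_add_distrib] at h
  simp at h
  rw [← Finset.mul_sum, ← Finset.mul_sum] at h
  linarith

namespace DFr
variable {M : ℝ} {u : Cn n × ℝ → ℝ} {p : Cn n × ℝ} {v : OrthonormalBasis (Fin n) ℂ (Cn n)}
    {μ : Fin n → ℝ} {k F : ℝ}

theorem nv (v : OrthonormalBasis (Fin n) ℂ (Cn n)) (i : Fin n) : ‖v i‖ = 1 :=
  v.orthonormal.1 i

theorem nIv (v : OrthonormalBasis (Fin n) ℂ (Cn n)) (i : Fin n) : ‖Complex.I • v i‖ = 1 := by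
  rw [norm_smul, nv v i]; simp

theorem qvv (H : DFr M u p v μ k F) (a : Fin n) : Qf u p (v a) (v a) = 1 / μ a := by
  rw [H.q1, inner_self_eq_norm_sq_to_K, nv v a]
  simp

theorem Lop_u (H : DFr M u p v μ k F) : Lop v μ u p = dd ((0 : Cn n), (1 : ℝ)) u p - n := by
  unfold Lop frS
  congr 1
  have h : ∀ a, μ a * (dd (v a, (0 : ℝ)) (dd (v a, (0 : ℝ)) u) p +
      dd (Complex.I • v a, (0 : ℝ)) (dd (Complex.I • v a, (0 : ℝ)) u) p) = 1 := by
    intro a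
    have h1 := H.qvv a
    unfold Qf at h1
    rw [h1]
    field_simp [(H.pos a).ne']
  simp [h]

/-- Key lower bound with the strictly plurisubharmonic function. -/
theorem key (H : DFr M u p v μ k F) {c : ℝ} (hc : 0 < c) :
    - M + n * Real.log (c / 4) + n ≤ dd ((0 : Cn n), (1 : ℝ)) u p + c * ∑ i, μ i := by
  have h1 := trace_log H.pos (s := c / 4) (by positivity)
  have h2 := (abs_le.1 H.hF).1
  rw [H.ut]
  linarith

end DFr

section est
variable {Ω : Set (Cn n)} {ρ : Cn n → ℝ} {c K : ℝ}

theorem closure_cases (hΩ : IsOpen Ω) {z : Cn n} (hz : z ∈ closure Ω) : z ∈ Ω ∨ z ∈ frontier Ω := by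
  by_cases h : z ∈ Ω
  · exact Or.inl h
  · right
    rw [hΩ.frontier_eq]
    exact ⟨hz, h⟩

/-- At a slice minimum of `W`, the form `Q` of `W` is nonnegative. -/
theorem slice_Q {W : Cn n × ℝ → ℝ} (hΩ : IsOpen Ω) {z : Cn n} {t : ℝ}
    (hz : z ∈ Ω) (h : Sm W (z, t)) (hm : ∀ y ∈ Ω, W (z, t) ≤ W (y, t)) (X : Cn n) :
    0 ≤ Qf W (z, t) X X :=
  add_nonneg (slice_min hΩ hz h hm X).2 (slice_min hΩ hz h hm (Complex.I • X)).2

theorem slice_nonneg {W : Cn n × ℝ → ℝ} {t : ℝ} (hΩ : IsOpen Ω) (hb : IsBounded Ω)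
    (hc : ContinuousOn (fun x => W (x, t)) (closure Ω)) (hs : ∀ z ∈ Ω, Sm W (z, t))
    (hbd : ∀ z ∈ frontier Ω, 0 ≤ W (z, t))
    (hQ : ∀ z ∈ Ω, (∀ X, 0 ≤ Qf W (z, t) X X) → False) :
    ∀ z ∈ closure Ω, 0 ≤ W (z, t) := by
  intro z hz
  obtain ⟨z0, hz0, hmin⟩ := hb.isCompact_closure.exists_isMinOn ⟨z, hz⟩ hc
  have h1 : ∀ y ∈ closure Ω, W (z0, t) ≤ W (y, t) := fun y hy => hmin hy
  rcases closure_cases hΩ hz0 with h | h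
  · exact (hQ z0 h fun X => slice_Q hΩ h (hs z0 h) (fun y hy => h1 y (subset_closure hy)) X).elim
  · exact (hbd z0 h).trans (h1 z hz)

theorem Sol.cslice {T M : ℝ} {u φ : Cn n × ℝ → ℝ} (S : Sol Ω T M u φ) {t : ℝ}
    (ht : t ∈ Ico (0 : ℝ) T) : ContinuousOn (fun x => u (x, t)) (closure Ω) :=
  S.ru.c0.comp (f := fun x => (x, t)) (by fun_prop) (fun x hx => ⟨hx, ht⟩)

theorem Sol.le_M [NeZero n] {T M : ℝ} {u φ : Cn n × ℝ → ℝ} (D : Dom Ω ρ c K)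
    (S : Sol Ω T M u φ) : ∀ z ∈ closure Ω, ∀ t ∈ Ico (0 : ℝ) T, u (z, t) ≤ M := by
  intro z hz t ht
  rcases eq_or_lt_of_le ht.1 with h0 | h0
  · rw [← h0]
    exact (abs_le.1 (S.init z hz)).2
  have ht' : t ∈ Ioo (0 : ℝ) T := ⟨h0, ht.2⟩
  have := slice_nonneg (W := fun q => M - u q) (t := t) D.op D.bdd
    (continuousOn_const.sub (S.cslice ht)) (fun z hz => (Sm.const M _).sub (S.ru.sm z hz t ht'))
    (fun y hy => by
      rw [S.bdry y hy t ht]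
      linarith [(abs_le.1 (S.bφ0.b0c y (frontier_subset_closure hy) t ht')).2])
    (fun y hy hX => by
      obtain ⟨v, μ, k, F, H⟩ := S.frm hy ht'
      have h1 := hX (v 0)
      unfold Qf at h1
      rw [dd2_sub (Sm.const M _) H.sm, dd2_sub (Sm.const M _) H.sm, dd2_const, dd2_const] at h1
      have h2 := H.qvv 0
      unfold Qf at h2
      have h3 : 0 < 1 / μ 0 := by have := H.pos 0; positivity
      linarith) z hz
  linarith

theorem nlog_le (c : ℝ) : - (n * |Real.log (c / 4)|) ≤ n * Real.log (c / 4) := by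
  have h1 := neg_abs_le (Real.log (c / 4))
  have h2 : (0 : ℝ) ≤ n := Nat.cast_nonneg n
  nlinarith

theorem u_bound [NeZero n] (D : Dom Ω ρ c K) (T M : ℝ) : ∃ C : ℝ, 1 ≤ C ∧ ∀ u φ : Cn n × ℝ → ℝ,
    Sol Ω T M u φ → ∀ z ∈ closure Ω, ∀ t ∈ Ico (0 : ℝ) T, |u (z, t)| ≤ C := by
  set K0 := |M| + n * |Real.log (c / 4)| + 1 with hK0
  have hK0' : 0 < K0 := by positivity
  have hp1 := D.Kpos
  have hp2 := abs_nonneg M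
  have hp3 : 0 ≤ K0 * |T| := by positivity
  refine ⟨1 + |M| + K0 * |T| + K, by linarith, ?_⟩
  intro u φ S z hz t ht
  have hM := abs_of_nonneg (a := M) (by linarith [S.M1])
  have hT := abs_of_pos S.T0
  rw [hM, hT]
  rw [abs_le]
  constructor
  swap
  · have h1 := S.le_M D z hz t ht
    have : 0 ≤ K0 * T := mul_nonneg hK0'.le S.T0.le
    linarith [D.Kpos]
  have hsub : Icc 0 t ⊆ Ico (0 : ℝ) T := fun s hs => ⟨hs.1, lt_of_le_of_lt hs.2 ht.2⟩
  have key := min_principle D.op D.bdd (t0 := 0) (t1 := t)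
    (W := fun q => (u q - ρ q.1) + (M + K0 * q.2))
    (((S.ru.c0.mono (prod_mono subset_rfl hsub)).sub
      (D.sm.continuous.comp continuous_fst).continuousOn).add (by fun_prop))
    (fun y hy s hs => (((S.ru.sm y hy s ⟨hs.1, lt_of_le_of_lt hs.2 ht.2⟩).sub (Sm_fst D.sm _)).add
      ((Sm.const M _).add ((Sm.const K0 _).mul (Sm_snd _)))))
    (fun y hy => by
      have h1 := (abs_le.1 (S.init y hy)).1
      have h2 := D.le0 hy
      simp only [mul_zero]
      linarith)
    (fun y hy s hs => by
      rw [S.bdry y hy s (hsub hs), D.zero y hy]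
      have hs' := hsub hs
      have h3 : 0 ≤ K0 * s := mul_nonneg hK0'.le hs.1
      rcases eq_or_lt_of_le hs.1 with h0 | h0
      · have h1 := (abs_le.1 (S.init y (frontier_subset_closure hy))).1
        rw [← h0, ← S.bdry y hy 0 ⟨le_rfl, S.T0⟩]
        linarith
      · have := (abs_le.1 (S.bφ0.b0c y (frontier_subset_closure hy) s ⟨h0, hs'.2⟩)).1
        linarith)
    (fun y hy s hs _ => by
      obtain ⟨v, μ, k, F, H⟩ := S.frm hy (t := s) ⟨hs.1, lt_of_le_of_lt hs.2 ht.2⟩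
      refine ⟨v, μ, fun a => (H.pos a).le, ?_⟩
      have s1 := (H.sm.sub (Sm_fst D.sm _))
      have s2 := ((Sm.const M (y, s)).add ((Sm.const K0 _).mul (Sm_snd _)))
      rw [Lop_add _ _ s1 s2, Lop_sub _ _ H.sm (Sm_fst D.sm _),
        Lop_add _ _ (Sm.const M (y, s)) ((Sm.const K0 _).mul (Sm_snd _)), Lop_const,
        Lop_cmul _ _ _ (Sm_snd _), Lop_snd, H.Lop_u]
      have h1 := H.key D.cpos
      have h2 := Lop_rho D (DFr.nv v) H.pos (subset_closure hy) s
      have h3 := nlog_le (n := n) c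
      rw [hM] at hK0
      linarith)
    z hz t ⟨ht.1, le_rfl⟩
  have h1 := D.b0 z
  have h2 := (abs_le.1 h1).2
  have h3 := (abs_le.1 h1).1
  have h4 : K0 * t ≤ K0 * T := mul_le_mul_of_nonneg_left ht.2.le hK0'.le
  linarith

theorem Sol.Dtphi {T M : ℝ} {u φ : Cn n × ℝ → ℝ}
    (S : Sol Ω T M u φ) : ∀ z ∈ closure Ω, ∀ t ∈ Ioo (0 : ℝ) T, |Dt T φ (z, t)| ≤ M := by
  intro z hz t ht
  have h1 : ContinuousWithinAt (fun x => Dt T φ (x, t)) (closure Ω) z :=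
    (S.rφ.ct.comp (f := fun x => (x, t)) (by fun_prop) (fun x hx => ⟨hx, ht.1.le, ht.2⟩)) z hz
  have h2 : (𝓝[Ω] z).NeBot := mem_closure_iff_nhdsWithin_neBot.1 hz
  refine le_of_tendsto (h1.mono subset_closure).tendsto.abs ?_
  filter_upwards [self_mem_nhdsWithin] with x hx
  rw [S.rφ.et x hx t ht]
  exact S.bφ0.bt x hx t ht

theorem Sol.Dt_ev {T M : ℝ} {u φ : Cn n × ℝ → ℝ} (hΩ : IsOpen Ω)
    (S : Sol Ω T M u φ) {z : Cn n} (hz : z ∈ Ω) {t : ℝ} (ht : t ∈ Ioo (0 : ℝ) T) :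
    Dt T u =ᶠ[𝓝 (z, t)] dd ((0 : Cn n), (1 : ℝ)) u := by
  filter_upwards [(hΩ.prod isOpen_Ioo).mem_nhds (show (z, t) ∈ Ω ×ˢ Ioo (0 : ℝ) T from ⟨hz, ht⟩)]
    with q hq
  exact S.ru.et q.1 hq.1 q.2 hq.2

theorem ut_bound [NeZero n] (D : Dom Ω ρ c K) (T M : ℝ) : ∃ C : ℝ, 1 ≤ C ∧ ∀ u φ : Cn n × ℝ → ℝ,
    Sol Ω T M u φ → ∀ z ∈ closure Ω, ∀ t ∈ Ico (0 : ℝ) T, |t * Dt T u (z, t)| ≤ C := by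
  obtain ⟨C0, hC0, hu0⟩ := u_bound D T M
  set C1 := n + |T| * |M| + 1 with hC1
  set K0 := |M| + |T| * |M| + n * |Real.log (c / 4)| + 1 with hK0
  have hTM : 0 ≤ |T| * |M| := by positivity
  have hK0' : 0 < K0 := by positivity
  have hC1' : 0 < C1 := by positivity
  have hKp := D.Kpos
  have hC1T : 0 ≤ C1 * |T| := by positivity
  have hK0T : 0 ≤ K0 * |T| := by positivity
  refine ⟨2 * C0 + |T| * |M| + C1 * |T| + K0 * |T| + K, by linarith, ?_⟩
  intro u φ S z hz t ht
  have hM := abs_of_nonneg (a := M) (by linarith [S.M1])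
  have hT := abs_of_pos S.T0
  rw [hM, hT] at hTM hC1 hK0 ⊢
  rw [hT] at hC1T hK0T
  have hM1 := S.M1
  have hT0 := S.T0
  have hsub : Icc 0 t ⊆ Ico (0 : ℝ) T := fun s hs => ⟨hs.1, lt_of_le_of_lt hs.2 ht.2⟩
  have hsub2 : ∀ s ∈ Ioc 0 t, s ∈ Ioo 0 T := fun s hs => ⟨hs.1, lt_of_le_of_lt hs.2 ht.2⟩
  have hcu := S.ru.c0.mono (prod_mono (subset_refl (closure Ω)) hsub)
  have hct := S.ru.ct.mono (prod_mono (subset_refl (closure Ω)) hsub)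
  have hbt : ∀ y ∈ frontier Ω, ∀ s ∈ Icc 0 t, |s * Dt T u (y, s)| ≤ T * M := by
    intro y hy s hs
    rcases eq_or_lt_of_le hs.1 with h0 | h0
    · rw [← h0, zero_mul, abs_zero]
      positivity
    · rw [S.bdt y hy s (hsub hs), abs_mul, abs_of_pos h0]
      exact mul_le_mul (hsub hs).2.le
        (S.Dtphi y (frontier_subset_closure hy) s ⟨h0, (hsub hs).2⟩) (abs_nonneg _) S.T0.le
  have hn1 : ‖((0 : Cn n), (1 : ℝ))‖ = 1 := by simp [Prod.norm_def]
  have upper := min_principle D.op D.bdd (t0 := 0) (t1 := t)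
    (W := fun q => ((C0 + T * M) + C1 * q.2) + (u q - q.2 * Dt T u q))
    (ContinuousOn.add (by fun_prop) (hcu.sub (continuous_snd.continuousOn.mul hct)))
    (fun y hy s hs => ((Sm.const _ _).add ((Sm.const _ _).mul (Sm_snd _))).add
      ((S.ru.sm y hy s (hsub2 s hs)).sub ((Sm_snd _).mul (((S.ru.sm y hy s (hsub2 s hs)).dd _).congr
        (S.Dt_ev D.op hy (hsub2 s hs))))))
    (fun y hy => by
      have h1 := (abs_le.1 (hu0 u φ S y hy 0 ⟨le_rfl, S.T0⟩)).1
      simp only [mul_zero, zero_mul]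
      linarith)
    (fun y hy s hs => by
      have h1 := (abs_le.1 (hu0 u φ S y (frontier_subset_closure hy) s (hsub hs))).1
      have h2 := (abs_le.1 (hbt y hy s hs)).2
      have h3 := mul_nonneg hC1'.le hs.1
      linarith)
    (fun y hy s hs hneg => by
      obtain ⟨v, μ, k, F, H⟩ := S.frm hy (hsub2 s hs)
      refine ⟨v, μ, fun a => (H.pos a).le, ?_⟩
      have hev := S.Dt_ev D.op hy (hsub2 s hs)
      have s0 : Sm (Dt T u) (y, s) := (H.sm.dd _).congr hev
      have s1 := (Sm.const (C0 + T * M) (y, s)).add ((Sm.const C1 _).mul (Sm_snd _))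
      rw [Lop_add _ _ s1 (H.sm.sub ((Sm_snd _).mul s0)),
        Lop_sub _ _ H.sm ((Sm_snd _).mul s0), Lop_tmul _ _ s0,
        Lop_add _ _ (Sm.const _ (y, s)) ((Sm.const C1 _).mul (Sm_snd _)), Lop_const,
        Lop_cmul _ _ _ (Sm_snd _), Lop_snd, H.Lop_u, Lop_congr _ _ hev]
      have h1 := H.L ((0 : Cn n), (1 : ℝ))
      rw [hn1] at h1
      have he := S.ru.et y hy s (hsub2 s hs)
      simp only [he] at hneg ⊢
      have h3 := mul_nonneg hC1'.le hs.1.le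
      have h4 := (abs_le.1 (hu0 u φ S y (subset_closure hy) s (hsub ⟨hs.1.le, hs.2⟩))).1
      have h5 : 0 < s * dd ((0 : Cn n), (1 : ℝ)) u (y, s) := by nlinarith
      have h6 := (abs_le.1 h1).2
      have h7 : s * Lop v μ (dd ((0 : Cn n), (1 : ℝ)) u) (y, s) ≤
          s * (M + k * dd ((0 : Cn n), (1 : ℝ)) u (y, s)) :=
        mul_le_mul_of_nonneg_left (by linarith) hs.1.le
      have h8 := H.k0
      have h9 : s * M ≤ T * M := mul_le_mul_of_nonneg_right (hsub2 s hs).2.le (by linarith)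
      nlinarith)
    z hz t ⟨ht.1, le_rfl⟩
  have lower := min_principle D.op D.bdd (t0 := 0) (t1 := t)
    (W := fun q => (T * M + K0 * q.2) + (q.2 * Dt T u q - ρ q.1))
    (ContinuousOn.add (by fun_prop) ((continuous_snd.continuousOn.mul hct).sub
      (D.sm.continuous.comp continuous_fst).continuousOn))
    (fun y hy s hs => ((Sm.const _ _).add ((Sm.const _ _).mul (Sm_snd _))).add
      (((Sm_snd _).mul (((S.ru.sm y hy s (hsub2 s hs)).dd _).congr
        (S.Dt_ev D.op hy (hsub2 s hs)))).sub (Sm_fst D.sm _)))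
    (fun y hy => by
      have h2 := D.le0 hy
      simp only [mul_zero, zero_mul]
      linarith)
    (fun y hy s hs => by
      have h2 := (abs_le.1 (hbt y hy s hs)).1
      have h3 := mul_nonneg hK0'.le hs.1
      simp only [D.zero y hy]
      linarith)
    (fun y hy s hs hneg => by
      obtain ⟨v, μ, k, F, H⟩ := S.frm hy (hsub2 s hs)
      refine ⟨v, μ, fun a => (H.pos a).le, ?_⟩
      have hev := S.Dt_ev D.op hy (hsub2 s hs)
      have s0 : Sm (Dt T u) (y, s) := (H.sm.dd _).congr hev
      have s1 := (Sm.const (T * M) (y, s)).add ((Sm.const K0 _).mul (Sm_snd _))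
      rw [Lop_add _ _ s1 (((Sm_snd _).mul s0).sub (Sm_fst D.sm _)),
        Lop_sub _ _ ((Sm_snd _).mul s0) (Sm_fst D.sm _), Lop_tmul _ _ s0,
        Lop_add _ _ (Sm.const _ (y, s)) ((Sm.const K0 _).mul (Sm_snd _)), Lop_const,
        Lop_cmul _ _ _ (Sm_snd _), Lop_snd, Lop_congr _ _ hev]
      have h1 := H.L ((0 : Cn n), (1 : ℝ))
      rw [hn1] at h1
      have he := S.ru.et y hy s (hsub2 s hs)
      simp only [he] at hneg ⊢
      have h3 := mul_nonneg hK0'.le hs.1.le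
      have h4 := D.le0 (subset_closure hy)
      have h5 : s * dd ((0 : Cn n), (1 : ℝ)) u (y, s) < 0 := by nlinarith
      have h6 := (abs_le.1 h1).1
      have h7 : s * (-M + k * dd ((0 : Cn n), (1 : ℝ)) u (y, s)) ≤
          s * Lop v μ (dd ((0 : Cn n), (1 : ℝ)) u) (y, s) :=
        mul_le_mul_of_nonneg_left (by linarith) hs.1.le
      have h8 := H.k0
      have h9 : s * M ≤ T * M := mul_le_mul_of_nonneg_right (hsub2 s hs).2.le (by linarith)
      have h10 := H.key D.cpos
      have h11 := Lop_rho D (DFr.nv v) H.pos (subset_closure hy) s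
      have h12 := nlog_le (n := n) c
      have h13 : (0 : ℝ) ≤ n := Nat.cast_nonneg n
      nlinarith)
    z hz t ⟨ht.1, le_rfl⟩
  have h1 := (abs_le.1 (D.b0 z)).1
  have h2 := (abs_le.1 (hu0 u φ S z hz t ht)).2
  have h4 : K0 * t ≤ K0 * T := mul_le_mul_of_nonneg_left ht.2.le hK0'.le
  have h5 : C1 * t ≤ C1 * T := mul_le_mul_of_nonneg_left ht.2.le hC1'.le
  rw [abs_le]
  constructor <;> linarith

end est

section bgrad
variable {Ω : Set (Cn n)} {ρ : Cn n → ℝ} {c K : ℝ}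

/-- The form `Q` expanded in a diagonalising frame. -/
theorem DFr.qxx {M : ℝ} {u : Cn n × ℝ → ℝ} {p : Cn n × ℝ}
    {v : OrthonormalBasis (Fin n) ℂ (Cn n)} {μ : Fin n → ℝ} {k F : ℝ} (H : DFr M u p v μ k F)
    (X : Cn n) : Qf u p X X = ∑ a, ‖(inner ℂ (v a) X : ℂ)‖ ^ 2 / μ a := by
  have hlin : ∀ Y, Qf u p X Y = Bil u p H.sm X Y +
      Bil u p H.sm (Complex.I • X) (Complex.I • Y) := fun Y => rfl
  have hadd : ∀ Y Z, Qf u p X (Y + Z) = Qf u p X Y + Qf u p X Z := by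
    intro Y Z
    simp only [hlin, smul_add, map_add]
    ring
  have hsm : ∀ (r : ℝ) Y, Qf u p X (r • Y) = r * Qf u p X Y := by
    intro r Y
    simp only [hlin, I_rsmul, map_smul, smul_eq_mul]
    ring
  have hsum : ∀ (s : Finset (Fin n)) (Y : Fin n → Cn n),
      Qf u p X (∑ a ∈ s, Y a) = ∑ a ∈ s, Qf u p X (Y a) := by
    intro s Y
    induction s using Finset.induction_on with
    | empty =>
      have := hsm 0 0
      simpa using this
    | insert a s ha ih => rw [Finset.sum_insert ha, Finset.sum_insert ha, hadd, ih]
  conv_lhs => rw [← v.sum_repr' X]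
  have e : ∑ a, inner ℂ (v a) X • v a = X := v.sum_repr' X
  have : Qf u p X (∑ a, inner ℂ (v a) X • v a) = ∑ a, ‖(inner ℂ (v a) X : ℂ)‖ ^ 2 / μ a := by
    rw [hsum]
    refine Finset.sum_congr rfl fun a _ => ?_
    rw [csmul_decomp, hadd, hsm, hsm, H.q1, H.q2, Complex.sq_norm, Complex.normSq_apply]
    have := (H.pos a).ne'
    field_simp
  rw [e]
  rw [e] at this
  exact this

theorem DFr.q_nonneg {M : ℝ} {u : Cn n × ℝ → ℝ} {p : Cn n × ℝ}
    {v : OrthonormalBasis (Fin n) ℂ (Cn n)} {μ : Fin n → ℝ} {k F : ℝ} (H : DFr M u p v μ k F)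
    (X : Cn n) : 0 ≤ Qf u p X X := by
  rw [H.qxx]
  exact Finset.sum_nonneg fun a _ => div_nonneg (sq_nonneg _) (H.pos a).le

theorem norm_sq_frame (v : OrthonormalBasis (Fin n) ℂ (Cn n)) (X : Cn n) :
    ∑ a, ‖(inner ℂ (v a) X : ℂ)‖ ^ 2 = ‖X‖ ^ 2 := v.sum_sq_norm_inner_right X

/-- Lower bound on the form gives a bound on the sum of logs. -/
theorem DFr.log_le {M : ℝ} {u : Cn n × ℝ → ℝ} {p : Cn n × ℝ}
    {v : OrthonormalBasis (Fin n) ℂ (Cn n)} {μ : Fin n → ℝ} {k F : ℝ} (H : DFr M u p v μ k F)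
    {E : ℝ} (h : ∀ X, 4 * Real.exp E * ‖X‖ ^ 2 ≤ Qf u p X X) :
    ∑ a, Real.log (4 * μ a) ≤ - (n * E) := by
  have : ∀ a, Real.log (4 * μ a) ≤ - E := by
    intro a
    have h1 := h (v a)
    rw [H.qvv, DFr.nv] at h1
    have h2 := H.pos a
    rw [Real.log_le_iff_le_exp (by positivity), Real.exp_neg]
    rw [le_div_iff₀ h2] at h1
    rw [← one_div, le_div_iff₀ (Real.exp_pos E)]
    linarith
  calc _ ≤ ∑ a : Fin n, (- E) := Finset.sum_le_sum fun a _ => this a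
    _ = _ := by simp

/-- Bounds on the log-determinant for positive time. -/
theorem logdet_bound [NeZero n] (D : Dom Ω ρ c K) (T M t0 : ℝ) (ht0 : 0 < t0) : ∃ C : ℝ, 1 ≤ C ∧
    ∀ u φ : Cn n × ℝ → ℝ, Sol Ω T M u φ →
    (∀ z ∈ closure Ω, ∀ t ∈ Ico t0 T, |Dt T u (z, t)| ≤ C) ∧
    (∀ z ∈ Ω, ∀ t ∈ Ico t0 T, ∀ v μ k F, DFr M u (z, t) v μ k F →
      |∑ a, Real.log (4 * μ a)| ≤ C ∧ Real.exp (- C) / 4 ≤ ∑ a, μ a ∧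
      |dd ((0 : Cn n), (1 : ℝ)) u (z, t)| ≤ C) := by
  obtain ⟨C1, h1, hC1⟩ := ut_bound D T M
  refine ⟨C1 / t0 + |M| + 1, ?_, ?_⟩
  · have := abs_nonneg M
    have : 0 ≤ C1 / t0 := by positivity
    linarith
  intro u φ S
  have hM := abs_of_nonneg (a := M) (by linarith [S.M1])
  rw [hM]
  have hM1 := S.M1
  have hD : ∀ z ∈ closure Ω, ∀ t ∈ Ico t0 T, |Dt T u (z, t)| ≤ C1 / t0 := by
    intro z hz t ht
    have htp : 0 < t := lt_of_lt_of_le ht0 ht.1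
    have h2 := hC1 u φ S z hz t ⟨htp.le, ht.2⟩
    rw [abs_mul, abs_of_pos htp] at h2
    rw [le_div_iff₀ ht0]
    nlinarith [abs_nonneg (Dt T u (z, t)), ht.1]
  refine ⟨fun z hz t ht => (hD z hz t ht).trans (by linarith), ?_⟩
  intro z hz t ht v μ k F H
  have h2 := hD z (subset_closure hz) t ht
  rw [S.ru.et z hz t ⟨lt_of_lt_of_le ht0 ht.1, ht.2⟩] at h2
  have h3 := H.ut
  have h4 := abs_le.1 H.hF
  have h5 := abs_le.1 h2
  have h6 : |∑ a, Real.log (4 * μ a)| ≤ C1 / t0 + M + 1 := by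
    rw [abs_le]; constructor <;> linarith
  refine ⟨h6, ?_, h2.trans (by linarith)⟩
  set C := C1 / t0 + M + 1
  have h7 := trace_log H.pos (Real.exp_pos C)
  rw [Real.log_exp] at h7
  have hn : (1 : ℝ) ≤ n := by exact_mod_cast NeZero.one_le
  have hC : 0 ≤ C := by
    have : 0 ≤ C1 / t0 := by positivity
    positivity
  have h8 : 1 ≤ 4 * Real.exp C * ∑ a, μ a := by
    have := (abs_le.1 h6).1
    nlinarith
  rw [Real.exp_neg, div_le_iff₀ (by norm_num), ← one_div, div_le_iff₀ (Real.exp_pos C)]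
  linarith

theorem Qf_sub {a b : Cn n × ℝ → ℝ} {p : Cn n × ℝ} (ha : Sm a p) (hb : Sm b p) (X : Cn n) :
    Qf (fun q => a q - b q) p X X = Qf a p X X - Qf b p X X := by
  unfold Qf
  rw [dd2_sub ha hb, dd2_sub ha hb]
  ring

theorem Dom.Qf_rho (D : Dom Ω ρ c K) (A : ℝ) {z : Cn n} (t : ℝ) (X : Cn n) :
    Qf (fun q => A * ρ q.1) (z, t) X X = A * (dd X (dd X ρ) z +
      dd (Complex.I • X) (dd (Complex.I • X) ρ) z) := by
  have h : ∀ Y : Cn n, dd (Y, (0 : ℝ)) (dd (Y, (0 : ℝ)) fun q : Cn n × ℝ => A * ρ q.1) (z, t) =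
      A * dd Y (dd Y ρ) z := by
    intro Y
    rw [dd2_mul (Sm.const A _) (Sm_fst D.sm _), dd2_const]
    rw [dd_fst_fun D.sm, dd_fst_fun (D.cdd _)]
    simp [dd_const]
  unfold Qf
  rw [h, h]
  ring

theorem Bd.Qf_le {T M : ℝ} {a : Cn n × ℝ → ℝ} (h : Bd Ω T M a) {z : Cn n} (hz : z ∈ Ω) {t : ℝ}
    (ht : t ∈ Ioo (0 : ℝ) T) (X : Cn n) : |Qf a (z, t) X X| ≤ 2 * M * ‖X‖ ^ 2 := by
  have h1 := h.b2 z hz t ht X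
  have h2 := h.b2 z hz t ht (Complex.I • X)
  rw [norm_smul, Complex.norm_I, one_mul] at h2
  unfold Qf
  have := abs_add_le (dd (X, (0 : ℝ)) (dd (X, (0 : ℝ)) a) (z, t))
    (dd (Complex.I • X, (0 : ℝ)) (dd (Complex.I • X, (0 : ℝ)) a) (z, t))
  linarith

theorem barrier_bound [NeZero n] (D : Dom Ω ρ c K) (T M t0 : ℝ) (ht0 : 0 < t0) : ∃ A : ℝ, 1 ≤ A ∧
    ∀ u φ : Cn n × ℝ → ℝ, Sol Ω T M u φ →
    ∀ z ∈ closure Ω, ∀ t ∈ Ico t0 T, |u (z, t) - φ (z, t)| ≤ - (A * ρ z) := by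
  obtain ⟨C, hC, hCs⟩ := logdet_bound D T M t0 ht0
  have hc := D.cpos
  set A := (4 * Real.exp (C + 1) + 2 * |M|) / c + 1 with hA
  have hA0 : 0 ≤ (4 * Real.exp (C + 1) + 2 * |M|) / c := by positivity
  refine ⟨A, by linarith, ?_⟩
  intro u φ S z hz t ht
  have ht' : t ∈ Ioo (0 : ℝ) T := ⟨lt_of_lt_of_le ht0 ht.1, ht.2⟩
  have hM := abs_of_nonneg (a := M) (by linarith [S.M1])
  have hAc : 4 * Real.exp (C + 1) + 2 * M ≤ A * c := by
    rw [hA, add_mul, div_mul_cancel₀ _ hc.ne', hM]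
    linarith
  have hA1 : 0 < A := by linarith
  have hn : (1 : ℝ) ≤ n := by exact_mod_cast NeZero.one_le
  have hcφ : ContinuousOn (fun x => φ (x, t)) (closure Ω) :=
    S.rφ.c0.comp (f := fun x => (x, t)) (by fun_prop) (fun x hx => ⟨hx, ht'.1.le, ht'.2⟩)
  have hcu := S.cslice (t := t) ⟨ht'.1.le, ht'.2⟩
  have hsA : ∀ q : Cn n × ℝ, Sm (fun q : Cn n × ℝ => A * ρ q.1) q := fun q =>
    (Sm.const A q).mul (Sm_fst D.sm q)
  have hcA : ContinuousOn (fun x => A * ρ x) (closure Ω) :=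
    (continuous_const.mul D.sm.continuous).continuousOn
  have l1 := slice_nonneg (W := fun q => (u q - φ q) - A * ρ q.1) (t := t) D.op D.bdd
    ((hcu.sub hcφ).sub hcA)
    (fun y hy => ((S.ru.sm y hy t ht').sub (S.rφ.sm y hy t ht')).sub (hsA _))
    (fun y hy => by
      rw [S.bdry y hy t ⟨ht'.1.le, ht'.2⟩, D.zero y hy]; simp)
    (fun y hy hX => by
      obtain ⟨v, μ, k, F, H⟩ := S.frm hy ht'
      have h1 := (hCs u φ S).2 y hy t ht v μ k F H
      have h2 := H.log_le (E := C + 1) (fun X => by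
        have h3 := hX X
        rw [Qf_sub ((S.ru.sm y hy t ht').sub (S.rφ.sm y hy t ht')) (hsA _),
          Qf_sub (S.ru.sm y hy t ht') (S.rφ.sm y hy t ht'), D.Qf_rho] at h3
        have h4 := D.psh y (subset_closure hy) X
        have h5 := (abs_le.1 (S.bφ0.Qf_le hy ht' X)).1
        have h6 := mul_le_mul_of_nonneg_left h4 hA1.le
        have h7 := mul_le_mul_of_nonneg_right hAc (sq_nonneg ‖X‖)
        linarith)
      have h8 := (abs_le.1 h1.1).1
      nlinarith) z hz
  have l2 := slice_nonneg (W := fun q => (φ q - u q) - A * ρ q.1) (t := t) D.op D.bdd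
    ((hcφ.sub hcu).sub hcA)
    (fun y hy => ((S.rφ.sm y hy t ht').sub (S.ru.sm y hy t ht')).sub (hsA _))
    (fun y hy => by
      rw [S.bdry y hy t ⟨ht'.1.le, ht'.2⟩, D.zero y hy]; simp)
    (fun y hy hX => by
      obtain ⟨v, μ, k, F, H⟩ := S.frm hy ht'
      have h3 := hX (v 0)
      rw [Qf_sub ((S.rφ.sm y hy t ht').sub (S.ru.sm y hy t ht')) (hsA _),
          Qf_sub (S.rφ.sm y hy t ht') (S.ru.sm y hy t ht'), D.Qf_rho] at h3
      have h4 := D.psh y (subset_closure hy) (v 0)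
      have h5 := (abs_le.1 (S.bφ0.Qf_le hy ht' (v 0))).2
      have h6 := mul_le_mul_of_nonneg_left h4 hA1.le
      have h7 := mul_le_mul_of_nonneg_right hAc (sq_nonneg ‖v 0‖)
      have h8 := H.q_nonneg (v 0)
      have h9 := Real.exp_pos (C + 1)
      rw [DFr.nv v 0] at *
      linarith) z hz
  rw [abs_le]
  constructor <;> linarith

/-- Difference of gradients `(u - φ)_S`. -/
def gd (Ω : Set (Cn n)) (u φ : Cn n × ℝ → ℝ) (S : Cn n) (q : Cn n × ℝ) : ℝ :=
  D1 Ω u q S - D1 Ω φ q S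

theorem bgrad [NeZero n] (D : Dom Ω ρ c K) (T M t0 : ℝ) (ht0 : 0 < t0) : ∃ A : ℝ, 1 ≤ A ∧
    ∀ u φ : Cn n × ℝ → ℝ, Sol Ω T M u φ →
    ∀ p ∈ frontier Ω, ∀ t ∈ Ico t0 T, ∀ X, |gd Ω u φ X (p, t)| ≤ A * |dd X ρ p| := by
  obtain ⟨A, hA, hAs⟩ := barrier_bound D T M t0 ht0
  refine ⟨A, hA, ?_⟩
  intro u φ S p hp t ht
  have ht' : t ∈ Ioo (0 : ℝ) T := ⟨lt_of_lt_of_le ht0 ht.1, ht.2⟩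
  have hpc := frontier_subset_closure hp
  have hd := (S.ru.h1 p hpc t ht').sub (S.rφ.h1 p hpc t ht')
  have hb0 : ∀ z ∈ frontier Ω, u (z, t) - φ (z, t) = 0 := fun z hz => by
    rw [S.bdry z hz t ⟨ht'.1.le, ht'.2⟩, sub_self]
  have hneg : ∀ X, dd X ρ p < 0 → |gd Ω u φ X (p, t)| ≤ A * |dd X ρ p| := by
    intro X hX
    obtain ⟨δ, hδ, hin⟩ := D.inward hp hX
    have hlim : Tendsto (fun r : ℝ => p + r • X) (𝓝[>] 0) (𝓝[closure Ω] p) := by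
      refine tendsto_nhdsWithin_iff.2 ⟨?_, ?_⟩
      · have : Continuous fun r : ℝ => p + r • X := by fun_prop
        have h := this.tendsto 0
        simp only [zero_smul, add_zero] at h
        exact h.mono_left nhdsWithin_le_nhds
      · filter_upwards [Ioo_mem_nhdsGT hδ] with r hr
        exact subset_closure (hin p hpc (by simpa using hδ) r hr)
    have hline : ∀ (h : Cn n → ℝ) (h' : Cn n →L[ℝ] ℝ), HasFDerivWithinAt h h' (closure Ω) p →
        HasDerivWithinAt (fun r : ℝ => h (p + r • X)) (h' X) (Ioo (0 : ℝ) δ) 0 := by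
      intro h h' hh
      have h0 : HasDerivWithinAt (fun r : ℝ => p + r • X) X (Ioo (0 : ℝ) δ) 0 := by
        have : HasDerivAt (fun r : ℝ => p + r • X) ((1 : ℝ) • X) 0 :=
          ((hasDerivAt_id (0 : ℝ)).smul_const X).const_add p
        simpa using this.hasDerivWithinAt
      have hh' : HasFDerivWithinAt h h' (closure Ω) (p + (0 : ℝ) • X) := by simpa using hh
      exact hh'.comp_hasDerivWithinAt (0 : ℝ) h0
        (fun r hr => subset_closure (hin p hpc (by simpa using hδ) r hr))
    have hρ : HasFDerivWithinAt ρ (fderiv ℝ ρ p) (closure Ω) p :=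
      ((D.Sm p).diff.hasFDerivAt).hasFDerivWithinAt
    have hw : ∀ (h : Cn n → ℝ) (h' : Cn n →L[ℝ] ℝ), HasFDerivWithinAt h h' (closure Ω) p →
        h p = 0 → (∀ z ∈ closure Ω, 0 ≤ h z) → 0 ≤ h' X := by
      intro h h' hh h0 hz
      have h1 := hline h h' hh
      rw [hasDerivWithinAt_iff_tendsto_slope] at h1
      have hne : (𝓝[Ioo (0 : ℝ) δ \ {0}] (0 : ℝ)).NeBot := by
        have : Ioo (0 : ℝ) δ \ {0} = Ioo 0 δ := by
          ext x; simp
        rw [this]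
        exact left_nhdsWithin_Ioo_neBot hδ
      refine ge_of_tendsto h1 ?_
      filter_upwards [self_mem_nhdsWithin] with r hr
      have hr' := hr.1
      rw [slope_def_field]
      simp only [zero_smul, add_zero, h0, sub_zero]
      exact div_nonneg (hz _ (subset_closure (hin p hpc (by simpa using hδ) r hr'))) hr'.1.le
    have hbb : ∀ z ∈ closure Ω, _ := fun z hz => abs_le.1 (hAs u φ S z hz t ht)
    have w1 := hw _ _ ((hρ.const_mul A).neg.sub hd) (by
      simp [D.zero p hp, S.bdry p hp t ⟨ht'.1.le, ht'.2⟩]) (fun z hz => by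
        have := (hbb z hz).2
        simp only [Pi.neg_apply, Pi.sub_apply]
        linarith)
    have w2 := hw _ _ ((hρ.const_mul A).neg.add hd) (by
      simp [D.zero p hp, S.bdry p hp t ⟨ht'.1.le, ht'.2⟩]) (fun z hz => by
        have := (hbb z hz).1
        simp only [Pi.neg_apply, Pi.add_apply, Pi.sub_apply]
        linarith)
    have e1 : fderiv ℝ ρ p X = dd X ρ p := rfl
    simp [e1] at w1 w2
    unfold gd
    rw [abs_of_neg hX, abs_le]
    constructor <;> linarith
  intro X
  rcases lt_trichotomy (dd X ρ p) 0 with h | h | h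
  · exact hneg X h
  · have := D.tang hp h hd hb0
    have h2 : gd Ω u φ X (p, t) = 0 := by simpa [gd] using this
    rw [h2, h]; simp
  · have h3 : dd (-X) ρ p = - dd X ρ p := dd_vneg ..
    have := hneg (-X) (by rw [h3]; linarith)
    rw [h3, abs_neg] at this
    have h4 : gd Ω u φ (-X) (p, t) = - gd Ω u φ X (p, t) := by
      unfold gd; simp only [map_neg]; ring
    rwa [h4, abs_neg] at this

end bgrad

section igrad
variable {Ω : Set (Cn n)} {ρ : Cn n → ℝ} {c K : ℝ}

theorem Sol.D1_ev {T M : ℝ} {u φ : Cn n × ℝ → ℝ} (hΩ : IsOpen Ω)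
    (S : Sol Ω T M u φ) {z : Cn n} (hz : z ∈ Ω) {t : ℝ} (ht : t ∈ Ioo (0 : ℝ) T) (X : Cn n) :
    (fun q => D1 Ω u q X) =ᶠ[𝓝 (z, t)] dd (X, (0 : ℝ)) u := by
  filter_upwards [(hΩ.prod isOpen_Ioo).mem_nhds (show (z, t) ∈ Ω ×ˢ Ioo (0 : ℝ) T from ⟨hz, ht⟩)]
    with q hq
  exact S.ru.e1 q.1 hq.1 q.2 hq.2 X

theorem Sm_tpow (t0 : ℝ) (m : ℕ) (p : Cn n × ℝ) :
    Sm (fun q : Cn n × ℝ => (q.2 - t0) ^ m) p :=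
  ((contDiff_snd.sub contDiff_const).pow m).contDiffAt

theorem dd_tpow (t0 : ℝ) (m : ℕ) (X p : Cn n × ℝ) :
    dd X (fun q : Cn n × ℝ => (q.2 - t0) ^ m) p = m * (p.2 - t0) ^ (m - 1) * X.2 := by
  have h1 : HasFDerivAt (fun q : Cn n × ℝ => q.2 - t0) (ContinuousLinearMap.snd ℝ (Cn n) ℝ) p :=
    (ContinuousLinearMap.snd ℝ (Cn n) ℝ).hasFDerivAt.sub_const t0
  have h2 := h1.pow m
  simp [dd, h2.fderiv]

theorem Lop_tpow (v : Fin n → Cn n) (μ : Fin n → ℝ) (t0 : ℝ) (m : ℕ) {b : Cn n × ℝ → ℝ}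
    {p : Cn n × ℝ} (hb : Sm b p) :
    Lop v μ (fun q => (q.2 - t0) ^ m * b q) p =
      (p.2 - t0) ^ m * Lop v μ b p + m * (p.2 - t0) ^ (m - 1) * b p := by
  rw [Lop_mul v μ (Sm_tpow t0 m p) hb]
  have h1 : ∀ e : Cn n, dd (e, (0 : ℝ)) (fun q : Cn n × ℝ => (q.2 - t0) ^ m) = fun _ => 0 := by
    intro e
    funext q
    rw [dd_tpow]
    simp
  have h2 : Gam v μ (fun q : Cn n × ℝ => (q.2 - t0) ^ m) b p = 0 := by
    unfold Gam frS
    simp [h1]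
  have h3 : Lop v μ (fun q : Cn n × ℝ => (q.2 - t0) ^ m) p = m * (p.2 - t0) ^ (m - 1) := by
    unfold Lop frS
    simp [h1, dd_tpow, dd_const]
  rw [h2, h3]
  ring

/-- Lower bound for the gradient term. -/
theorem DFr.gam_lower [NeZero n] {M : ℝ} {u : Cn n × ℝ → ℝ} {p : Cn n × ℝ}
    {v : OrthonormalBasis (Fin n) ℂ (Cn n)} {μ : Fin n → ℝ} {k F : ℝ} (H : DFr M u p v μ k F)
    {X : Cn n} (hX : ‖X‖ = 1) {y s : ℝ} (hy : 0 < y) (hs : 0 < s)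
    (hyu : y ≤ dd (X, (0 : ℝ)) u p) :
    n + n * Real.log s + (2 * Real.log y - Real.log n) + ∑ a, Real.log (4 * μ a) ≤
      4 * s * (Gam v μ u u p + ∑ a, μ a) := by
  have hn : (1 : ℝ) ≤ n := by exact_mod_cast NeZero.one_le
  set d : Cn n → ℝ := fun e => dd (e, (0 : ℝ)) u p with hd
  have hadd : ∀ Y Z, d (Y + Z) = d Y + d Z := fun Y Z => by simp [hd, dd, ← map_add]
  have hsmul : ∀ (r : ℝ) Y, d (r • Y) = r * d Y := fun r Y => by
    have : ((r • Y, (0 : ℝ)) : Cn n × ℝ) = r • (Y, (0 : ℝ)) := by simp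
    simp only [hd, dd, this, map_smul, smul_eq_mul]
  have hsum : ∀ (s : Finset (Fin n)) (Y : Fin n → Cn n),
      d (∑ a ∈ s, Y a) = ∑ a ∈ s, d (Y a) := by
    intro s Y
    induction s using Finset.induction_on with
    | empty =>
      have := hsmul 0 0
      simpa using this
    | insert a s ha ih => rw [Finset.sum_insert ha, Finset.sum_insert ha, hadd, ih]
  set G : Fin n → ℝ := fun a => d (v a) ^ 2 + d (Complex.I • v a) ^ 2 with hG
  have hG0 : ∀ a, 0 ≤ G a := fun a => by positivity
  have hexp : d X = ∑ a, ((inner ℂ (v a) X : ℂ).re * d (v a) +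
      (inner ℂ (v a) X : ℂ).im * d (Complex.I • v a)) := by
    conv_lhs => rw [← v.sum_repr' X]
    rw [hsum]
    refine Finset.sum_congr rfl fun a _ => ?_
    rw [csmul_decomp, hadd, hsmul, hsmul]
  have hcs : ∃ a, y ^ 2 / n ≤ G a := by
    by_contra hcon
    push Not at hcon
    have h1 : d X ≤ ∑ a, (‖(inner ℂ (v a) X : ℂ)‖ ^ 2 * y + G a / y) / 2 := by
      rw [hexp]
      refine Finset.sum_le_sum fun a _ => ?_
      rw [Complex.sq_norm, Complex.normSq_apply]
      have e1 := sq_nonneg ((inner ℂ (v a) X : ℂ).re * y - d (v a))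
      have e2 := sq_nonneg ((inner ℂ (v a) X : ℂ).im * y - d (Complex.I • v a))
      rw [le_div_iff₀ (by norm_num), ← mul_le_mul_iff_left₀ hy]
      simp only [hG, add_mul, div_mul_cancel₀ _ hy.ne']
      nlinarith
    have h2 : ∑ a, (‖(inner ℂ (v a) X : ℂ)‖ ^ 2 * y + G a / y) / 2 =
        (y + (∑ a, G a) / y) / 2 := by
      rw [← Finset.sum_div, Finset.sum_add_distrib, ← Finset.sum_mul, norm_sq_frame, hX,
        ← Finset.sum_div]
      ring
    have h3 : ∑ a, G a < y ^ 2 := by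
      calc ∑ a, G a < ∑ a : Fin n, y ^ 2 / n :=
            Finset.sum_lt_sum_of_nonempty Finset.univ_nonempty fun a _ => hcon a
        _ = y ^ 2 := by
            rw [Finset.sum_const, Finset.card_univ, Fintype.card_fin, nsmul_eq_mul]
            field_simp
    have h4 : (∑ a, G a) / y < y := by
      rw [div_lt_iff₀ hy]; nlinarith
    have h5 : y ≤ d X := hyu
    linarith
  obtain ⟨a, ha⟩ := hcs
  have hGa : 0 < G a := lt_of_lt_of_le (by positivity) ha
  have hl := log_sum_le Finset.univ (fun b => s * (4 * μ b) * (if b = a then G a else 1))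
    (fun b _ => by
      have := H.pos b
      split_ifs <;> positivity)
  have e1 : ∀ b, Real.log (s * (4 * μ b) * (if b = a then G a else 1)) =
      Real.log s + Real.log (4 * μ b) + (if b = a then Real.log (G a) else 0) := by
    intro b
    have := H.pos b
    rw [Real.log_mul (by positivity) (by split_ifs <;> positivity),
      Real.log_mul (by positivity) (by positivity)]
    split_ifs <;> simp
  simp only [e1, Finset.sum_add_distrib, Finset.sum_ite_eq', Finset.mem_univ, if_true,
    Finset.sum_const, Finset.card_univ, Fintype.card_fin, nsmul_eq_mul] at hl
  have e2 : 2 * Real.log y - Real.log n ≤ Real.log (G a) := by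
    have := Real.log_le_log (by positivity) ha
    rw [Real.log_div (by positivity) (by positivity), Real.log_pow] at this
    push_cast at this
    linarith
  have e3 : ∑ b, s * (4 * μ b) * (if b = a then G a else 1) ≤
      4 * s * (Gam v μ u u p + ∑ a, μ a) := by
    have : Gam v μ u u p = ∑ b, μ b * G b := by
      unfold Gam frS
      refine Finset.sum_congr rfl fun b _ => ?_
      simp only [hG, hd]
      ring
    rw [this, ← Finset.sum_add_distrib, Finset.mul_sum]
    refine Finset.sum_le_sum fun b _ => ?_
    have h1 := H.pos b
    have h2 := hG0 b
    have h3 : (if b = a then G a else 1) ≤ G b + 1 := by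
      split_ifs with h
      · rw [h]; linarith
      · linarith
    have h4 : 0 ≤ s * (4 * μ b) := by positivity
    calc _ ≤ s * (4 * μ b) * (G b + 1) := mul_le_mul_of_nonneg_left h3 h4
      _ = _ := by ring
  linarith

theorem Gam_self_nonneg {v : Fin n → Cn n} {μ : Fin n → ℝ} (hμ : ∀ a, 0 ≤ μ a)
    (a : Cn n × ℝ → ℝ) (p : Cn n × ℝ) : 0 ≤ Gam v μ a a p :=
  frS_nonneg hμ fun _ => mul_self_nonneg _

set_option maxHeartbeats 1600000 in
theorem grad_core [NeZero n] (D : Dom Ω ρ c K) (T M t0 : ℝ) (hT : 0 < T) (hM : 1 ≤ M)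
    (ht0 : 0 < t0) : ∃ M0 : ℝ, 0 < M0 ∧
    ∀ u φ : Cn n × ℝ → ℝ, Sol Ω T M u φ → ∀ X, ‖X‖ = 1 →
    ∀ z ∈ closure Ω, ∀ t ∈ Ico t0 T, (t - t0) ^ n * D1 Ω u (z, t) X ≤ M0 := by
  obtain ⟨C0, hC0, hu0⟩ := u_bound D T M
  obtain ⟨C, hC, hCs⟩ := logdet_bound D T M t0 ht0
  obtain ⟨A, hA, hAs⟩ := bgrad D T M t0 ht0
  have hn : (1 : ℝ) ≤ n := by exact_mod_cast NeZero.one_le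
  have hn0 : n ≠ 0 := NeZero.ne n
  have hc := D.cpos
  have hK := D.Kpos
  set δ := 1 / (4 * (C0 ^ 2 + K)) with hδ
  have hδ0 : 0 < δ := by positivity
  have hδ1 : δ * (C0 ^ 2 + K) = 1 / 4 := by
    rw [hδ]; field_simp
  set c' := min 2 c with hc'
  have hc'0 : 0 < c' := lt_min (by norm_num) hc
  set B := n * T + T ^ 2 + 2 * δ * C0 * (C + n) * T ^ 2 + 1 with hB
  have hB0 : 0 < B := by positivity
  set R := 4 * B / (δ * c') with hR
  have hR0 : 0 < R := by positivity
  have hRe : δ * c' * R = 4 * B := by rw [hR]; field_simp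
  set E := (n * Real.log R + Real.log n + C) / 2 with hE
  set M0 := 4 * Real.exp E + 4 * T ^ n * (A * K + M) with hM0
  have hM00 : 0 < M0 := by positivity
  refine ⟨M0, hM00, ?_⟩
  intro u φ S X hX z1 hz1 t1 ht1
  by_contra hcon
  push Not at hcon
  have hpos : ∀ t ∈ Icc t0 t1, t ∈ Ioo (0 : ℝ) T := fun t ht =>
    ⟨lt_of_lt_of_le ht0 ht.1, lt_of_le_of_lt ht.2 ht1.2⟩
  have hI : ∀ t ∈ Icc t0 t1, t ∈ Ico t0 T := fun t ht => ⟨ht.1, lt_of_le_of_lt ht.2 ht1.2⟩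
  have hsub : closure Ω ×ˢ Icc t0 t1 ⊆ closure Ω ×ˢ Ioo (0 : ℝ) T :=
    prod_mono subset_rfl hpos
  have hh : ContinuousOn (fun q : Cn n × ℝ => D1 Ω u q X) (closure Ω ×ˢ Icc t0 t1) :=
    (S.ru.c1.mono hsub).clm_apply continuousOn_const
  have hhσ : ContinuousOn (fun q : Cn n × ℝ => (q.2 - t0) ^ n * D1 Ω u q X)
      (closure Ω ×ˢ Icc t0 t1) := ContinuousOn.mul (by fun_prop) hh
  obtain ⟨q, hq, hmax⟩ := (D.bdd.isCompact_closure.prod isCompact_Icc).exists_isMaxOn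
    ⟨(z1, t1), hz1, ht1.1, le_rfl⟩ hhσ
  set P := (q.2 - t0) ^ n * D1 Ω u q X with hP
  have hmax' : ∀ y ∈ closure Ω, ∀ t ∈ Icc t0 t1, (t - t0) ^ n * D1 Ω u (y, t) X ≤ P :=
    fun y hy t ht => hmax (show (y, t) ∈ _ from ⟨hy, ht⟩)
  have hPM : M0 < P := lt_of_lt_of_le hcon (hmax' z1 hz1 t1 ⟨ht1.1, le_rfl⟩)
  have hP0 : 0 < P := hM00.trans hPM
  have hcu : ContinuousOn u (closure Ω ×ˢ Icc t0 t1) :=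
    S.ru.c0.mono (prod_mono subset_rfl fun t ht => ⟨(hpos t ht).1.le, (hpos t ht).2⟩)
  have hub : ∀ y ∈ closure Ω, ∀ t ∈ Icc t0 t1, u (y, t) * u (y, t) ≤ C0 ^ 2 := by
    intro y hy t ht
    have := hu0 u φ S y hy t ⟨(hpos t ht).1.le, (hpos t ht).2⟩
    rw [← abs_mul_abs_self]
    nlinarith [abs_nonneg (u (y, t))]
  have hδP : 0 < δ * P := by positivity
  have hδC : δ * P * C0 ^ 2 + δ * P * K = P / 4 := by
    calc _ = P * (δ * (C0 ^ 2 + K)) := by ring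
      _ = _ := by rw [hδ1]; ring
  have hδK : 0 ≤ δ * P * K := by positivity
  have hδC0 : 0 ≤ δ * P * C0 ^ 2 := by positivity
  have key := min_principle D.op D.bdd (t0 := t0) (t1 := t1)
    (W := fun q => P / 2 - (q.2 - t0) ^ n * D1 Ω u q X -
      ((δ * P) * (u q * u q) + (δ * P) * ρ q.1))
    ((continuousOn_const.sub hhσ).sub ((continuousOn_const.mul (hcu.mul hcu)).add
      (continuous_const.mul (D.sm.continuous.comp continuous_fst)).continuousOn))
    (fun y hy s hs => by
      have ht := hpos s ⟨hs.1.le, hs.2⟩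
      have s1 := S.ru.sm y hy s ht
      exact ((Sm.const _ _).sub ((Sm_tpow _ _ _).mul ((s1.dd _).congr (S.D1_ev D.op hy ht X)))).sub
        (((Sm.const _ _).mul (s1.mul s1)).add ((Sm.const _ _).mul (Sm_fst D.sm _))))
    (fun y hy => by
      have h1 := D.le0 hy
      have h2 := mul_le_mul_of_nonneg_left (hub y hy t0 ⟨le_rfl, ht1.1⟩) hδP.le
      have h3 := mul_nonneg hδP.le (neg_nonneg.2 h1)
      simp only [sub_self, zero_pow hn0, zero_mul]
      linarith)
    (fun y hy s hs => by
      have h2 := mul_le_mul_of_nonneg_left (hub y (frontier_subset_closure hy) s hs) hδP.le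
      have h3 := hAs u φ S y hy s (hI s hs) X
      have h4 := D.b1 y X
      have h5 := S.bφ1 X
      have h6 := h5.b0c y (frontier_subset_closure hy) s (hpos s hs)
      rw [hX, mul_one] at h4 h6
      have h7 : D1 Ω u (y, s) X ≤ A * K + M := by
        have := (abs_le.1 h3).2
        have := (abs_le.1 h6).2
        have : A * |dd X ρ y| ≤ A * K := mul_le_mul_of_nonneg_left h4 (by linarith)
        unfold gd at *
        linarith
      have h8 : (s - t0) ^ n ≤ T ^ n :=
        pow_le_pow_left₀ (by linarith [hs.1]) (by linarith [(hpos s hs).2]) n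
      have h9 : (s - t0) ^ n * D1 Ω u (y, s) X ≤ T ^ n * (A * K + M) := by
        have h10 : 0 ≤ (s - t0) ^ n := pow_nonneg (by linarith [hs.1]) n
        have h11 : 0 ≤ A * K + M := by positivity
        calc _ ≤ (s - t0) ^ n * (A * K + M) := mul_le_mul_of_nonneg_left h7 h10
          _ ≤ _ := mul_le_mul_of_nonneg_right h8 h11
      have h12 := Real.exp_pos E
      simp only [D.zero y hy, mul_zero]
      linarith)
    (fun y hy s hs hneg => by
      have hs' : s ∈ Icc t0 t1 := ⟨hs.1.le, hs.2⟩
      have ht := hpos s hs'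
      obtain ⟨v, μ, k, F, H⟩ := S.frm hy ht
      refine ⟨v, μ, fun a => (H.pos a).le, ?_⟩
      obtain ⟨l1, l2, l3⟩ := (hCs u φ S).2 y hy s (hI s hs') v μ k F H
      have hev := S.D1_ev D.op hy ht X
      have s0 : Sm (fun q => D1 Ω u q X) (y, s) := (H.sm.dd _).congr hev
      have s2 := (H.sm.mul H.sm)
      have s3 := (Sm.const (δ * P) (y, s)).mul s2
      have s4 : Sm (fun q : Cn n × ℝ => δ * P * ρ q.1) (y, s) :=
        (Sm.const (δ * P) (y, s)).mul (Sm_fst D.sm _)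
      rw [Lop_sub _ _ ((Sm.const _ _).sub ((Sm_tpow _ _ _).mul s0)) (s3.add s4),
        Lop_sub _ _ (Sm.const _ _) ((Sm_tpow _ _ _).mul s0), Lop_const, Lop_tpow _ _ _ _ s0,
        Lop_add _ _ s3 s4, Lop_cmul _ _ _ s2, Lop_cmul _ _ _ (Sm_fst D.sm _),
        Lop_mul _ _ H.sm H.sm, H.Lop_u, Lop_congr _ _ hev]
      have he := S.ru.e1 y hy s ht X
      have hmx := hmax' y (subset_closure hy) s hs'
      simp only [he] at hneg hmx ⊢
      have hLh := (abs_le.1 (H.L (X, (0 : ℝ)))).2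
      have hnX : ‖(X, (0 : ℝ))‖ = 1 := by simp [Prod.norm_def, hX]
      rw [hnX, mul_one] at hLh
      set h := dd (X, (0 : ℝ)) u (y, s) with hh_def
      set ut := dd ((0 : Cn n), (1 : ℝ)) u (y, s) with hut_def
      set Lh := Lop v μ (dd (X, (0 : ℝ)) u) (y, s)
      set Γ := Gam v μ u u (y, s)
      have hσ : 0 < s - t0 := by linarith [hs.1]
      have hσT : s - t0 ≤ T := by linarith [ht.2]
      have hρ := D.le0 (subset_closure hy)
      have hu2 := mul_le_mul_of_nonneg_left (hub y (subset_closure hy) s hs') hδP.le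
      have hρ2 := mul_nonneg hδP.le (neg_nonneg.2 hρ)
      have hh1 : P / 4 < (s - t0) ^ n * h := by linarith
      have hσn : 0 < (s - t0) ^ n := by positivity
      have hh0 : 0 < h := by
        by_contra hc0
        push Not at hc0
        have := mul_nonpos_of_nonneg_of_nonpos hσn.le hc0
        linarith
      have hyy : P / (4 * (s - t0) ^ n) ≤ h := by
        rw [div_le_iff₀ (by positivity)]; linarith
      have hgl := H.gam_lower hX (y := P / (4 * (s - t0) ^ n)) (s := (s - t0) ^ 2 / R)
        (by positivity) (by positivity) hyy
      have hlogP : E ≤ Real.log (P / 4) := by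
        rw [Real.le_log_iff_exp_le (by positivity)]
        have : 0 ≤ 4 * T ^ n * (A * K + M) := by positivity
        linarith
      have eA : Real.log (P / (4 * (s - t0) ^ n)) = Real.log (P / 4) - n * Real.log (s - t0) := by
        rw [← div_div, Real.log_div (by positivity) hσn.ne', Real.log_pow]
      have eB : Real.log ((s - t0) ^ 2 / R) = 2 * Real.log (s - t0) - Real.log R := by
        rw [Real.log_div (by positivity) hR0.ne', Real.log_pow]
        norm_num
      rw [eA, eB] at hgl
      have hG : (n : ℝ) ≤ 4 * ((s - t0) ^ 2 / R) * (Γ + ∑ a, μ a) := by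
        refine le_trans ?_ hgl
        have := (abs_le.1 l1).1
        rw [hE] at hlogP
        linarith
      have hG2 : R ≤ 4 * (s - t0) ^ 2 * (Γ + ∑ a, μ a) := by
        have h1 : 1 ≤ 4 * ((s - t0) ^ 2 / R) * (Γ + ∑ a, μ a) := hn.trans hG
        have h2 : 4 * ((s - t0) ^ 2 / R) * (Γ + ∑ a, μ a) =
          (4 * (s - t0) ^ 2 * (Γ + ∑ a, μ a)) / R := by ring
        rw [h2, le_div_iff₀ hR0] at h1
        linarith
      have hLr := Lop_rho D (DFr.nv v) H.pos (subset_closure hy) s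
      have hΓ0 : 0 ≤ Γ := Gam_self_nonneg (fun a => (H.pos a).le) u _
      have hμ0 : 0 ≤ ∑ a, μ a := Finset.sum_nonneg fun a _ => (H.pos a).le
      have hgood : c' * (Γ + ∑ a, μ a) ≤ 2 * Γ + c * ∑ a, μ a := by
        have e1 : c' ≤ 2 := min_le_left _ _
        have e2 : c' ≤ c := min_le_right _ _
        nlinarith
      -- multiply by sigma squared
      have hLh2 : Lh ≤ M := by
        have := mul_nonneg (neg_nonneg.2 H.k0) hh0.le
        linarith
      have t1 : (s - t0) ^ 2 * ((s - t0) ^ n * Lh) ≤ T ^ 2 * P := by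
        have e1 : (s - t0) ^ n ≤ T ^ n := pow_le_pow_left₀ hσ.le hσT n
        have e2 : (s - t0) ^ 2 ≤ T ^ 2 := pow_le_pow_left₀ hσ.le hσT 2
        have e3 : (s - t0) ^ n * Lh ≤ T ^ n * M := by
          calc _ ≤ (s - t0) ^ n * M := mul_le_mul_of_nonneg_left hLh2 hσn.le
            _ ≤ _ := mul_le_mul_of_nonneg_right e1 (by linarith)
        have e4 : T ^ n * M ≤ P := by
          have : 0 ≤ T ^ n * (A * K) := by positivity
          have : 0 ≤ T ^ n * M := by positivity
          have := Real.exp_pos E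
          nlinarith
        calc _ ≤ (s - t0) ^ 2 * P := mul_le_mul_of_nonneg_left (e3.trans e4) (by positivity)
          _ ≤ _ := mul_le_mul_of_nonneg_right e2 hP0.le
      have t2 : (s - t0) ^ 2 * (n * (s - t0) ^ (n - 1) * h) ≤ n * T * P := by
        have e1 : (s - t0) ^ 2 * (n * (s - t0) ^ (n - 1) * h) =
            n * (s - t0) * ((s - t0) ^ n * h) := by
          have : (s - t0) ^ n = (s - t0) ^ (n - 1) * (s - t0) := by
            rw [← pow_succ, Nat.sub_add_cancel (Nat.one_le_iff_ne_zero.2 hn0)]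
          rw [this]; ring
        rw [e1]
        calc _ ≤ n * (s - t0) * P := mul_le_mul_of_nonneg_left hmx (by positivity)
          _ ≤ _ := mul_le_mul_of_nonneg_right (mul_le_mul_of_nonneg_left hσT (by positivity)) hP0.le
      have t3 : (s - t0) ^ 2 * (δ * P * (2 * (u (y, s) * (ut - n)))) ≤
          2 * δ * C0 * (C + n) * T ^ 2 * P := by
        have e2 : (s - t0) ^ 2 ≤ T ^ 2 := pow_le_pow_left₀ hσ.le hσT 2
        have e3 : u (y, s) * (ut - n) ≤ C0 * (C + n) := by
          refine (le_abs_self _).trans ?_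
          rw [abs_mul]
          refine mul_le_mul (hu0 u φ S y (subset_closure hy) s ⟨ht.1.le, ht.2⟩) ?_ (abs_nonneg _)
            (by linarith)
          rw [abs_le]
          have := abs_le.1 l3
          constructor <;> linarith
        calc _ ≤ (s - t0) ^ 2 * (δ * P * (2 * (C0 * (C + n)))) := by gcongr
          _ ≤ T ^ 2 * (δ * P * (2 * (C0 * (C + n)))) := by gcongr
          _ = _ := by ring
      have t4 : B * P ≤ (s - t0) ^ 2 * (δ * P * (c' * (Γ + ∑ a, μ a))) := by
        have e1 : δ * c' * R * P ≤ δ * c' * (4 * (s - t0) ^ 2 * (Γ + ∑ a, μ a)) * P := by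
          gcongr
        rw [hRe] at e1
        linarith
      have t5 : (s - t0) ^ 2 * (δ * P * (c' * (Γ + ∑ a, μ a))) ≤
          (s - t0) ^ 2 * (δ * P * (2 * Γ + c * ∑ a, μ a)) := by gcongr
      have t6 : (s - t0) ^ 2 * (δ * P * Lop v μ (fun q => ρ q.1) (y, s)) ≤
          (s - t0) ^ 2 * (δ * P * (- (c * ∑ a, μ a))) := by gcongr
      have hfin : 0 < (s - t0) ^ 2 * (0 - ((s - t0) ^ n * Lh + n * (s - t0) ^ (n - 1) * h) -
          (δ * P * (u (y, s) * (ut - n) + u (y, s) * (ut - n) - 2 * Γ) +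
            δ * P * Lop v μ (fun q => ρ q.1) (y, s))) := by
        have e0 : B * P = n * T * P + T ^ 2 * P + 2 * δ * C0 * (C + n) * T ^ 2 * P + P := by
          rw [hB]; ring
        linarith
      exact pos_of_mul_pos_right hfin (by positivity))
    q.1 hq.1 q.2 hq.2
  have h1 := (abs_le.1 (D.b0 q.1)).1
  have h2 := mul_le_mul_of_nonneg_left h1 hδP.le
  have h3 := mul_nonneg hδP.le (mul_self_nonneg (u q))
  have h4 : P / 2 - P - ((δ * P) * (u q * u q) + (δ * P) * ρ q.1) ≥ 0 := key
  linarith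

/-- Interior gradient bound. -/
theorem grad_bound [NeZero n] (D : Dom Ω ρ c K) (T M ε : ℝ) (hT : 0 < T) (hM : 1 ≤ M)
    (hε : 0 < ε) : ∃ C : ℝ, 1 ≤ C ∧
    ∀ u φ : Cn n × ℝ → ℝ, Sol Ω T M u φ →
    ∀ z ∈ closure Ω, ∀ t ∈ Ico ε T, ∀ X, |D1 Ω u (z, t) X| ≤ C * ‖X‖ := by
  obtain ⟨M0, hM0, h⟩ := grad_core D T M (ε / 2) hT hM (by linarith)
  refine ⟨M0 / (ε / 2) ^ n + 1, by have : 0 ≤ M0 / (ε / 2) ^ n := by positivity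
                                   linarith, ?_⟩
  intro u φ S z hz t ht
  have h1 : ∀ X, ‖X‖ = 1 → D1 Ω u (z, t) X ≤ M0 / (ε / 2) ^ n := by
    intro X hX
    have h2 := h u φ S X hX z hz t ⟨by linarith [ht.1], ht.2⟩
    rw [le_div_iff₀ (by positivity)]
    by_cases h3 : 0 ≤ D1 Ω u (z, t) X
    · have h4 : (ε / 2) ^ n ≤ (t - ε / 2) ^ n :=
        pow_le_pow_left₀ (by positivity) (by linarith [ht.1]) n
      nlinarith
    · push Not at h3
      have : 0 < (ε / 2) ^ n := by positivity
      nlinarith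
  intro X
  by_cases hX : X = 0
  · simp [hX]
  have hX0 : 0 < ‖X‖ := norm_pos_iff.2 hX
  set Y := ‖X‖⁻¹ • X with hY
  have hY1 : ‖Y‖ = 1 := by rw [hY, norm_smul, norm_inv, norm_norm, inv_mul_cancel₀ hX0.ne']
  have e1 : D1 Ω u (z, t) X = ‖X‖ * D1 Ω u (z, t) Y := by
    rw [hY, map_smul, smul_eq_mul, ← mul_assoc, mul_inv_cancel₀ hX0.ne', one_mul]
  have h2 := h1 Y hY1
  have h3 := h1 (-Y) (by rw [norm_neg, hY1])
  rw [map_neg] at h3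
  rw [e1, abs_mul, abs_of_pos hX0, mul_comm]
  refine mul_le_mul_of_nonneg_right ?_ hX0.le
  rw [abs_le]
  constructor <;> linarith

end igrad

section barrier
variable {Ω : Set (Cn n)} {ρ : Cn n → ℝ} {c K : ℝ}

theorem two_mul_abs_le {x y X Y : ℝ} (hx : |x| ≤ X) (hy : |y| ≤ Y) :
    |2 * (x * y)| ≤ X ^ 2 + Y ^ 2 := by
  have h1 := sq_nonneg (|x| - |y|)
  have h2 := abs_nonneg x
  have h3 := abs_nonneg y
  rw [abs_mul, abs_mul, abs_two]
  nlinarith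

theorem young_scalar {x1 x2 R J G1 G2 P1 P2 F1 F2 m k M : ℝ} (hm : 0 ≤ m) (h1 : |x1| ≤ k)
    (h2 : |x2| ≤ k) (hR : |R| ≤ 1) (hJ : |J| ≤ 1) (hP1 : |P1| ≤ M) (hP2 : |P2| ≤ M)
    (hF1 : |F1| ≤ M) (hF2 : |F2| ≤ M) :
    |2 * (x1 * R + x2 * J) + m * (2 * (-(x1 * G2) - x1 * P2 + x2 * G1 + x2 * P1 - x1 * F1
      - x2 * F2))| ≤ 4 * k + m * (G1 * G1 + G2 * G2) + m * (6 * k ^ 2 + 4 * M ^ 2) := by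
  have a1 := abs_le.1 (Bd.abs_mul_le h1 hR)
  have a2 := abs_le.1 (Bd.abs_mul_le h2 hJ)
  have b1 := abs_le.1 (two_mul_abs_le h1 (le_refl |G2|))
  have b2 := abs_le.1 (two_mul_abs_le h1 hP2)
  have b3 := abs_le.1 (two_mul_abs_le h2 (le_refl |G1|))
  have b4 := abs_le.1 (two_mul_abs_le h2 hP1)
  have b5 := abs_le.1 (two_mul_abs_le h1 hF1)
  have b6 := abs_le.1 (two_mul_abs_le h2 hF2)
  rw [sq_abs] at b1 b3
  have e : |2 * (-(x1 * G2) - x1 * P2 + x2 * G1 + x2 * P1 - x1 * F1 - x2 * F2)| ≤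
      (G1 * G1 + G2 * G2) + (6 * k ^ 2 + 4 * M ^ 2) := by
    rw [abs_le]; constructor <;> linarith
  have e' := abs_le.1 e
  have f1 := mul_le_mul_of_nonneg_left e'.1 hm
  have f2 := mul_le_mul_of_nonneg_left e'.2 hm
  rw [abs_le]; constructor <;> linarith

/-- The function `φ_X` as used in the barrier. -/
theorem gd_ev {T M : ℝ} {u φ : Cn n × ℝ → ℝ} (hΩ : IsOpen Ω)
    (S : Sol Ω T M u φ) {z : Cn n} (hz : z ∈ Ω) {t : ℝ} (ht : t ∈ Ioo (0 : ℝ) T) (X : Cn n) :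
    gd Ω u φ X =ᶠ[𝓝 (z, t)] fun q => dd (X, (0 : ℝ)) u q - D1 Ω φ q X := by
  filter_upwards [S.D1_ev hΩ hz ht X] with q hq
  unfold gd
  rw [hq]

theorem gd_Sm {T M : ℝ} {u φ : Cn n × ℝ → ℝ} (hΩ : IsOpen Ω)
    (S : Sol Ω T M u φ) {z : Cn n} (hz : z ∈ Ω) {t : ℝ} (ht : t ∈ Ioo (0 : ℝ) T) (X : Cn n) :
    Sm (gd Ω u φ X) (z, t) :=
  (((S.ru.sm z hz t ht).dd _).sub ((S.bφ1 X).sm z hz t ht)).congr (gd_ev hΩ S hz ht X)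

theorem gd_dd {T M : ℝ} {u φ : Cn n × ℝ → ℝ} (hΩ : IsOpen Ω)
    (S : Sol Ω T M u φ) {z : Cn n} (hz : z ∈ Ω) {t : ℝ} (ht : t ∈ Ioo (0 : ℝ) T) (X e : Cn n) :
    dd (e, (0 : ℝ)) (gd Ω u φ X) (z, t) = dd (e, (0 : ℝ)) (dd (X, (0 : ℝ)) u) (z, t) -
      dd (e, (0 : ℝ)) (fun q => D1 Ω φ q X) (z, t) := by
  rw [dd_congr (gd_ev hΩ S hz ht X),
    dd_sub ((S.ru.sm z hz t ht).dd _).diff ((S.bφ1 X).sm z hz t ht).diff]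

theorem gd_cont {T M : ℝ} {u φ : Cn n × ℝ → ℝ} (S : Sol Ω T M u φ) (X : Cn n) :
    ContinuousOn (gd Ω u φ X) (closure Ω ×ˢ Ioo (0 : ℝ) T) :=
  (S.ru.c1.clm_apply continuousOn_const).sub (S.rφ.c1.clm_apply continuousOn_const)

theorem gd_Lop {T M Cg : ℝ} {u φ : Cn n × ℝ → ℝ} (hΩ : IsOpen Ω)
    (S : Sol Ω T M u φ) {z : Cn n} (hz : z ∈ Ω) {t : ℝ} (ht : t ∈ Ioo (0 : ℝ) T) {X : Cn n}
    (hX : ‖X‖ ≤ 1) (hCg : |D1 Ω u (z, t) X| ≤ Cg)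
    {v : OrthonormalBasis (Fin n) ℂ (Cn n)} {μ : Fin n → ℝ} {k F : ℝ} (H : DFr M u (z, t) v μ k F) :
    |Lop v μ (gd Ω u φ X) (z, t)| ≤ (M * Cg + 2 * M) * (1 + 2 * ∑ i, μ i) := by
  have hM := S.M1
  rw [Lop_congr _ _ (gd_ev hΩ S hz ht X), Lop_sub _ _ (H.sm.dd _) ((S.bφ1 X).sm z hz t ht)]
  have h1 := (S.bφ1 X).Lop_le hz ht (DFr.nv v) H.pos
  have h2 := H.L (X, (0 : ℝ))
  have hnX : ‖(X, (0 : ℝ))‖ = ‖X‖ := by simp [Prod.norm_def]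
  rw [hnX] at h2
  rw [S.ru.e1 z hz t ht] at hCg
  have hk : |k| ≤ M := by
    rw [abs_le]
    exact ⟨H.k1, by linarith [H.k0]⟩
  have h3 := Bd.abs_mul_le hk hCg
  have hμ0 : 0 ≤ ∑ a, μ a := Finset.sum_nonneg fun a _ => (H.pos a).le
  have h4 : M * ‖X‖ ≤ M := by nlinarith
  have h5 : M * ‖X‖ * (1 + 2 * ∑ i, μ i) ≤ M * (1 + 2 * ∑ i, μ i) := by gcongr
  have h6 : (M * Cg + M) ≤ (M * Cg + M) * (1 + 2 * ∑ i, μ i) := by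
    have : 0 ≤ Cg := (abs_nonneg _).trans hCg
    have : 0 ≤ M * Cg + M := by positivity
    nlinarith
  have g1 := abs_le.1 h1
  have g2 := abs_le.1 h2
  have g3 := abs_le.1 h3
  rw [abs_le]
  constructor <;> linarith

theorem Gam_young {v : Fin n → Cn n} {μ : Fin n → ℝ} (hμ : ∀ a, 0 ≤ μ a)
    (a b : Cn n × ℝ → ℝ) (p : Cn n × ℝ) :
    |2 * Gam v μ a b p| ≤ Gam v μ a a p + Gam v μ b b p := by
  unfold Gam
  rw [← frS_add, ← frS_smul]
  have h1 : frS v μ (fun e => 2 * (dd (e, (0 : ℝ)) a p * dd (e, (0 : ℝ)) b p)) ≤ _ :=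
    frS_mono (v := v) hμ (H := fun e => dd (e, (0 : ℝ)) a p * dd (e, (0 : ℝ)) a p +
      dd (e, (0 : ℝ)) b p * dd (e, (0 : ℝ)) b p) (fun e => by
      nlinarith [sq_nonneg (dd (e, (0 : ℝ)) a p - dd (e, (0 : ℝ)) b p)])
  have h2 : frS v μ (fun e => (-1) * (dd (e, (0 : ℝ)) a p * dd (e, (0 : ℝ)) a p +
      dd (e, (0 : ℝ)) b p * dd (e, (0 : ℝ)) b p)) ≤ _ :=
    frS_mono (v := v) hμ (H := fun e => 2 * (dd (e, (0 : ℝ)) a p * dd (e, (0 : ℝ)) b p))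
      (fun e => by
      nlinarith [sq_nonneg (dd (e, (0 : ℝ)) a p + dd (e, (0 : ℝ)) b p)])
  rw [frS_smul] at h2
  rw [abs_le]
  constructor <;> linarith

theorem Bd.Gam_le {T k : ℝ} {a : Cn n × ℝ → ℝ} (h : Bd Ω T k a) {z : Cn n} (hz : z ∈ Ω) {t : ℝ}
    (ht : t ∈ Ioo (0 : ℝ) T) {v : OrthonormalBasis (Fin n) ℂ (Cn n)} {μ : Fin n → ℝ}
    (hμ : ∀ i, 0 < μ i) : Gam v μ a a (z, t) ≤ 2 * k ^ 2 * ∑ i, μ i := by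
  unfold Gam frS
  rw [Finset.mul_sum]
  refine Finset.sum_le_sum fun i _ => ?_
  have h1 := h.b1 z hz t ht (v i)
  have h2 := h.b1 z hz t ht (Complex.I • v i)
  rw [DFr.nv, mul_one] at h1
  rw [DFr.nIv, mul_one] at h2
  have e1 := sq_le_sq' (abs_le.1 h1).1 (abs_le.1 h1).2
  have e2 := sq_le_sq' (abs_le.1 h2).1 (abs_le.1 h2).2
  have := hμ i
  have e3 : μ i * (dd (v i, (0 : ℝ)) a (z, t) * dd (v i, (0 : ℝ)) a (z, t) +
      dd (Complex.I • v i, (0 : ℝ)) a (z, t) * dd (Complex.I • v i, (0 : ℝ)) a (z, t)) ≤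
      μ i * (2 * k ^ 2) := mul_le_mul_of_nonneg_left (by linarith) this.le
  linarith

/-- The crucial identity: the normal derivative enters through the rotated normal derivative. -/
theorem gdN_gam {T M k : ℝ} {u φ : Cn n × ℝ → ℝ} (hΩ : IsOpen Ω)
    (S : Sol Ω T M u φ) {z : Cn n} (hz : z ∈ Ω) {t : ℝ} (ht : t ∈ Ioo (0 : ℝ) T) {N : Cn n}
    (hN : ‖N‖ ≤ 1) {a : Cn n × ℝ → ℝ} (ha : Bd Ω T k a)
    {v : OrthonormalBasis (Fin n) ℂ (Cn n)} {μ : Fin n → ℝ} {k' F : ℝ}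
    (H : DFr M u (z, t) v μ k' F) :
    |2 * Gam v μ a (gd Ω u φ N) (z, t)| ≤ 4 * n * k +
      Gam v μ (gd Ω u φ (Complex.I • N)) (gd Ω u φ (Complex.I • N)) (z, t) +
      (6 * k ^ 2 + 4 * M ^ 2) * ∑ i, μ i := by
  have hM := S.M1
  have hIN : ‖Complex.I • N‖ ≤ 1 := by rw [norm_smul]; simpa using hN
  unfold Gam frS
  rw [Finset.mul_sum, Finset.mul_sum]
  have e0 : 4 * (n : ℝ) * k = ∑ i : Fin n, 4 * k := by
    rw [Finset.sum_const, Finset.card_univ, Fintype.card_fin, nsmul_eq_mul]; ring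
  rw [e0, ← Finset.sum_add_distrib, ← Finset.sum_add_distrib]
  refine (Finset.abs_sum_le_sum_abs _ _).trans (Finset.sum_le_sum fun i _ => ?_)
  have hμ := H.pos i
  have h1 := ha.b1 z hz t ht (v i)
  have h2 := ha.b1 z hz t ht (Complex.I • v i)
  rw [DFr.nv, mul_one] at h1
  rw [DFr.nIv, mul_one] at h2
  have hin : ‖(inner ℂ (v i) N : ℂ)‖ ≤ 1 := by
    refine (norm_inner_le_norm _ _).trans ?_
    rw [DFr.nv, one_mul]; exact hN
  have hR := (Complex.abs_re_le_norm (inner ℂ (v i) N : ℂ)).trans hin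
  have hJ := (Complex.abs_im_le_norm (inner ℂ (v i) N : ℂ)).trans hin
  have hφ : ∀ X : Cn n, ‖X‖ ≤ 1 → ∀ e : Cn n, ‖e‖ = 1 →
      |dd (e, (0 : ℝ)) (fun q => D1 Ω φ q X) (z, t)| ≤ M := by
    intro X hX e he
    have := (S.bφ1 X).b1 z hz t ht e
    rw [he, mul_one] at this
    refine this.trans ?_
    nlinarith
  have q1 := H.q1 N i
  have q2 := H.q2 N i
  unfold Qf at q1 q2
  rw [I_I_smul] at q2
  have en : ∀ X Y : Cn n, dd (X, (0 : ℝ)) (dd (-Y, (0 : ℝ)) u) (z, t) =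
      - dd (X, (0 : ℝ)) (dd (Y, (0 : ℝ)) u) (z, t) := by
    intro X Y
    rw [dd_comm H.sm, show ((-Y, (0 : ℝ)) : Cn n × ℝ) = - (Y, 0) by simp, dd_vneg,
      dd_comm H.sm]
  rw [en] at q2
  rw [dd_comm H.sm (N, (0 : ℝ)), dd_comm H.sm (Complex.I • N, (0 : ℝ)), eq_div_iff hμ.ne'] at q1 q2
  beta_reduce
  rw [gd_dd hΩ S hz ht N (v i), gd_dd hΩ S hz ht N (Complex.I • v i)]
  have g1 := gd_dd hΩ S hz ht (Complex.I • N) (v i)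
  have g2 := gd_dd hΩ S hz ht (Complex.I • N) (Complex.I • v i)
  have key := young_scalar (G1 := dd (v i, (0 : ℝ)) (gd Ω u φ (Complex.I • N)) (z, t))
    (G2 := dd (Complex.I • v i, (0 : ℝ)) (gd Ω u φ (Complex.I • N)) (z, t)) hμ.le h1 h2 hR hJ
    (hφ _ hIN (v i) (DFr.nv v i)) (hφ _ hIN (Complex.I • v i) (DFr.nIv v i))
    (hφ _ hN (v i) (DFr.nv v i)) (hφ _ hN (Complex.I • v i) (DFr.nIv v i))
  refine le_trans (le_of_eq ?_) (key.trans (le_of_eq (by ring)))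
  congr 1
  rw [g1, g2, ← q1, ← q2]
  ring

end barrier

section barrier2
variable {Ω : Set (Cn n)} {ρ : Cn n → ℝ} {c K : ℝ}

theorem bar_scalar {a1 a2 La1 La2 Lb gt gN gi Lt LN Li G1 G2 Ga Gtt Gii B c 𝒯 Lr k M C2 C3 c0 Q nn : ℝ}
    (hk : 0 ≤ k) (hC2 : 0 ≤ C2) (hC3 : 0 ≤ C3) (hn : 0 ≤ nn)
    (ha1 : |a1| ≤ k) (ha2 : |a2| ≤ k) (hLa1 : |La1| ≤ k * (1 + 2 * 𝒯))
    (hLa2 : |La2| ≤ k * (1 + 2 * 𝒯)) (hLb : |Lb| ≤ k * (1 + 2 * 𝒯))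
    (hgt : |gt| ≤ C3) (hgN : |gN| ≤ C3) (hgi : |gi| ≤ C3)
    (hLt : |Lt| ≤ C2 * (1 + 2 * 𝒯)) (hLN : |LN| ≤ C2 * (1 + 2 * 𝒯)) (hLi : |Li| ≤ C2 * (1 + 2 * 𝒯))
    (hG1 : |2 * G1| ≤ Ga + Gtt) (hGa : Ga ≤ 2 * k ^ 2 * 𝒯)
    (hG2 : |2 * G2| ≤ 4 * nn * k + Gii + (6 * k ^ 2 + 4 * M ^ 2) * 𝒯)
    (hGt : 0 ≤ Gtt) (hGi : 0 ≤ Gii) (hLr : Lr ≤ - (c * 𝒯)) (hB : 0 ≤ B) (hc0 : 0 < c0)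
    (h𝒯 : c0 ≤ 𝒯)
    (hQ : Q = 2 * k * C2 + 2 * C3 * k + k + 4 * C3 * C2 + 4 * k ^ 2 + 2 * M ^ 2 + 4 * nn * k)
    (hBQ : Q * (1 / c0 + 2) < B * c) :
    0 < a1 * Lt + gt * La1 - 2 * G1 + (a2 * LN + gN * La2 - 2 * G2) + Lb
      - (gt * Lt + gt * Lt - 2 * Gtt) - (gi * Li + gi * Li - 2 * Gii) - B * Lr := by
  have e1 := (abs_le.1 (Bd.abs_mul_le ha1 hLt)).1
  have e2 := (abs_le.1 (Bd.abs_mul_le hgt hLa1)).1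
  have e3 := (abs_le.1 hG1).2
  have e4 := (abs_le.1 (Bd.abs_mul_le ha2 hLN)).1
  have e5 := (abs_le.1 (Bd.abs_mul_le hgN hLa2)).1
  have e6 := (abs_le.1 hG2).2
  have e7 := (abs_le.1 hLb).1
  have e8 := (abs_le.1 (Bd.abs_mul_le hgt hLt)).2
  have e9 := (abs_le.1 (Bd.abs_mul_le hgi hLi)).2
  have e10 := mul_le_mul_of_nonneg_left hLr hB
  have hT : 0 < 𝒯 := lt_of_lt_of_le hc0 h𝒯
  have hQ0 : 0 ≤ Q := by rw [hQ]; positivity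
  have f1 : 1 ≤ (1 / c0) * 𝒯 := by
    rw [one_div, inv_mul_eq_div, le_div_iff₀ hc0]; linarith
  have f2 : Q * (1 + 2 * 𝒯) ≤ Q * ((1 / c0 + 2) * 𝒯) :=
    mul_le_mul_of_nonneg_left (by linarith) hQ0
  have f3 := mul_lt_mul_of_pos_right hBQ hT
  have f4 : Q * (1 + 2 * 𝒯) < B * (c * 𝒯) := by
    calc _ ≤ _ := f2
      _ = Q * (1 / c0 + 2) * 𝒯 := by ring
      _ < _ := f3
      _ = _ := by ring
  have f5 : 0 ≤ 4 * nn * k * 𝒯 := by positivity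
  have f6 : 0 ≤ k ^ 2 := by positivity
  have f7 : 0 ≤ M ^ 2 := by positivity
  have f8 : Q * (1 + 2 * 𝒯) = 2 * (k * (C2 * (1 + 2 * 𝒯))) + 2 * (C3 * (k * (1 + 2 * 𝒯))) +
      k * (1 + 2 * 𝒯) + 4 * (C3 * (C2 * (1 + 2 * 𝒯))) + 4 * k ^ 2 + 2 * M ^ 2 + 4 * nn * k +
      2 * (4 * nn * k * 𝒯) + 8 * k ^ 2 * 𝒯 + 4 * M ^ 2 * 𝒯 := by rw [hQ]; ring
  have f9 : (6 * k ^ 2 + 4 * M ^ 2) * 𝒯 = 6 * k ^ 2 * 𝒯 + 4 * M ^ 2 * 𝒯 := by ring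
  rw [f9] at e6
  rw [f8] at f4
  linarith

/-- The barrier quantity. -/
def Psi (Ω : Set (Cn n)) (u φ a1 a2 b : Cn n × ℝ → ℝ) (τ N : Cn n) (q : Cn n × ℝ) : ℝ :=
  a1 q * gd Ω u φ τ q + a2 q * gd Ω u φ N q + b q

theorem barrier_core [NeZero n] (D : Dom Ω ρ c K) (T M t0 Kb : ℝ) (hT : 0 < T) (hM : 1 ≤ M)
    (ht0 : 0 < t0) (hKb : 1 ≤ Kb) : ∃ B : ℝ, 1 ≤ B ∧
    ∀ u φ : Cn n × ℝ → ℝ, Sol Ω T M u φ → ∀ N τ : Cn n, ‖N‖ ≤ 1 → ‖τ‖ ≤ 1 →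
    ∀ a1 a2 b : Cn n × ℝ → ℝ, Bd Ω T Kb a1 → Bd Ω T Kb a2 → Bd Ω T Kb b → ∀ t1 < T,
    (∀ z ∈ closure Ω, 0 ≤ Psi Ω u φ a1 a2 b τ N (z, t0) - gd Ω u φ τ (z, t0) * gd Ω u φ τ (z, t0) -
      gd Ω u φ (Complex.I • N) (z, t0) * gd Ω u φ (Complex.I • N) (z, t0)) →
    (∀ z ∈ frontier Ω, ∀ t ∈ Icc t0 t1, 0 ≤ Psi Ω u φ a1 a2 b τ N (z, t) -
      gd Ω u φ τ (z, t) * gd Ω u φ τ (z, t) -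
      gd Ω u φ (Complex.I • N) (z, t) * gd Ω u φ (Complex.I • N) (z, t)) →
    ∀ z ∈ closure Ω, ∀ t ∈ Icc t0 t1, 0 ≤ Psi Ω u φ a1 a2 b τ N (z, t) -
      gd Ω u φ τ (z, t) * gd Ω u φ τ (z, t) -
      gd Ω u φ (Complex.I • N) (z, t) * gd Ω u φ (Complex.I • N) (z, t) - B * ρ z := by
  obtain ⟨C, hC1, hC⟩ := logdet_bound D T M t0 ht0
  obtain ⟨Cg, hCg1, hCg⟩ := grad_bound D T M t0 hT hM ht0
  have hcpos := D.cpos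
  set C2 := M * Cg + 2 * M with hC2
  set C3 := Cg + M with hC3
  set c0 := Real.exp (-C) / 4 with hc0
  have hc0p : 0 < c0 := by positivity
  set Q := 2 * Kb * C2 + 2 * C3 * Kb + Kb + 4 * C3 * C2 + 4 * Kb ^ 2 + 2 * M ^ 2 + 4 * n * Kb with hQ
  have hQ0 : 0 ≤ Q := by positivity
  have hB0 : 0 ≤ Q * (1 / c0 + 2) / c := by positivity
  have hBc : ∀ x : ℝ, (x / c + 1) * c = x + c := fun x => by field_simp
  refine ⟨Q * (1 / c0 + 2) / c + 1, by linarith, ?_⟩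
  intro u φ S N τ hN hτ a1 a2 b ha1 ha2 hb t1 ht1 hi hbd
  set B := Q * (1 / c0 + 2) / c + 1 with hB
  have hIN : ‖Complex.I • N‖ ≤ 1 := by rw [norm_smul]; simpa using hN
  have hsub : closure Ω ×ˢ Icc t0 t1 ⊆ closure Ω ×ˢ Ioo (0 : ℝ) T :=
    prod_mono_right fun t ht => ⟨lt_of_lt_of_le ht0 ht.1, lt_of_le_of_lt ht.2 ht1⟩
  have hBρ : ∀ z ∈ closure Ω, 0 ≤ - (B * ρ z) := fun z hz => by
    have := D.le0 hz
    have : 0 ≤ B * (- ρ z) := mul_nonneg (by linarith) (by linarith)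
    linarith
  refine min_principle D.op D.bdd (W := fun q => Psi Ω u φ a1 a2 b τ N q -
      gd Ω u φ τ q * gd Ω u φ τ q -
      gd Ω u φ (Complex.I • N) q * gd Ω u φ (Complex.I • N) q - B * ρ q.1) ?_ ?_ ?_ ?_ ?_
  · refine ContinuousOn.mono ?_ hsub
    have hρ : ContinuousOn (fun q : Cn n × ℝ => ρ q.1) (closure Ω ×ˢ Ioo (0 : ℝ) T) :=
      (D.sm.continuous.comp continuous_fst).continuousOn
    exact ((((((ha1.cont.mul (gd_cont S τ)).add (ha2.cont.mul (gd_cont S N))).add hb.cont).sub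
      ((gd_cont S τ).mul (gd_cont S τ))).sub
      ((gd_cont S (Complex.I • N)).mul (gd_cont S (Complex.I • N)))).sub
      (continuousOn_const.mul hρ))
  · intro z hz t ht
    have ht' : t ∈ Ioo (0 : ℝ) T := ⟨ht0.trans ht.1, lt_of_le_of_lt ht.2 ht1⟩
    have gτ := gd_Sm D.op S hz ht' τ
    have gN := gd_Sm D.op S hz ht' N
    have gI := gd_Sm D.op S hz ht' (Complex.I • N)
    exact ((((((ha1.sm z hz t ht').mul gτ).add ((ha2.sm z hz t ht').mul gN)).add
      (hb.sm z hz t ht')).sub (gτ.mul gτ)).sub (gI.mul gI)).sub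
      ((Sm.const B _).mul (Sm_fst D.sm _))
  · intro z hz
    have := hi z hz
    have := hBρ z hz
    beta_reduce
    linarith
  · intro z hz t ht
    have := hbd z hz t ht
    have := hBρ z (frontier_subset_closure hz)
    beta_reduce
    linarith
  · intro z hz t ht _
    have ht' : t ∈ Ioo (0 : ℝ) T := ⟨ht0.trans ht.1, lt_of_le_of_lt ht.2 ht1⟩
    have ht'' : t ∈ Ico t0 T := ⟨ht.1.le, lt_of_le_of_lt ht.2 ht1⟩
    obtain ⟨v, μ, k, F, H⟩ := S.frm hz ht'
    obtain ⟨-, hμc, -⟩ := (hC u φ S).2 z hz t ht'' v μ k F H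
    refine ⟨v, μ, fun a => (H.pos a).le, ?_⟩
    have gτ := gd_Sm D.op S hz ht' τ
    have gN := gd_Sm D.op S hz ht' N
    have gI := gd_Sm D.op S hz ht' (Complex.I • N)
    have s1 := ha1.sm z hz t ht'
    have s2 := ha2.sm z hz t ht'
    have s3 := hb.sm z hz t ht'
    have hz' := subset_closure hz
    have hD1 : ∀ X : Cn n, ‖X‖ ≤ 1 → |D1 Ω u (z, t) X| ≤ Cg := fun X hX =>
      (hCg u φ S z hz' t ht'' X).trans (by nlinarith)
    have hg : ∀ X : Cn n, ‖X‖ ≤ 1 → |gd Ω u φ X (z, t)| ≤ C3 := by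
      intro X hX
      have h1 := abs_le.1 (hD1 X hX)
      have h2 := (S.bφ1 X).b0 z hz t ht'
      have h3 := abs_le.1 (h2.trans (show M * ‖X‖ ≤ M by nlinarith))
      unfold gd
      rw [abs_le, hC3]
      constructor <;> linarith
    unfold Psi
    rw [Lop_sub v μ ((((s1.mul gτ).add (s2.mul gN)).add s3).sub (gτ.mul gτ) |>.sub (gI.mul gI))
        ((Sm.const B _).mul (Sm_fst D.sm _)),
      Lop_sub v μ ((((s1.mul gτ).add (s2.mul gN)).add s3).sub (gτ.mul gτ)) (gI.mul gI),
      Lop_sub v μ (((s1.mul gτ).add (s2.mul gN)).add s3) (gτ.mul gτ),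
      Lop_add v μ ((s1.mul gτ).add (s2.mul gN)) s3,
      Lop_add v μ (s1.mul gτ) (s2.mul gN), Lop_cmul v μ B (Sm_fst D.sm _),
      Lop_mul v μ s1 gτ, Lop_mul v μ s2 gN, Lop_mul v μ gτ gτ, Lop_mul v μ gI gI]
    refine bar_scalar (k := Kb) (M := M) (C2 := C2) (C3 := C3) (c0 := c0) (Q := Q) (nn := n)
      (𝒯 := ∑ i, μ i) (c := c) (by linarith) (by positivity) (by positivity) (by positivity)
      (ha1.b0 z hz t ht') (ha2.b0 z hz t ht') (ha1.Lop_le hz ht' (DFr.nv v) H.pos)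
      (ha2.Lop_le hz ht' (DFr.nv v) H.pos) (hb.Lop_le hz ht' (DFr.nv v) H.pos)
      (hg τ hτ) (hg N hN) (hg _ hIN) (gd_Lop D.op S hz ht' hτ (hD1 τ hτ) H)
      (gd_Lop D.op S hz ht' hN (hD1 N hN) H) (gd_Lop D.op S hz ht' hIN (hD1 _ hIN) H)
      (Gam_young (fun a => (H.pos a).le) _ _ _) (ha1.Gam_le hz ht' H.pos)
      (gdN_gam D.op S hz ht' hN ha2 H) (Gam_self_nonneg (fun a => (H.pos a).le) _ _)
      (Gam_self_nonneg (fun a => (H.pos a).le) _ _) (Lop_rho D (DFr.nv v) H.pos hz' t)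
      (by linarith) hc0p hμc hQ ?_
    have hBc := hBc (Q * (1 / c0 + 2))
    linarith

end barrier2

section barrier3
variable {Ω : Set (Cn n)} {ρ : Cn n → ℝ} {c K : ℝ}

theorem Bd.lip_seg {T k : ℝ} {a : Cn n × ℝ → ℝ} (ha : Bd Ω T k a) {p V : Cn n}
    (hp : p ∈ closure Ω) {t : ℝ} (ht : t ∈ Ioo (0 : ℝ) T) {r : ℝ} (hr : 0 < r)
    (h : ∀ s ∈ Ioc (0 : ℝ) r, p + s • V ∈ Ω) :
    |a (p + r • V, t) - a (p, t)| ≤ k * ‖V‖ * r := by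
  have hcl : ∀ s ∈ Icc (0 : ℝ) r, p + s • V ∈ closure Ω := by
    intro s hs
    rcases hs.1.eq_or_lt with h0 | h0
    · rw [← h0]; simpa using hp
    · exact subset_closure (h s ⟨h0, hs.2⟩)
  have hcont : ContinuousOn (fun s : ℝ => a (p + s • V, t)) (Icc 0 r) :=
    ha.cont.comp (f := fun s : ℝ => (p + s • V, t)) (by fun_prop) (fun s hs => ⟨hcl s hs, ht⟩)
  have hd : ∀ s ∈ Ioo (0 : ℝ) r, HasDerivAt (fun s : ℝ => a (p + s • V, t))
      (dd (V, (0 : ℝ)) a (p + s • V, t)) s := by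
    intro s hs
    have := hasDerivAt_line (W := a) (p := (p + s • V, t)) (q := (p, t)) (s := s)
      (ha.sm _ (h s ⟨hs.1, hs.2.le⟩) t ht).diff (V, (0 : ℝ)) (by simp)
    simpa using this
  obtain ⟨s, hs, he⟩ := exists_hasDerivAt_eq_slope _ _ hr hcont hd
  have hb := ha.b1 _ (h s ⟨hs.1, hs.2.le⟩) t ht V
  simp only [sub_zero, zero_smul, add_zero] at he
  rw [eq_div_iff hr.ne'] at he
  rw [← he, abs_mul, abs_of_pos hr]
  exact mul_le_mul_of_nonneg_right hb hr.le

theorem gd_le {T M Cg : ℝ} {u φ : Cn n × ℝ → ℝ} (S : Sol Ω T M u φ) {z : Cn n}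
    (hz : z ∈ closure Ω) {t : ℝ} (ht : t ∈ Ioo (0 : ℝ) T)
    {X : Cn n} (hX : ‖X‖ ≤ 1) (hC : |D1 Ω u (z, t) X| ≤ Cg * ‖X‖) (hCg : 1 ≤ Cg) :
    |gd Ω u φ X (z, t)| ≤ Cg + M := by
  have hM := S.M1
  have h1 := abs_le.1 (hC.trans (show Cg * ‖X‖ ≤ Cg by nlinarith))
  have h3 := abs_le.1 (((S.bφ1 X).b0c z hz t ht).trans (show M * ‖X‖ ≤ M by nlinarith))
  unfold gd
  rw [abs_le]
  constructor <;> linarith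

/-- Difference of the second derivatives. -/
def G2 (Ω : Set (Cn n)) (u φ : Cn n × ℝ → ℝ) (q : Cn n × ℝ) (X Y : Cn n) : ℝ :=
  D2 Ω u q X Y - D2 Ω φ q X Y

theorem gd_hasFDeriv {T M : ℝ} {u φ : Cn n × ℝ → ℝ} (S : Sol Ω T M u φ) {z : Cn n}
    (hz : z ∈ closure Ω) {t : ℝ} (ht : t ∈ Ioo (0 : ℝ) T) (Y : Cn n) :
    ∃ L : Cn n →L[ℝ] ℝ, HasFDerivWithinAt (fun x => gd Ω u φ Y (x, t)) L (closure Ω) z ∧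
      ∀ X, L X = G2 Ω u φ (z, t) X Y := by
  have h := ((S.ru.h2 z hz t ht).clm_apply (hasFDerivWithinAt_const Y z (closure Ω))).sub
    ((S.rφ.h2 z hz t ht).clm_apply (hasFDerivWithinAt_const Y z (closure Ω)))
  refine ⟨_, h, fun X => ?_⟩
  simp [G2]

theorem gd_slope {T M : ℝ} {u φ : Cn n × ℝ → ℝ} (S : Sol Ω T M u φ) {p : Cn n}
    (hp : p ∈ closure Ω) {t : ℝ} (ht : t ∈ Ioo (0 : ℝ) T) (V Y : Cn n) {δ : ℝ} (hδ : 0 < δ)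
    (h : ∀ r ∈ Ioo (0 : ℝ) δ, p + r • V ∈ Ω) :
    Tendsto (fun r : ℝ => r⁻¹ * (gd Ω u φ Y (p + r • V, t) - gd Ω u φ Y (p, t))) (𝓝[Ioo 0 δ] 0)
      (𝓝 (G2 Ω u φ (p, t) V Y)) := by
  obtain ⟨L, hL, hLX⟩ := gd_hasFDeriv S hp ht Y
  rw [← hLX]
  have hγ : HasDerivWithinAt (fun r : ℝ => p + r • V) V (Ioo 0 δ) 0 := by
    simpa using (((hasDerivAt_id (0 : ℝ)).smul_const V).const_add p).hasDerivWithinAt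
  have hL' : HasFDerivWithinAt (fun x => gd Ω u φ Y (x, t)) L (closure Ω) (p + (0 : ℝ) • V) := by
    simpa using hL
  have h1 := hL'.comp_hasDerivWithinAt (0 : ℝ) hγ (fun r hr => subset_closure (h r hr))
  rw [hasDerivWithinAt_iff_tendsto_slope' (by simp)] at h1
  refine h1.congr' ?_
  filter_upwards with r
  simp [slope_def_field, div_eq_inv_mul]

set_option maxHeartbeats 1600000 in
theorem barrier_lem [NeZero n] (D : Dom Ω ρ c K) (T M t0 δ r0 Kb : ℝ) (hT : 0 < T) (hM : 1 ≤ M)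
    (ht0 : 0 < t0) (hδ : 0 < δ) (hr0 : 0 < r0) (hKb : 1 ≤ Kb) : ∃ C : ℝ, 1 ≤ C ∧
    ∀ u φ : Cn n × ℝ → ℝ, Sol Ω T M u φ → ∀ p ∈ frontier Ω, ∀ N τ : Cn n, ‖N‖ = 1 →
    c ≤ dd N ρ p → dd (Complex.I • N) ρ p = 0 → ‖τ‖ ≤ 1 → dd τ ρ p = 0 →
    ∀ a1 a2 b : Cn n × ℝ → ℝ, Bd Ω T Kb a1 → Bd Ω T Kb a2 → Bd Ω T Kb b →
    ∀ ts, t0 + δ ≤ ts → ts < T →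
    (∀ z ∈ frontier Ω, dist z p < r0 → ∀ t ∈ Icc t0 ts, 0 ≤ Psi Ω u φ a1 a2 b τ N (z, t)) →
    Psi Ω u φ a1 a2 b τ N (p, ts) = 0 →
    a1 (p, ts) * G2 Ω u φ (p, ts) N τ + a2 (p, ts) * G2 Ω u φ (p, ts) N N ≤ C := by
  obtain ⟨Cg, hCg1, hCg⟩ := grad_bound D T M t0 hT hM ht0
  obtain ⟨A, hA1, hA⟩ := bgrad D T M t0 ht0
  obtain ⟨R, hR⟩ := D.bdd.closure.exists_norm_le
  have hK1 := D.Kpos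
  have hc := D.cpos
  set R' := |R| with hR'
  have hRp : ∀ z ∈ closure Ω, ‖z‖ ≤ R' := fun z hz => (hR z hz).trans (le_abs_self R)
  set C3 := Cg + M with hC3
  set P0 := 2 * (Kb * C3) + Kb with hP0
  have hP0p : 0 ≤ P0 := by positivity
  set K1 := 2 * (A * K) ^ 2 + P0 / r0 ^ 2 + (P0 + 2 * C3 ^ 2) / δ with hK1d
  have hK1p : 0 ≤ K1 := by positivity
  set Kb' := Kb + 4 * (|K1| * (4 * R' ^ 2 + 4 * R' + 2)) + 4 * (|K1| * (T + T + 1)) with hKb'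
  have hKK : Kb ≤ Kb' := by
    have : 0 ≤ 4 * (|K1| * (4 * R' ^ 2 + 4 * R' + 2)) := by positivity
    have : 0 ≤ 4 * (|K1| * (T + T + 1)) := by positivity
    linarith
  obtain ⟨B, hB1, hB⟩ := barrier_core D T M t0 Kb' hT hM ht0 (hKb.trans hKK)
  have hCp : 0 ≤ B * K := by positivity
  have hCp' : 0 ≤ Kb * C3 := by positivity
  refine ⟨Kb * C3 + Kb + B * K, by linarith, ?_⟩
  intro u φ S p hp N τ hN hcN hIN hτ hτρ a1 a2 b ha1 ha2 hb ts hts htsT hΨ hΨ0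
  have hpc := frontier_subset_closure hp
  have hts' : ts ∈ Ioo (0 : ℝ) T := ⟨by linarith, htsT⟩
  have hINn : ‖Complex.I • N‖ ≤ 1 := by rw [norm_smul]; simp [hN]
  have hg : ∀ z ∈ closure Ω, ∀ t ∈ Icc t0 ts, ∀ X : Cn n, ‖X‖ ≤ 1 → |gd Ω u φ X (z, t)| ≤ C3 := by
    intro z hz t ht X hX
    exact gd_le S hz ⟨by linarith [ht.1], by linarith [ht.2]⟩ hX
      (hCg u φ S z hz t ⟨ht.1, by linarith [ht.2]⟩ X) hCg1
  have hPsi : ∀ z ∈ closure Ω, ∀ t ∈ Icc t0 ts, -P0 ≤ Psi Ω u φ a1 a2 b τ N (z, t) := by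
    intro z hz t ht
    have ht' : t ∈ Ioo (0 : ℝ) T := ⟨by linarith [ht.1], by linarith [ht.2]⟩
    have e1 := (abs_le.1 (Bd.abs_mul_le (ha1.b0c z hz t ht') (hg z hz t ht τ hτ))).1
    have e2 := (abs_le.1 (Bd.abs_mul_le (ha2.b0c z hz t ht') (hg z hz t ht N hN.le))).1
    have e3 := (abs_le.1 (hb.b0c z hz t ht')).1
    unfold Psi
    linarith
  set b' : Cn n × ℝ → ℝ := fun q => b q + K1 * ‖q.1 - p‖ ^ 2 + K1 * (ts - q.2) with hb'
  have hPb : ∀ q, Psi Ω u φ a1 a2 b' τ N q = Psi Ω u φ a1 a2 b τ N q + K1 * ‖q.1 - p‖ ^ 2 +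
      K1 * (ts - q.2) := by
    intro q; unfold Psi; rw [hb']; ring
  have hb'B : Bd Ω T Kb' b' := by
    refine ((hb.add ((Bd_sq (abs_nonneg R) T (fun z hz => hRp z (subset_closure hz))
      (hRp p hpc)).cmul K1)).add ((Bd_time Ω T ts hts'.1.le hT).cmul K1)).mono ?_
    rw [hKb', ← hR']
    have : |K1| * (ts + T + 1) ≤ |K1| * (T + T + 1) :=
      mul_le_mul_of_nonneg_left (by linarith) (abs_nonneg _)
    linarith
  have hsq : ∀ x : ℝ, |x| ≤ C3 → x * x ≤ C3 ^ 2 := by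
    intro x hx
    have := sq_le_sq' (abs_le.1 hx).1 (abs_le.1 hx).2
    nlinarith
  have main := hB u φ S N τ hN.le hτ a1 a2 b' (ha1.mono hKK) (ha2.mono hKK) hb'B ts htsT ?_ ?_
  rotate_left
  · intro z hz
    have ht : t0 ∈ Icc t0 ts := ⟨le_refl _, by linarith⟩
    have e1 := hPsi z hz t0 ht
    have e2 := hsq _ (hg z hz t0 ht τ hτ)
    have e3 := hsq _ (hg z hz t0 ht _ hINn)
    rw [hPb]
    have e4 : 0 ≤ K1 * ‖z - p‖ ^ 2 := by positivity
    have e5 : P0 + 2 * C3 ^ 2 ≤ K1 * (ts - t0) := by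
      have f1 : (P0 + 2 * C3 ^ 2) / δ ≤ K1 := by
        have : 0 ≤ 2 * (A * K) ^ 2 + P0 / r0 ^ 2 := by positivity
        linarith
      rw [div_le_iff₀ hδ] at f1
      have f2 : K1 * δ ≤ K1 * (ts - t0) := mul_le_mul_of_nonneg_left (by linarith) hK1p
      linarith
    change 0 ≤ Psi Ω u φ a1 a2 b τ N (z, t0) + K1 * ‖z - p‖ ^ 2 + K1 * (ts - t0) - _ - _
    linarith
  · intro z hz t ht
    have hzc := frontier_subset_closure hz
    have ht' : t ∈ Ico t0 T := ⟨ht.1, by linarith [ht.2]⟩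
    have hgl : ∀ X : Cn n, ‖X‖ ≤ 1 → dd X ρ p = 0 →
        gd Ω u φ X (z, t) * gd Ω u φ X (z, t) ≤ (A * K) ^ 2 * ‖z - p‖ ^ 2 := by
      intro X hX hX0
      have f1 := hA u φ S z hz t ht' X
      have f2 := D.lip X z p
      rw [hX0, sub_zero] at f2
      have f3 : K * ‖X‖ * ‖z - p‖ ≤ K * ‖z - p‖ := by
        have : K * ‖X‖ ≤ K := by nlinarith
        gcongr
      have f4 : |gd Ω u φ X (z, t)| ≤ A * (K * ‖z - p‖) :=
        f1.trans (mul_le_mul_of_nonneg_left (f2.trans f3) (by linarith))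
      have f5 := sq_le_sq' (abs_le.1 f4).1 (abs_le.1 f4).2
      calc _ = gd Ω u φ X (z, t) ^ 2 := by ring
        _ ≤ _ := f5
        _ = _ := by ring
    have e1 := hgl τ hτ hτρ
    have e2 := hgl _ hINn hIN
    rw [hPb]
    change 0 ≤ Psi Ω u φ a1 a2 b τ N (z, t) + K1 * ‖z - p‖ ^ 2 + K1 * (ts - t) - _ - _
    have e3 : 0 ≤ K1 * (ts - t) := mul_nonneg hK1p (by linarith [ht.2])
    have e4 : K1 * ‖z - p‖ ^ 2 = 2 * ((A * K) ^ 2 * ‖z - p‖ ^ 2) + P0 / r0 ^ 2 * ‖z - p‖ ^ 2 +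
        (P0 + 2 * C3 ^ 2) / δ * ‖z - p‖ ^ 2 := by rw [hK1d]; ring
    have e5 : 0 ≤ (P0 + 2 * C3 ^ 2) / δ * ‖z - p‖ ^ 2 := by positivity
    have e6 : 0 ≤ Psi Ω u φ a1 a2 b τ N (z, t) + P0 / r0 ^ 2 * ‖z - p‖ ^ 2 := by
      rcases lt_or_ge (dist z p) r0 with h | h
      · have := hΨ z hz h t ht
        positivity
      · have f1 := hPsi z hzc t ht
        rw [dist_eq_norm] at h
        have f2 : r0 ^ 2 ≤ ‖z - p‖ ^ 2 := by gcongr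
        have f3 : P0 ≤ P0 / r0 ^ 2 * ‖z - p‖ ^ 2 := by
          calc P0 = P0 / r0 ^ 2 * r0 ^ 2 := by field_simp
            _ ≤ _ := by gcongr
        linarith
    linarith
  -- the one sided derivative
  have hNneg : dd (-N) ρ p < 0 := by rw [dd_vneg]; linarith
  obtain ⟨d, hd, hin⟩ := D.inward hp hNneg
  have hseg : ∀ r ∈ Ioo (0 : ℝ) d, p + r • (-N) ∈ Ω := fun r hr =>
    hin p hpc (by simpa using hd) r hr
  have hNn : ‖-N‖ = 1 := by rw [norm_neg, hN]
  have l1 := gd_slope S hpc hts' (-N) τ hd hseg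
  have l2 := gd_slope S hpc hts' (-N) N hd hseg
  have hline : ∀ a : Cn n × ℝ → ℝ, ContinuousOn a (closure Ω ×ˢ Ioo (0 : ℝ) T) →
      Tendsto (fun r : ℝ => a (p + r • (-N), ts)) (𝓝[Ioo 0 d] 0) (𝓝 (a (p, ts))) := by
    intro a ha
    have h1 : ContinuousWithinAt a (closure Ω ×ˢ Ioo (0 : ℝ) T) (p, ts) := ha _ ⟨hpc, hts'⟩
    have h2 : Tendsto (fun r : ℝ => (p + r • (-N), ts)) (𝓝[Ioo 0 d] 0)
        (𝓝[closure Ω ×ˢ Ioo (0 : ℝ) T] (p, ts)) := by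
      refine tendsto_nhdsWithin_iff.2 ⟨?_, ?_⟩
      · have : ContinuousAt (fun r : ℝ => (p + r • (-N), ts)) 0 := by fun_prop
        have h3 := this.tendsto
        simp only [zero_smul, add_zero] at h3
        exact h3.mono_left nhdsWithin_le_nhds
      · filter_upwards [self_mem_nhdsWithin] with r hr
        exact ⟨subset_closure (hseg r hr), hts'⟩
    exact h1.tendsto.comp h2
  have l3 := hline a1 ha1.cont
  have l4 := hline a2 ha2.cont
  have l5 : Tendsto (fun r : ℝ => K1 * r) (𝓝[Ioo 0 d] 0) (𝓝 (K1 * 0)) :=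
    ((continuous_const.mul continuous_id).tendsto 0).mono_left nhdsWithin_le_nhds
  have lim := ((((l3.mul l1).add (l4.mul l2)).add_const (Kb * C3 + Kb + B * K)).add l5)
  have hne : (𝓝[Ioo (0 : ℝ) d] 0).NeBot := left_nhdsWithin_Ioo_neBot hd
  have hgτ0 : gd Ω u φ τ (p, ts) = 0 := by
    have := hA u φ S p hp ts ⟨by linarith, htsT⟩ τ
    rw [hτρ, abs_zero, mul_zero] at this
    exact abs_nonpos_iff.1 this
  have hts'' : ts ∈ Icc t0 ts := ⟨by linarith, le_refl _⟩
  have fin := ge_of_tendsto lim (b := 0) ?_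
  · have e : ∀ Y, G2 Ω u φ (p, ts) (-N) Y = - G2 Ω u φ (p, ts) N Y := by
      intro Y; unfold G2; simp; ring
    rw [e, e] at fin
    linarith
  filter_upwards [self_mem_nhdsWithin] with r hr
  have hzr := hseg r hr
  have hzrc := subset_closure hzr
  have m1 := main _ hzrc ts hts''
  rw [hPb] at m1
  change 0 ≤ Psi Ω u φ a1 a2 b τ N (p + r • (-N), ts) + K1 * ‖p + r • (-N) - p‖ ^ 2 + K1 * (ts - ts)
    - _ - _ - _ at m1
  have hnorm : ‖p + r • (-N) - p‖ = r := by
    rw [add_sub_cancel_left, norm_smul, hNn, mul_one, Real.norm_eq_abs, abs_of_pos hr.1]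
  rw [hnorm, sub_self, mul_zero] at m1
  have s1 := mul_self_nonneg (gd Ω u φ τ (p + r • (-N), ts))
  have s2 := mul_self_nonneg (gd Ω u φ (Complex.I • N) (p + r • (-N), ts))
  obtain ⟨s, hs, hsρ⟩ := D.mvt p (-N) hr.1
  have hρb := D.b1 (p + s • (-N)) (-N)
  rw [hNn, mul_one] at hρb
  rw [D.zero p hp, zero_add] at hsρ
  have hρr : - (B * ρ (p + r • (-N))) ≤ B * K * r := by
    rw [hsρ]
    have f1 := (abs_le.1 hρb).1
    have f2 : B * r * (-(dd (-N) ρ (p + s • (-N)))) ≤ B * r * K :=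
      mul_le_mul_of_nonneg_left (by linarith) (mul_nonneg (by linarith) hr.1.le)
    linarith
  have hseg' : ∀ s ∈ Ioc (0 : ℝ) r, p + s • (-N) ∈ Ω := fun s hs =>
    hseg s ⟨hs.1, lt_of_le_of_lt hs.2 hr.2⟩
  have la2 := ha2.lip_seg hpc hts' hr.1 hseg'
  have lb := hb.lip_seg hpc hts' hr.1 hseg'
  rw [hNn, mul_one] at la2 lb
  have la2' := (abs_le.1 (Bd.abs_mul_le la2 (hg p hpc ts hts'' N hN.le))).2
  have lb' := (abs_le.1 lb).2
  have hΨ0' := hΨ0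
  unfold Psi at m1 hΨ0'
  rw [hgτ0] at hΨ0'
  rw [hgτ0, sub_zero]
  have hr' := hr.1
  have key : 0 ≤ r * (a1 (p + r • (-N), ts) * (r⁻¹ * gd Ω u φ τ (p + r • (-N), ts)) +
      a2 (p + r • (-N), ts) * (r⁻¹ * (gd Ω u φ N (p + r • (-N), ts) - gd Ω u φ N (p, ts))) +
      (Kb * C3 + Kb + B * K) + K1 * r) := by
    have : r * (a1 (p + r • (-N), ts) * (r⁻¹ * gd Ω u φ τ (p + r • (-N), ts)) +
      a2 (p + r • (-N), ts) * (r⁻¹ * (gd Ω u φ N (p + r • (-N), ts) - gd Ω u φ N (p, ts))) +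
      (Kb * C3 + Kb + B * K) + K1 * r) = a1 (p + r • (-N), ts) * gd Ω u φ τ (p + r • (-N), ts) +
      a2 (p + r • (-N), ts) * (gd Ω u φ N (p + r • (-N), ts) - gd Ω u φ N (p, ts)) +
      (Kb * C3 + Kb + B * K) * r + K1 * r ^ 2 := by field_simp
    rw [this]
    linarith
  exact nonneg_of_mul_nonneg_right key hr'

end barrier3

section bdry2
variable {Ω : Set (Cn n)} {ρ : Cn n → ℝ} {c K : ℝ}

theorem gd_lin (u φ : Cn n × ℝ → ℝ) (q : Cn n × ℝ) (x y : ℝ) (X Y : Cn n) :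
    gd Ω u φ (x • X + y • Y) q = x * gd Ω u φ X q + y * gd Ω u φ Y q := by
  unfold gd; simp; ring

theorem dd_lin {G : Type*} [NormedAddCommGroup G] [NormedSpace ℝ G] (h : G → ℝ) (z : G) (x y : ℝ)
    (X Y : G) : dd (x • X + y • Y) h z = x * dd X h z + y * dd Y h z := by
  unfold dd; simp

theorem gd_prop {A : ℝ} {u φ : Cn n × ℝ → ℝ} {z : Cn n} {t : ℝ}
    (h : ∀ X, |gd Ω u φ X (z, t)| ≤ A * |dd X ρ z|) (X Y : Cn n) :
    dd Y ρ z * gd Ω u φ X (z, t) - dd X ρ z * gd Ω u φ Y (z, t) = 0 := by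
  have := h (dd Y ρ z • X + (- dd X ρ z) • Y)
  rw [gd_lin, dd_lin] at this
  have e : dd Y ρ z * dd X ρ z + -dd X ρ z * dd Y ρ z = 0 := by ring
  rw [e, abs_zero, mul_zero] at this
  have := abs_nonpos_iff.1 this
  linarith

theorem tang_tang {T M A t0 : ℝ} (D : Dom Ω ρ c K) (ht0 : 0 < t0) {u φ : Cn n × ℝ → ℝ}
    (S : Sol Ω T M u φ)
    (hA : ∀ p ∈ frontier Ω, ∀ t ∈ Ico t0 T, ∀ X, |gd Ω u φ X (p, t)| ≤ A * |dd X ρ p|)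
    {p : Cn n} (hp : p ∈ frontier Ω) {t : ℝ} (ht : t ∈ Ico t0 T) (N : Cn n) {τ τ' : Cn n}
    (hτ : dd τ ρ p = 0) (hτ' : dd τ' ρ p = 0) :
    dd N ρ p * G2 Ω u φ (p, t) τ' τ = dd τ' (dd τ ρ) p * gd Ω u φ N (p, t) := by
  have hpc := frontier_subset_closure hp
  have ht' : t ∈ Ioo (0 : ℝ) T := ⟨lt_of_lt_of_le ht0 ht.1, ht.2⟩
  obtain ⟨L1, hL1, hL1X⟩ := gd_hasFDeriv S hpc ht' τ
  obtain ⟨L2, hL2, hL2X⟩ := gd_hasFDeriv S hpc ht' N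
  have d1 : ∀ X : Cn n, HasFDerivWithinAt (dd X ρ) (fderiv ℝ (dd X ρ) p) (closure Ω) p := fun X =>
    (((D.cdd X).contDiffAt (x := p)).differentiableAt (by simp)).hasFDerivAt.hasFDerivWithinAt
  have hd := ((d1 N).mul hL1).sub ((d1 τ).mul hL2)
  have key := D.tang hp hτ' hd (fun z hz => gd_prop (hA z hz t ht) τ N)
  have hg0 : gd Ω u φ τ (p, t) = 0 := by
    have := hA p hp t ht τ
    rw [hτ, abs_zero, mul_zero] at this
    exact abs_nonpos_iff.1 this
  simp only [ContinuousLinearMap.sub_apply, ContinuousLinearMap.add_apply,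
    ContinuousLinearMap.smul_apply, smul_eq_mul, hL1X, hL2X, hτ, hg0, zero_mul, add_zero,
    zero_add] at key
  change dd N ρ p * G2 Ω u φ (p, t) τ' τ - gd Ω u φ N (p, t) * dd τ' (dd τ ρ) p = 0 at key
  linarith

theorem mixed_bound [NeZero n] (D : Dom Ω ρ c K) (T M t0 : ℝ) (hT : 0 < T) (hM : 1 ≤ M)
    (ht0 : 0 < t0) : ∃ C : ℝ, 1 ≤ C ∧
    ∀ u φ : Cn n × ℝ → ℝ, Sol Ω T M u φ → ∀ p ∈ frontier Ω, ∀ N τ : Cn n, ‖N‖ = 1 →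
    c ≤ dd N ρ p → dd (Complex.I • N) ρ p = 0 → ‖τ‖ ≤ 1 → dd τ ρ p = 0 →
    ∀ t ∈ Ico t0 T, |G2 Ω u φ (p, t) N τ| ≤ C := by
  have hK := D.Kpos
  have hc := D.cpos
  obtain ⟨A, hA1, hA⟩ := bgrad D T M (t0 / 2) (by linarith)
  obtain ⟨C, hC1, hC⟩ := barrier_lem D T M (t0 / 2) (t0 / 2) 1 (4 * K) hT hM (by linarith)
    (by linarith) one_pos (by linarith)
  refine ⟨C / c + 1, by have : 0 ≤ C / c := by positivity
                        linarith, ?_⟩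
  intro u φ S p hp N τ hN hcN hIN hτ hτρ t ht
  have b1 : Bd Ω T K (fun q => dd N ρ q.1) := (D.bd1 T N).mono (by rw [hN, mul_one])
  have b2 : Bd Ω T K (fun q => dd τ ρ q.1) := (D.bd1 T τ).mono (by nlinarith)
  have b3 : Bd Ω T (4 * K) (fun q => (-1) * dd N ρ q.1) := (b1.cmul (-1)).mono (by simp)
  have b4 : Bd Ω T (4 * K) (fun q => (-1) * dd τ ρ q.1) := (b2.cmul (-1)).mono (by simp)
  have b0 : Bd Ω T (4 * K) (fun _ => (0 : ℝ)) := (Bd.const Ω T 0).mono (by simp; linarith)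
  have hz : ∀ z ∈ frontier Ω, ∀ s ∈ Icc (t0 / 2) t,
      dd N ρ z * gd Ω u φ τ (z, s) - dd τ ρ z * gd Ω u φ N (z, s) = 0 := fun z hz s hs =>
    gd_prop (hA u φ S z hz s ⟨hs.1, lt_of_le_of_lt hs.2 ht.2⟩) τ N
  have hpt := hz p hp t ⟨by linarith [ht.1], le_refl _⟩
  have h1 := hC u φ S p hp N τ hN hcN hIN hτ hτρ (fun q => dd N ρ q.1)
    (fun q => (-1) * dd τ ρ q.1) (fun _ => 0) (b1.mono (by linarith)) b4 b0 t
    (by linarith [ht.1]) ht.2 (fun z hzf _ s hs => by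
      have := hz z hzf s hs
      unfold Psi; dsimp only; linarith) (by unfold Psi; dsimp only; linarith)
  have h2 := hC u φ S p hp N τ hN hcN hIN hτ hτρ (fun q => (-1) * dd N ρ q.1)
    (fun q => dd τ ρ q.1) (fun _ => 0) b3 (b2.mono (by linarith)) b0 t
    (by linarith [ht.1]) ht.2 (fun z hzf _ s hs => by
      have := hz z hzf s hs
      unfold Psi; dsimp only; linarith) (by unfold Psi; dsimp only; linarith)
  dsimp only at h1 h2
  rw [hτρ] at h1 h2
  have h3 : |dd N ρ p * G2 Ω u φ (p, t) N τ| ≤ C := by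
    rw [abs_le]; constructor <;> linarith
  rw [abs_mul, abs_of_pos (by linarith)] at h3
  have h4 : c * |G2 Ω u φ (p, t) N τ| ≤ C :=
    (mul_le_mul_of_nonneg_right hcN (abs_nonneg _)).trans h3
  have h5 : |G2 Ω u φ (p, t) N τ| ≤ C / c := by rw [le_div_iff₀ hc]; linarith
  linarith

end bdry2

section dnormal
variable {Ω : Set (Cn n)} {ρ : Cn n → ℝ} {c K : ℝ}

theorem DFr.q_va {M : ℝ} {u : Cn n × ℝ → ℝ} {p : Cn n × ℝ} {v : OrthonormalBasis (Fin n) ℂ (Cn n)}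
    {μ : Fin n → ℝ} {k F : ℝ} (H : DFr M u p v μ k F) (a : Fin n) : Qf u p (v a) (v a) = 1 / μ a := by
  rw [H.q1, orthonormal_iff_ite.1 v.orthonormal a a]
  simp

theorem sum_log_one {C l : ℝ} {x : Fin n → ℝ} (hs : |∑ a, x a| ≤ C)
    (hl : 0 ≤ l) (h : ∀ a, -l ≤ x a) (b : Fin n) : x b ≤ C + n * l := by
  have h1 : ∑ a ∈ Finset.univ.erase b, (-l) ≤ ∑ a ∈ Finset.univ.erase b, x a :=
    Finset.sum_le_sum fun a _ => h a
  rw [Finset.sum_const, nsmul_eq_mul] at h1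
  have h2 := Finset.add_sum_erase Finset.univ x (Finset.mem_univ b)
  have h3 : ((Finset.univ.erase b).card : ℝ) ≤ n := by
    have : (Finset.univ.erase b).card ≤ n := by
      refine (Finset.card_le_card (Finset.erase_subset _ _)).trans ?_
      simp
    exact_mod_cast this
  have h4 := (abs_le.1 hs).2
  nlinarith

theorem F1_int {M C Λ : ℝ} {u : Cn n × ℝ → ℝ} {p : Cn n × ℝ}
    {v : OrthonormalBasis (Fin n) ℂ (Cn n)}
    {μ : Fin n → ℝ} {k F : ℝ} (H : DFr M u p v μ k F) (hC : |∑ a, Real.log (4 * μ a)| ≤ C)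
    (hΛ : 0 < Λ) (h : ∀ X, Qf u p X X ≤ Λ * ‖X‖ ^ 2) (X : Cn n) :
    4 * Real.exp (-(C + n * |Real.log (4 / Λ)|)) * ‖X‖ ^ 2 ≤ Qf u p X X := by
  have h1 : ∀ a, -|Real.log (4 / Λ)| ≤ Real.log (4 * μ a) := by
    intro a
    have hm := H.pos a
    have e := h (v a)
    rw [H.q_va, DFr.nv, one_pow, mul_one, div_le_iff₀ hm] at e
    refine (neg_abs_le _).trans (Real.log_le_log (by positivity) ?_)
    rw [div_le_iff₀ hΛ]
    nlinarith
  have h2 := sum_log_one hC (abs_nonneg _) h1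
  rw [H.qxx, ← norm_sq_frame v, Finset.mul_sum]
  refine Finset.sum_le_sum fun a _ => ?_
  have hm := H.pos a
  have e := Real.exp_le_exp.2 (h2 a)
  rw [Real.exp_log (by positivity)] at e
  rw [le_div_iff₀ hm, Real.exp_neg]
  have hE := Real.exp_pos (C + n * |Real.log (4 / Λ)|)
  have e2 : (Real.exp (C + n * |Real.log (4 / Λ)|))⁻¹ * (4 * μ a) ≤ 1 := by
    rw [inv_mul_le_iff₀ hE]; linarith
  have := mul_le_mul_of_nonneg_left e2 (sq_nonneg ‖(inner ℂ (v a) X : ℂ)‖)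
  linarith

theorem F2_int {M C c' : ℝ} {u : Cn n × ℝ → ℝ} {p : Cn n × ℝ}
    {v : OrthonormalBasis (Fin n) ℂ (Cn n)}
    {μ : Fin n → ℝ} {k F : ℝ} (H : DFr M u p v μ k F) (hC : |∑ a, Real.log (4 * μ a)| ≤ C)
    (hc : 0 < c') (h : ∀ X, c' * ‖X‖ ^ 2 ≤ Qf u p X X) (X : Cn n) :
    Qf u p X X ≤ 4 * Real.exp (C + n * |Real.log (4 / c')|) * ‖X‖ ^ 2 := by
  have h1 : ∀ a, -|Real.log (4 / c')| ≤ -Real.log (4 * μ a) := by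
    intro a
    have hm := H.pos a
    have e := h (v a)
    rw [H.q_va, DFr.nv, one_pow, mul_one, le_div_iff₀ hm] at e
    have : Real.log (4 * μ a) ≤ Real.log (4 / c') := by
      refine Real.log_le_log (by positivity) ?_
      rw [le_div_iff₀ hc]
      nlinarith
    linarith [le_abs_self (Real.log (4 / c'))]
  have hC' : |∑ a, -Real.log (4 * μ a)| ≤ C := by rwa [Finset.sum_neg_distrib, abs_neg]
  have h2 := sum_log_one hC' (abs_nonneg _) h1
  rw [H.qxx, ← norm_sq_frame v, Finset.mul_sum]
  refine Finset.sum_le_sum fun a _ => ?_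
  have hm := H.pos a
  have e := Real.exp_le_exp.2 (h2 a)
  rw [Real.exp_neg, Real.exp_log (by positivity)] at e
  rw [div_le_iff₀ hm]
  have e2 : 1 ≤ Real.exp (C + n * |Real.log (4 / c')|) * (4 * μ a) := by
    rwa [inv_le_iff_one_le_mul₀ (by positivity)] at e
  have := mul_le_mul_of_nonneg_left e2 (sq_nonneg ‖(inner ℂ (v a) X : ℂ)‖)
  linarith

/-- The Levi form on the closure. -/
def QD (Ω : Set (Cn n)) (u : Cn n × ℝ → ℝ) (q : Cn n × ℝ) (X : Cn n) : ℝ :=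
  D2 Ω u q X X + D2 Ω u q (Complex.I • X) (Complex.I • X)

theorem QD_eq {T : ℝ} {u : Cn n × ℝ → ℝ} (R : Reg Ω T u) {z : Cn n} (hz : z ∈ Ω) {t : ℝ}
    (ht : t ∈ Ioo (0 : ℝ) T) (X : Cn n) : QD Ω u (z, t) X = Qf u (z, t) X X := by
  unfold QD Qf
  rw [R.e2 z hz t ht, R.e2 z hz t ht]

theorem I_norm (X : Cn n) : ‖Complex.I • X‖ = ‖X‖ := by rw [norm_smul]; simp

theorem QD_near {T : ℝ} {u : Cn n × ℝ → ℝ} (R : Reg Ω T u) {p : Cn n} (hp : p ∈ closure Ω) {t : ℝ}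
    (ht : t ∈ Ioo (0 : ℝ) T) {η : ℝ} (hη : 0 < η) :
    ∃ z ∈ Ω, ∀ X, |QD Ω u (z, t) X - QD Ω u (p, t) X| ≤ η * ‖X‖ ^ 2 := by
  have h1 : ContinuousWithinAt (fun x => D2 Ω u (x, t)) (closure Ω) p :=
    (R.c2.comp (f := fun x => (x, t)) (by fun_prop) (fun x hx => ⟨hx, ht⟩)) p hp
  have h2 : (𝓝[Ω] p).NeBot := mem_closure_iff_nhdsWithin_neBot.1 hp
  have h3 := (h1.mono subset_closure).tendsto
  have h3' : Tendsto (fun x => ‖D2 Ω u (x, t) - D2 Ω u (p, t)‖) (𝓝[Ω] p)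
      (𝓝 0) :=
    (tendsto_iff_norm_sub_tendsto_zero (E := Cn n →L[ℝ] Cn n →L[ℝ] ℝ)).1 h3
  have h4 := (h3'.eventually_lt_const (show (0 : ℝ) < η / 2 by linarith)).and self_mem_nhdsWithin
  obtain ⟨z, hz1, hz⟩ := h4.exists
  refine ⟨z, hz, fun X => ?_⟩
  have h5 : ∀ Y, |D2 Ω u (z, t) Y Y - D2 Ω u (p, t) Y Y| ≤ η / 2 * ‖Y‖ ^ 2 := by
    intro Y
    have e1 := (D2 Ω u (z, t) - D2 Ω u (p, t)).le_opNorm₂ Y Y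
    rw [ContinuousLinearMap.sub_apply, ContinuousLinearMap.sub_apply, Real.norm_eq_abs] at e1
    refine e1.trans ?_
    rw [mul_assoc, ← sq]
    exact mul_le_mul_of_nonneg_right hz1.le (sq_nonneg _)
  have e1 := abs_le.1 (h5 X)
  have e2 := abs_le.1 (h5 (Complex.I • X))
  rw [I_norm] at e2
  unfold QD
  rw [abs_le]
  constructor <;> linarith

theorem QD_nonneg {T M : ℝ} {u φ : Cn n × ℝ → ℝ} (S : Sol Ω T M u φ) {p : Cn n}
    (hp : p ∈ closure Ω) {t : ℝ} (ht : t ∈ Ioo (0 : ℝ) T) (X : Cn n) : 0 ≤ QD Ω u (p, t) X := by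
  refine le_of_forall_pos_le_add fun ε hε => ?_
  obtain ⟨z, hz, h⟩ := QD_near S.ru hp ht (η := ε / (‖X‖ ^ 2 + 1)) (by positivity)
  obtain ⟨v, μ, k, F, H⟩ := S.frm hz ht
  have h1 := H.q_nonneg X
  rw [← QD_eq S.ru hz ht] at h1
  have h2 := (abs_le.1 (h X)).2
  have h3 : ε / (‖X‖ ^ 2 + 1) * ‖X‖ ^ 2 ≤ ε := by
    rw [div_mul_eq_mul_div, div_le_iff₀ (by positivity)]
    nlinarith
  linarith

theorem F1_bd {T M t0 C Λ : ℝ} (ht0 : 0 < t0) (hΛ : 0 < Λ)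
    {u φ : Cn n × ℝ → ℝ} (S : Sol Ω T M u φ)
    (hC : ∀ z ∈ Ω, ∀ t ∈ Ico t0 T, ∀ v μ k F, DFr M u (z, t) v μ k F →
      |∑ a, Real.log (4 * μ a)| ≤ C)
    {p : Cn n} (hp : p ∈ closure Ω) {t : ℝ} (ht : t ∈ Ico t0 T)
    (h : ∀ X, QD Ω u (p, t) X ≤ Λ * ‖X‖ ^ 2) (X : Cn n) :
    2 * Real.exp (-(C + n * |Real.log (4 / (Λ + 1))|)) * ‖X‖ ^ 2 ≤ QD Ω u (p, t) X := by
  have ht' : t ∈ Ioo (0 : ℝ) T := ⟨lt_of_lt_of_le ht0 ht.1, ht.2⟩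
  set E := Real.exp (-(C + n * |Real.log (4 / (Λ + 1))|)) with hE
  have hEp : 0 < E := Real.exp_pos _
  obtain ⟨z, hz, hn⟩ := QD_near S.ru hp ht' (η := min 1 E) (by positivity)
  obtain ⟨v, μ, k, F, H⟩ := S.frm hz ht'
  have h1 : ∀ Y, Qf u (z, t) Y Y ≤ (Λ + 1) * ‖Y‖ ^ 2 := by
    intro Y
    rw [← QD_eq S.ru hz ht']
    have e1 := (abs_le.1 (hn Y)).2
    have e2 : min 1 E * ‖Y‖ ^ 2 ≤ 1 * ‖Y‖ ^ 2 :=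
      mul_le_mul_of_nonneg_right (min_le_left _ _) (sq_nonneg _)
    linarith [h Y]
  have h2 := F1_int H (hC z hz t ht v μ k F H) (by linarith) h1 X
  rw [← QD_eq S.ru hz ht', ← hE] at h2
  have e1 := (abs_le.1 (hn X)).2
  have e2 : min 1 E * ‖X‖ ^ 2 ≤ E * ‖X‖ ^ 2 :=
    mul_le_mul_of_nonneg_right (min_le_right _ _) (sq_nonneg _)
  have e3 : 0 ≤ E * ‖X‖ ^ 2 := by positivity
  linarith

theorem F2_bd {T M t0 C c' : ℝ} (ht0 : 0 < t0) (hc : 0 < c')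
    {u φ : Cn n × ℝ → ℝ} (S : Sol Ω T M u φ)
    (hC : ∀ z ∈ Ω, ∀ t ∈ Ico t0 T, ∀ v μ k F, DFr M u (z, t) v μ k F →
      |∑ a, Real.log (4 * μ a)| ≤ C)
    {p : Cn n} (hp : p ∈ closure Ω) {t : ℝ} (ht : t ∈ Ico t0 T)
    (h : ∀ X, c' * ‖X‖ ^ 2 ≤ QD Ω u (p, t) X) (X : Cn n) :
    QD Ω u (p, t) X ≤ (4 * Real.exp (C + n * |Real.log (4 / (c' / 2))|) + c') * ‖X‖ ^ 2 := by
  have ht' : t ∈ Ioo (0 : ℝ) T := ⟨lt_of_lt_of_le ht0 ht.1, ht.2⟩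
  obtain ⟨z, hz, hn⟩ := QD_near S.ru hp ht' (η := c' / 2) (by positivity)
  obtain ⟨v, μ, k, F, H⟩ := S.frm hz ht'
  have h1 : ∀ Y, c' / 2 * ‖Y‖ ^ 2 ≤ Qf u (z, t) Y Y := by
    intro Y
    rw [← QD_eq S.ru hz ht']
    have e1 := (abs_le.1 (hn Y)).1
    linarith [h Y]
  have h2 := F2_int H (hC z hz t ht v μ k F H) (by linarith) h1 X
  rw [← QD_eq S.ru hz ht'] at h2
  have e1 := (abs_le.1 (hn X)).1
  have e3 : 0 ≤ c' * ‖X‖ ^ 2 := by positivity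
  linarith

end dnormal

section hess
variable {Ω : Set (Cn n)} {ρ : Cn n → ℝ} {c K : ℝ}

theorem D2phi_le {T M : ℝ} {u φ : Cn n × ℝ → ℝ} (S : Sol Ω T M u φ) {z : Cn n}
    (hz : z ∈ closure Ω) {t : ℝ} (ht : t ∈ Ioo (0 : ℝ) T) (X Y : Cn n) :
    |D2 Ω φ (z, t) X Y| ≤ M * (‖X‖ * ‖Y‖) := (S.bφ2 X Y).b0c z hz t ht

theorem hess_split [NeZero n] (D : Dom Ω ρ c K) (T M t0 : ℝ) (hT : 0 < T) (hM : 1 ≤ M)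
    (ht0 : 0 < t0) : ∃ C : ℝ, 1 ≤ C ∧
    ∀ u φ : Cn n × ℝ → ℝ, Sol Ω T M u φ → ∀ p ∈ frontier Ω, ∀ N : Cn n, ‖N‖ = 1 →
    c ≤ dd N ρ p → dd (Complex.I • N) ρ p = 0 → ∀ t ∈ Ico t0 T,
    (∀ τ τ', dd τ ρ p = 0 → dd τ' ρ p = 0 → |D2 Ω u (p, t) τ τ'| ≤ C * (‖τ‖ * ‖τ'‖)) ∧
    (∀ τ, dd τ ρ p = 0 → |D2 Ω u (p, t) N τ| ≤ C * ‖τ‖) := by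
  obtain ⟨A, hA1, hA⟩ := bgrad D T M t0 ht0
  obtain ⟨C, hC1, hC⟩ := mixed_bound D T M t0 hT hM ht0
  have hK := D.Kpos
  have hc := D.cpos
  refine ⟨K * A + C + M, by have : 0 ≤ K * A := by positivity
                            linarith, ?_⟩
  intro u φ S p hp N hN hcN hIN t ht
  have hpc := frontier_subset_closure hp
  have ht' : t ∈ Ioo (0 : ℝ) T := ⟨lt_of_lt_of_le ht0 ht.1, ht.2⟩
  have hN0 : 0 < dd N ρ p := by linarith
  constructor
  · intro τ τ' hτ hτ'
    have h1 := tang_tang D ht0 S (hA u φ S) hp ht N hτ' hτ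
    have h2 : |G2 Ω u φ (p, t) τ τ'| ≤ K * A * (‖τ‖ * ‖τ'‖) := by
      have e1 := Bd.abs_mul_le (D.b2 p τ τ') (hA u φ S p hp t ht N)
      rw [← h1, abs_mul, abs_of_pos hN0] at e1
      have e2 : dd N ρ p * |G2 Ω u φ (p, t) τ τ'| ≤ dd N ρ p * (K * A * (‖τ‖ * ‖τ'‖)) :=
        e1.trans (le_of_eq (by ring))
      exact le_of_mul_le_mul_left e2 hN0
    have h3 := abs_le.1 (D2phi_le S hpc ht' τ τ')
    have h4 := abs_le.1 h2
    unfold G2 at h4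
    have h5 : 0 ≤ C * (‖τ‖ * ‖τ'‖) := by positivity
    rw [abs_le]
    constructor <;> linarith
  · intro τ hτ
    have h2 : |G2 Ω u φ (p, t) N τ| ≤ C * ‖τ‖ := by
      rcases eq_or_ne τ 0 with h0 | h0
      · rw [h0]; simp [G2]
      · have hn : 0 < ‖τ‖ := norm_pos_iff.2 h0
        have e := hC u φ S p hp N (‖τ‖⁻¹ • τ) hN hcN hIN (by
          rw [norm_smul, norm_inv, norm_norm, inv_mul_cancel₀ hn.ne']) (by
          have := dd_lin ρ p ‖τ‖⁻¹ 0 τ 0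
          rw [hτ] at this; simpa using this) t ht
        have e2 : G2 Ω u φ (p, t) N (‖τ‖⁻¹ • τ) = ‖τ‖⁻¹ * G2 Ω u φ (p, t) N τ := by
          unfold G2; simp; ring
        rw [e2, abs_mul, abs_of_pos (inv_pos.2 hn), inv_mul_le_iff₀ hn] at e
        linarith
    have h3 := abs_le.1 (D2phi_le S hpc ht' N τ)
    have h4 := abs_le.1 h2
    unfold G2 at h4
    rw [hN, one_mul] at h3
    have h5 : 0 ≤ K * A * ‖τ‖ := by positivity
    rw [abs_le]
    constructor <;> linarith

theorem decomp_norm (D : Dom Ω ρ c K) {p N : Cn n} (hN : ‖N‖ = 1) (hcN : c ≤ dd N ρ p) (X : Cn n) :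
    |dd X ρ p / dd N ρ p| ≤ K / c * ‖X‖ ∧
    dd (X - (dd X ρ p / dd N ρ p) • N) ρ p = 0 ∧
    ‖X - (dd X ρ p / dd N ρ p) • N‖ ≤ (1 + K / c) * ‖X‖ := by
  have hc := D.cpos
  have hN0 : 0 < dd N ρ p := by linarith
  have h1 : |dd X ρ p / dd N ρ p| ≤ K / c * ‖X‖ := by
    rw [abs_div, abs_of_pos hN0, div_mul_eq_mul_div]
    have := D.Kpos
    exact div_le_div₀ (by positivity) (D.b1 p X) hc hcN
  refine ⟨h1, ?_, ?_⟩
  · have := dd_lin ρ p 1 (-(dd X ρ p / dd N ρ p)) X N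
    rw [one_smul, neg_smul, ← sub_eq_add_neg] at this
    rw [this]
    field_simp
    ring
  · refine (norm_sub_le _ _).trans ?_
    rw [norm_smul, hN, mul_one, Real.norm_eq_abs]
    linarith

theorem hess_NN [NeZero n] (D : Dom Ω ρ c K) (T M t0 : ℝ) (hT : 0 < T) (hM : 1 ≤ M)
    (ht0 : 0 < t0) : ∃ C : ℝ, 1 ≤ C ∧
    ∀ u φ : Cn n × ℝ → ℝ, Sol Ω T M u φ → ∀ p ∈ frontier Ω, ∀ N : Cn n, ‖N‖ = 1 →
    c ≤ dd N ρ p → dd (Complex.I • N) ρ p = 0 → ∀ t ∈ Ico t0 T, ∀ X,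
    ∃ y : ℝ, 0 ≤ y ∧ y ≤ C * ‖X‖ ^ 2 ∧
      |D2 Ω u (p, t) X X - y * D2 Ω u (p, t) N N| ≤ C * ‖X‖ ^ 2 := by
  obtain ⟨C, hC1, hC⟩ := hess_split D T M t0 hT hM ht0
  have hK := D.Kpos
  have hc := D.cpos
  set κ := 1 + K / c with hκ
  have hκ1 : 1 ≤ κ := by have : 0 ≤ K / c := by positivity
                         linarith
  have hκ2 : K / c ≤ κ := by linarith
  refine ⟨3 * C * κ ^ 2, ?_, ?_⟩
  · have : 1 ≤ κ ^ 2 := by nlinarith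
    nlinarith
  intro u φ S p hp N hN hcN hIN t ht X
  have hpc := frontier_subset_closure hp
  have ht' : t ∈ Ioo (0 : ℝ) T := ⟨lt_of_lt_of_le ht0 ht.1, ht.2⟩
  obtain ⟨h1, h2, h3⟩ := decomp_norm D hN hcN X
  set x := dd X ρ p / dd N ρ p with hx
  set τ := X - x • N with hτ
  obtain ⟨e1, e2⟩ := hC u φ S p hp N hN hcN hIN t ht
  have h1' : |x| ≤ κ * ‖X‖ := h1.trans (by gcongr)
  have hX : X = τ + x • N := by rw [hτ]; simp
  have hexp : D2 Ω u (p, t) X X = D2 Ω u (p, t) τ τ + 2 * (x * D2 Ω u (p, t) N τ) +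
      x ^ 2 * D2 Ω u (p, t) N N := by
    have hs := S.ru.symm p hpc t ht' τ N
    rw [hX]
    simp only [map_add, map_smul, ContinuousLinearMap.add_apply, ContinuousLinearMap.smul_apply,
      smul_eq_mul]
    rw [hs]; ring
  have hx2 : x ^ 2 ≤ κ ^ 2 * ‖X‖ ^ 2 := by
    have := sq_le_sq' (abs_le.1 h1').1 (abs_le.1 h1').2
    linarith [mul_pow κ ‖X‖ 2]
  have hpos : 0 ≤ κ ^ 2 * ‖X‖ ^ 2 := by positivity
  refine ⟨x ^ 2, sq_nonneg _, ?_, ?_⟩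
  · have : κ ^ 2 * ‖X‖ ^ 2 ≤ 3 * C * (κ ^ 2 * ‖X‖ ^ 2) := by nlinarith
    linarith
  · have f1 := e1 τ τ h2 h2
    have f2 := Bd.abs_mul_le h1' ((e2 τ h2).trans
      (mul_le_mul_of_nonneg_left h3 (by linarith)))
    have f3 : C * (‖τ‖ * ‖τ‖) ≤ C * ((κ * ‖X‖) * (κ * ‖X‖)) := by gcongr
    have f1' := abs_le.1 (f1.trans f3)
    have f2' := abs_le.1 f2
    rw [hexp, abs_le]
    constructor <;> linarith

/-- The Levi form of the defining function. -/
def QR (ρ : Cn n → ℝ) (z X : Cn n) : ℝ :=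
  dd X (dd X ρ) z + dd (Complex.I • X) (dd (Complex.I • X) ρ) z

theorem QR_le (D : Dom Ω ρ c K) (z X : Cn n) : QR ρ z X ≤ 2 * K * ‖X‖ ^ 2 := by
  have h1 := (abs_le.1 (D.b2 z X X)).2
  have h2 := (abs_le.1 (D.b2 z (Complex.I • X) (Complex.I • X))).2
  rw [I_norm] at h2
  unfold QR
  linarith

theorem QD_tang {T M A t0 : ℝ} (D : Dom Ω ρ c K) (ht0 : 0 < t0) {u φ : Cn n × ℝ → ℝ}
    (S : Sol Ω T M u φ)
    (hA : ∀ p ∈ frontier Ω, ∀ t ∈ Ico t0 T, ∀ X, |gd Ω u φ X (p, t)| ≤ A * |dd X ρ p|)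
    {p : Cn n} (hp : p ∈ frontier Ω) {t : ℝ} (ht : t ∈ Ico t0 T) (N : Cn n) {ξ : Cn n}
    (hξ : dd ξ ρ p = 0) (hIξ : dd (Complex.I • ξ) ρ p = 0) :
    dd N ρ p * QD Ω u (p, t) ξ = dd N ρ p * QD Ω φ (p, t) ξ + gd Ω u φ N (p, t) * QR ρ p ξ := by
  have h1 := tang_tang D ht0 S hA hp ht N hξ hξ
  have h2 := tang_tang D ht0 S hA hp ht N hIξ hIξ
  unfold G2 at h1 h2
  unfold QD QR
  linarith

theorem QDphi_le {T M : ℝ} {u φ : Cn n × ℝ → ℝ} (S : Sol Ω T M u φ) {z : Cn n}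
    (hz : z ∈ closure Ω) {t : ℝ} (ht : t ∈ Ioo (0 : ℝ) T) (X : Cn n) :
    |QD Ω φ (z, t) X| ≤ 2 * M * ‖X‖ ^ 2 := by
  have h1 := abs_le.1 (D2phi_le S hz ht X X)
  have h2 := abs_le.1 (D2phi_le S hz ht (Complex.I • X) (Complex.I • X))
  rw [I_norm] at h2
  unfold QD
  rw [abs_le]
  constructor <;> linarith

/-- Quadratic expressions in a moving frame are bounded. -/
theorem Bd_quad (hΩ : IsOpen Ω) {T k k1 : ℝ} (hk1 : 0 ≤ k1) (hk : 0 ≤ k)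
    {L : Cn n × ℝ → Cn n →L[ℝ] Cn n →L[ℝ] ℝ}
    (hL : ∀ X Y, Bd Ω T (k * (‖X‖ * ‖Y‖)) (fun q => L q X Y)) {α : Fin 4 → Cn n × ℝ → ℝ}
    (hα : ∀ j, Bd Ω T k1 (α j)) {e : Fin 4 → Cn n} (he : ∀ j, ‖e j‖ ≤ 1) :
    Bd Ω T (256 * k1 ^ 2 * k) (fun q => L q (∑ j, α j q • e j) (∑ j, α j q • e j)) := by
  have h1 : ∀ j l, Bd Ω T (16 * k1 ^ 2 * k) (fun q => α j q * α l q * L q (e j) (e l)) := by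
    intro j l
    refine (((hα j).mul (hα l)).mul (hL (e j) (e l))).mono ?_
    have : ‖e j‖ * ‖e l‖ ≤ 1 := mul_le_one₀ (he j) (norm_nonneg _) (he l)
    have h2 : k * (‖e j‖ * ‖e l‖) ≤ k := by nlinarith
    calc _ ≤ 4 * (4 * (k1 * k1) * k) := by gcongr
      _ = _ := by ring
  have h2 := Bd.sum Finset.univ (fun j _ => Bd.sum Finset.univ (fun l _ => h1 j l))
  refine (h2.congr hΩ fun z hz t ht => ?_).mono (le_of_eq ?_)
  · simp only [map_sum, map_smul, ContinuousLinearMap.sum_apply, ContinuousLinearMap.smul_apply,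
      smul_eq_mul, Finset.mul_sum]
    rw [Finset.sum_comm]
    refine Finset.sum_congr rfl fun j _ => Finset.sum_congr rfl fun l _ => ?_
    ring
  · simp; ring

end hess

section trud
variable {Ω : Set (Cn n)} {ρ : Cn n → ℝ} {c K : ℝ}

theorem QR_clm (D : Dom Ω ρ c K) (z X : Cn n) : QR ρ z X = fderiv ℝ (fderiv ℝ ρ) z X X +
    fderiv ℝ (fderiv ℝ ρ) z (Complex.I • X) (Complex.I • X) := by
  unfold QR
  rw [dd2_eq (D.Sm z), dd2_eq (D.Sm z)]

theorem QR_smul (D : Dom Ω ρ c K) (z X : Cn n) (r : ℝ) : QR ρ z (r • X) = r ^ 2 * QR ρ z X := by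
  rw [QR_clm D, QR_clm D, smul_comm Complex.I r X]
  simp only [map_smul, ContinuousLinearMap.smul_apply, smul_eq_mul]
  ring

theorem QD_smul (u : Cn n × ℝ → ℝ) (q : Cn n × ℝ) (X : Cn n) (r : ℝ) :
    QD Ω u q (r • X) = r ^ 2 * QD Ω u q X := by
  unfold QD
  rw [smul_comm Complex.I r X]
  simp only [map_smul, ContinuousLinearMap.smul_apply, smul_eq_mul]
  ring

theorem dd_smul_v {G : Type*} [NormedAddCommGroup G] [NormedSpace ℝ G] (h : G → ℝ) (z : G) (r : ℝ)
    (X : G) : dd (r • X) h z = r * dd X h z := by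
  unfold dd; simp

set_option maxHeartbeats 1600000 in
theorem dn_core [NeZero n] (D : Dom Ω ρ c K) (T M ε m0 : ℝ) (hT : 0 < T) (hM : 1 ≤ M)
    (hε : 0 < ε) (hm0 : 0 ≤ m0) : ∃ C : ℝ, 1 ≤ C ∧
    ∀ u φ : Cn n × ℝ → ℝ, Sol Ω T M u φ → ∀ s, 0 ≤ s → s < T → ∀ m, |m| ≤ m0 →
    ∀ p ∈ frontier Ω, ∀ ξ : Cn n, ‖ξ‖ = 1 → dd ξ ρ p = 0 → dd (Complex.I • ξ) ρ p = 0 →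
    ∀ N : Cn n, ‖N‖ = 1 → c ≤ dd N ρ p → dd (Complex.I • N) ρ p = 0 →
    ∀ ts, ε / 2 + ε / 4 ≤ ts → ts ≤ s →
    (∀ z ∈ frontier Ω, ∀ t ∈ Icc (ε / 2) s, ∀ ζ, dd ζ ρ z = 0 → dd (Complex.I • ζ) ρ z = 0 →
      0 ≤ QD Ω u (z, t) ζ + ((s - t) - m) * QR ρ z ζ) →
    QD Ω u (p, ts) ξ + ((s - ts) - m) * QR ρ p ξ = 0 →
    G2 Ω u φ (p, ts) N N ≤ C := by
  have hK := D.Kpos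
  have hc := D.cpos
  obtain ⟨A, hA1, hA⟩ := bgrad D T M (ε / 2) (by linarith)
  set kR := 256 * (4 * K) ^ 2 * K + 256 * (4 * K) ^ 2 * K with hkR
  set kφ := 256 * (4 * K) ^ 2 * M + 256 * (4 * K) ^ 2 * M with hkφ
  have hkRp : 0 ≤ kR := by positivity
  have hkφp : 0 ≤ kφ := by positivity
  set kb := 4 * (K * (kφ + 4 * ((T + T + 1 + m0) * kR))) with hkb
  have hkbp : 0 ≤ kb := by positivity
  obtain ⟨C, hC1, hC⟩ := barrier_lem D T M (ε / 2) (ε / 4) (c / (2 * K)) (1 + kR + kb) hT hM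
    (by linarith) (by linarith) (by positivity) (by linarith)
  refine ⟨C / c ^ 3 + 1, by have : 0 ≤ C / c ^ 3 := by positivity
                            linarith, ?_⟩
  intro u φ S s hs0 hsT m hm p hp ξ hξ1 hξ hIξ N hN hcN hIN ts hts1 hts2 hmin h0
  have hpc := frontier_subset_closure hp
  set e : Fin 4 → Cn n := ![ξ, Complex.I • ξ, N, Complex.I • N] with he
  set α : Fin 4 → Cn n × ℝ → ℝ := ![fun q => dd N ρ q.1, fun q => (-1) * dd (Complex.I • N) ρ q.1,
    fun q => (-1) * dd ξ ρ q.1, fun q => dd (Complex.I • ξ) ρ q.1] with hα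
  have he1 : ∀ j, ‖e j‖ ≤ 1 := by
    intro j
    fin_cases j
    · exact hξ1.le
    · exact (I_norm ξ).trans_le hξ1.le
    · exact hN.le
    · exact (I_norm N).trans_le hN.le
  have heI : ∀ j, ‖Complex.I • e j‖ ≤ 1 := fun j => (I_norm _).trans_le (he1 j)
  have hbd1 : ∀ X : Cn n, ‖X‖ ≤ 1 → Bd Ω T K (fun q => dd X ρ q.1) := fun X hX =>
    (D.bd1 T X).mono (by nlinarith)
  have hαB : ∀ j, Bd Ω T (4 * K) (α j) := by
    intro j
    fin_cases j
    · exact (hbd1 N hN.le).mono (by linarith)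
    · exact ((hbd1 _ ((I_norm N).trans_le hN.le)).cmul (-1)).mono (by simp)
    · exact ((hbd1 _ hξ1.le).cmul (-1)).mono (by simp)
    · exact (hbd1 _ ((I_norm ξ).trans_le hξ1.le)).mono (by linarith)
  set V : Cn n × ℝ → Cn n := fun q => ∑ j, α j q • e j with hV
  have hIV : ∀ q, Complex.I • V q = ∑ j, α j q • (Complex.I • e j) := by
    intro q
    rw [hV]
    simp only [Finset.smul_sum]
    exact Finset.sum_congr rfl fun j _ => smul_comm _ _ _
  have hVe : ∀ q, V q = dd N ρ q.1 • ξ + (-1 * dd (Complex.I • N) ρ q.1) • (Complex.I • ξ) +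
      (-1 * dd ξ ρ q.1) • N + dd (Complex.I • ξ) ρ q.1 • (Complex.I • N) := by
    intro q
    rw [hV]
    simp only [Fin.sum_univ_four]
    rfl
  have hVt : ∀ q, dd (V q) ρ q.1 = 0 := by
    intro q
    rw [hVe]
    unfold dd
    simp only [map_add, map_smul, smul_eq_mul]
    ring
  have hVIt : ∀ q, dd (Complex.I • V q) ρ q.1 = 0 := by
    intro q
    rw [hVe]
    simp only [smul_add, smul_comm Complex.I (_ : ℝ) (_ : Cn n), I_I_smul]
    unfold dd
    simp only [map_add, map_smul, smul_eq_mul, map_neg]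
    ring
  have hVp : ∀ t, V (p, t) = dd N ρ p • ξ := by
    intro t
    rw [hVe]
    change dd N ρ p • ξ + (-1 * dd (Complex.I • N) ρ p) • (Complex.I • ξ) +
      (-1 * dd ξ ρ p) • N + dd (Complex.I • ξ) ρ p • (Complex.I • N) = _
    rw [hIN, hξ, hIξ]
    simp
  have hLρ : ∀ X Y : Cn n, Bd Ω T (K * (‖X‖ * ‖Y‖)) (fun q => fderiv ℝ (fderiv ℝ ρ) q.1 X Y) :=
    fun X Y => (D.bd2 T X Y).congr D.op fun z _ t _ => (dd2_eq (D.Sm z) X Y).symm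
  have hBR : Bd Ω T kR (fun q => QR ρ q.1 (V q)) := by
    refine ((Bd_quad D.op (by positivity) (by positivity) hLρ hαB he1).add
      (Bd_quad D.op (by positivity) (by positivity) hLρ hαB heI)).congr D.op fun z _ t _ => ?_
    rw [QR_clm D, hIV]
  have hBφ : Bd Ω T kφ (fun q => QD Ω φ q (V q)) := by
    refine ((Bd_quad D.op (by positivity) (by positivity) S.bφ2 hαB he1).add
      (Bd_quad D.op (by positivity) (by positivity) S.bφ2 hαB heI)).congr D.op fun z _ t _ => ?_
    unfold QD
    rw [hIV]
  set b : Cn n × ℝ → ℝ := fun q => dd N ρ q.1 * (QD Ω φ q (V q) +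
    ((s - q.2) + (-m)) * QR ρ q.1 (V q)) with hb
  have hBb : Bd Ω T kb b := by
    have htm : Bd Ω T (T + T + 1 + m0) (fun q : Cn n × ℝ => (s - q.2) + (-m)) :=
      ((Bd_time Ω T s hs0 hT).add (Bd.const Ω T (-m))).mono (by rw [abs_neg]; linarith)
    exact (hbd1 N hN.le).mul (hBφ.add (htm.mul hBR))
  have hPsi : ∀ z ∈ frontier Ω, ∀ t ∈ Ico (ε / 2) T,
      Psi Ω u φ (fun _ => 0) (fun q => QR ρ q.1 (V q)) b 0 N (z, t) =
      dd N ρ z * (QD Ω u (z, t) (V (z, t)) + ((s - t) - m) * QR ρ z (V (z, t))) := by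
    intro z hz t ht
    have := QD_tang D (by linarith) S (hA u φ S) hz ht N (hVt (z, t)) (hVIt (z, t))
    unfold Psi
    rw [hb]
    dsimp only at this ⊢
    linarith
  have main := hC u φ S p hp N 0 hN hcN hIN (by simp) (by simp [dd]) (fun _ => 0)
    (fun q => QR ρ q.1 (V q)) b ((Bd.const Ω T 0).mono (by rw [abs_zero]; linarith))
    (hBR.mono (by linarith)) (hBb.mono (by linarith)) ts hts1 (by linarith) ?_ ?_
  · dsimp only at main
    rw [hVp, QR_smul D] at main
    have e1 : c ≤ QR ρ p ξ := by
      have := D.psh p hpc ξ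
      rw [hξ1] at this
      unfold QR
      linarith
    have e2 : c ^ 3 ≤ dd N ρ p ^ 2 * QR ρ p ξ := by
      have : c ^ 2 ≤ dd N ρ p ^ 2 := by gcongr
      calc c ^ 3 = c ^ 2 * c := by ring
        _ ≤ _ := by gcongr
    rcases le_or_gt (G2 Ω u φ (p, ts) N N) 0 with hg | hg
    · have : 0 ≤ C / c ^ 3 := by positivity
      linarith
    · have e3 := mul_le_mul_of_nonneg_right e2 hg.le
      have e4 : G2 Ω u φ (p, ts) N N ≤ C / c ^ 3 := by
        rw [le_div_iff₀ (by positivity)]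
        linarith
      linarith
  · intro z hz hd t ht
    rw [hPsi z hz t ⟨ht.1, by linarith [ht.2]⟩]
    refine mul_nonneg ?_ (hmin z hz t ⟨ht.1, by linarith [ht.2]⟩ _ (hVt (z, t)) (hVIt (z, t)))
    have h1 := (abs_le.1 (D.lip N z p)).1
    rw [hN, mul_one, ← dist_eq_norm] at h1
    have h2 : K * dist z p ≤ K * (c / (2 * K)) := by gcongr
    have h3 : K * (c / (2 * K)) = c / 2 := by field_simp
    linarith
  · rw [hPsi p hp ts ⟨by linarith, by linarith⟩, hVp, QD_smul, QR_smul D]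
    have : dd N ρ p * (dd N ρ p ^ 2 * QD Ω u (p, ts) ξ + (s - ts - m) * (dd N ρ p ^ 2 * QR ρ p ξ)) =
      dd N ρ p ^ 3 * (QD Ω u (p, ts) ξ + ((s - ts) - m) * QR ρ p ξ) := by ring
    rw [this, h0, mul_zero]

end trud

section
variable {Ω : Set (Cn n)} {ρ : Cn n → ℝ} {c K : ℝ}

theorem QR_ge (D : Dom Ω ρ c K) {z : Cn n} (hz : z ∈ closure Ω) (X : Cn n) :
    c * ‖X‖ ^ 2 ≤ QR ρ z X := D.psh z hz X

theorem D2_cont {T M : ℝ} {u φ : Cn n × ℝ → ℝ} (S : Sol Ω T M u φ)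
    {Y : Type*} [TopologicalSpace Y] {s : Set Y} {a : Y → Cn n × ℝ} {b b' : Y → Cn n}
    (ha : ContinuousOn a s) (hb : ContinuousOn b s) (hb' : ContinuousOn b' s)
    (hm : MapsTo a s (closure Ω ×ˢ Ioo (0 : ℝ) T)) :
    ContinuousOn (fun y => D2 Ω u (a y) (b y) (b' y)) s :=
  ((S.ru.c2.comp ha hm).clm_apply hb).clm_apply hb'

theorem QR_cont (D : Dom Ω ρ c K) : Continuous (fun y : Cn n × Cn n => QR ρ y.1 y.2) := by
  have h1 : Continuous (fderiv ℝ (fderiv ℝ ρ)) := by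
    have h2 : ContDiff ℝ (⊤ : ℕ∞) (fderiv ℝ ρ) := D.sm.fderiv_right (by simp)
    exact h2.continuous_fderiv (by simp)
  have h3 : Continuous (fun y : Cn n × Cn n => Complex.I • y.2) :=
    (continuous_const_smul Complex.I).comp continuous_snd
  have e : (fun y : Cn n × Cn n => QR ρ y.1 y.2) = fun y => fderiv ℝ (fderiv ℝ ρ) y.1 y.2 y.2 +
    fderiv ℝ (fderiv ℝ ρ) y.1 (Complex.I • y.2) (Complex.I • y.2) := by
    funext y
    exact QR_clm D y.1 y.2
  rw [e]
  have h4 := h1.comp (continuous_fst (X := Cn n) (Y := Cn n))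
  exact ((h4.clm_apply continuous_snd).clm_apply continuous_snd).add
    ((h4.clm_apply h3).clm_apply h3)

theorem ddρ_cont (D : Dom Ω ρ c K) : Continuous (fun y : Cn n × Cn n => dd y.2 ρ y.1) := by
  have h1 : Continuous (fderiv ℝ ρ) := D.sm.continuous_fderiv (by simp)
  exact (h1.comp continuous_fst).clm_apply continuous_snd

theorem tang_min {T M : ℝ} (D : Dom Ω ρ c K) {u φ : Cn n × ℝ → ℝ} (S : Sol Ω T M u φ) {a s : ℝ}
    (ha : 0 < a) (has : a ≤ s) (hs : s < T) {p0 ξ0 : Cn n} (hp0 : p0 ∈ frontier Ω)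
    (hξ0 : ‖ξ0‖ = 1) (h0 : dd ξ0 ρ p0 = 0) (h0' : dd (Complex.I • ξ0) ρ p0 = 0) :
    ∃ m : ℝ, m * QR ρ p0 ξ0 ≤ QD Ω u (p0, s) ξ0 ∧
    (∀ z ∈ frontier Ω, ∀ t ∈ Icc a s, ∀ ζ, dd ζ ρ z = 0 → dd (Complex.I • ζ) ρ z = 0 →
      0 ≤ QD Ω u (z, t) ζ + ((s - t) - m) * QR ρ z ζ) ∧
    ∃ p ∈ frontier Ω, ∃ ξ, ‖ξ‖ = 1 ∧ dd ξ ρ p = 0 ∧ dd (Complex.I • ξ) ρ p = 0 ∧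
    ∃ ts ∈ Icc a s, QD Ω u (p, ts) ξ + ((s - ts) - m) * QR ρ p ξ = 0 := by
  have hcpos := D.cpos
  have hQ : ∀ z ∈ frontier Ω, ∀ ζ : Cn n, ‖ζ‖ = 1 → 0 < QR ρ z ζ := by
    intro z hz ζ hζ
    have := QR_ge D (frontier_subset_closure hz) ζ
    rw [hζ] at this
    linarith
  have hfc : IsCompact (frontier Ω) :=
    Metric.isCompact_of_isClosed_isBounded isClosed_frontier
      (D.bdd.closure.subset frontier_subset_closure)
  set B : Set ((Cn n × Cn n) × ℝ) := ((frontier Ω ×ˢ sphere (0 : Cn n) 1) ×ˢ Icc a s) ∩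
    {q | dd q.1.2 ρ q.1.1 = 0 ∧ dd (Complex.I • q.1.2) ρ q.1.1 = 0} with hB
  have hBc : IsCompact B := by
    refine IsCompact.inter_right ((hfc.prod (isCompact_sphere _ _)).prod isCompact_Icc) ?_
    refine IsClosed.inter ?_ ?_
    · exact isClosed_eq ((ddρ_cont D).comp continuous_fst) continuous_const
    · refine isClosed_eq ((ddρ_cont D).comp (g := fun y : Cn n × Cn n => dd y.2 ρ y.1)
        (f := fun q : (Cn n × Cn n) × ℝ => (q.1.1, Complex.I • q.1.2)) ?_) continuous_const
      exact (continuous_fst.comp continuous_fst).prodMk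
        ((continuous_const_smul Complex.I).comp (continuous_snd.comp continuous_fst))
  have hm0 : ((p0, ξ0), s) ∈ B := ⟨⟨⟨hp0, by simpa using hξ0⟩, ⟨has, le_rfl⟩⟩, h0, h0'⟩
  set g : (Cn n × Cn n) × ℝ → ℝ := fun q => QD Ω u (q.1.1, q.2) q.1.2 / QR ρ q.1.1 q.1.2 + (s - q.2)
    with hg
  have hBn : ∀ q ∈ B, q.1.1 ∈ frontier Ω ∧ ‖q.1.2‖ = 1 ∧ q.2 ∈ Icc a s := by
    intro q hq
    exact ⟨hq.1.1.1, by simpa using hq.1.1.2, hq.1.2⟩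
  have hgc : ContinuousOn g B := by
    have k1 : Continuous (fun q : (Cn n × Cn n) × ℝ => (q.1.1, q.2)) :=
      (continuous_fst.comp continuous_fst).prodMk continuous_snd
    have k2 : Continuous (fun q : (Cn n × Cn n) × ℝ => q.1.2) := continuous_snd.comp continuous_fst
    have k3 : Continuous (fun q : (Cn n × Cn n) × ℝ => Complex.I • q.1.2) :=
      (continuous_const_smul Complex.I).comp k2
    have k4 : MapsTo (fun q : (Cn n × Cn n) × ℝ => (q.1.1, q.2)) B (closure Ω ×ˢ Ioo (0 : ℝ) T) := by
      intro q hq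
      obtain ⟨b1, -, b3⟩ := hBn q hq
      exact ⟨frontier_subset_closure b1, lt_of_lt_of_le ha b3.1, lt_of_le_of_lt b3.2 hs⟩
    refine ContinuousOn.add (ContinuousOn.div ?_ ?_ ?_) ?_
    · exact (D2_cont S k1.continuousOn k2.continuousOn k2.continuousOn k4).add
        (D2_cont S k1.continuousOn k3.continuousOn k3.continuousOn k4)
    · exact ((QR_cont D).comp continuous_fst).continuousOn
    · intro q hq
      obtain ⟨b1, b2, b3⟩ := hBn q hq
      exact (hQ _ b1 _ b2).ne'
    · exact (continuous_const.sub continuous_snd).continuousOn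
  obtain ⟨q, hq, hmin⟩ := hBc.exists_isMinOn ⟨_, hm0⟩ hgc
  have hmin' : ∀ z ∈ frontier Ω, ∀ t ∈ Icc a s, ∀ ζ, ‖ζ‖ = 1 → dd ζ ρ z = 0 →
      dd (Complex.I • ζ) ρ z = 0 → 0 ≤ QD Ω u (z, t) ζ + ((s - t) - g q) * QR ρ z ζ := by
    intro z hz t ht ζ hζ h1 h2
    have hin : ((z, ζ), t) ∈ B := ⟨⟨⟨hz, by simpa using hζ⟩, ht⟩, h1, h2⟩
    have h3 : g q ≤ QD Ω u (z, t) ζ / QR ρ z ζ + (s - t) := hmin hin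
    have h4 := hQ z hz ζ hζ
    have h5 : (g q - (s - t)) * QR ρ z ζ ≤ QD Ω u (z, t) ζ := by
      rw [← le_div_iff₀ h4]
      linarith
    linarith
  refine ⟨g q, ?_, ?_, ?_⟩
  · have := hmin' p0 hp0 s ⟨has, le_rfl⟩ ξ0 hξ0 h0 h0'
    linarith
  · intro z hz t ht ζ h1 h2
    by_cases hζ : ζ = 0
    · subst hζ
      have e1 := QD_smul (Ω := Ω) u (z, t) 0 0
      have e2 := QR_smul D z 0 0
      simp only [zero_smul] at e1 e2
      rw [e1, e2]
      simp
    · have hr : 0 < ‖ζ‖ := norm_pos_iff.2 hζ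
      set ζ' := ‖ζ‖⁻¹ • ζ with hζ'
      have e0 : ζ = ‖ζ‖ • ζ' := by rw [hζ', smul_smul, mul_inv_cancel₀ hr.ne', one_smul]
      have e1 : ‖ζ'‖ = 1 := by rw [hζ', norm_smul, norm_inv, norm_norm, inv_mul_cancel₀ hr.ne']
      have e2 : dd ζ' ρ z = 0 := by rw [hζ', dd_smul_v, h1, mul_zero]
      have e3 : dd (Complex.I • ζ') ρ z = 0 := by
        rw [hζ', smul_comm, dd_smul_v, h2, mul_zero]
      have e4 := hmin' z hz t ht ζ' e1 e2 e3
      rw [e0, QD_smul, QR_smul D]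
      have : 0 ≤ ‖ζ‖ ^ 2 * (QD Ω u (z, t) ζ' + ((s - t) - g q) * QR ρ z ζ') := by positivity
      linarith
  · obtain ⟨b1, b2, b3⟩ := hBn q hq
    refine ⟨q.1.1, b1, q.1.2, b2, hq.2.1, hq.2.2, q.2, b3, ?_⟩
    have h4 := (hQ _ b1 _ b2).ne'
    simp only [hg]
    field_simp
    ring

set_option maxHeartbeats 1600000 in
theorem tang_lower [NeZero n] (D : Dom Ω ρ c K) (T M ε : ℝ) (hT : 0 < T) (hM : 1 ≤ M)
    (hε : 0 < ε) : ∃ c' : ℝ, 0 < c' ∧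
    ∀ u φ : Cn n × ℝ → ℝ, Sol Ω T M u φ → ∀ p ∈ frontier Ω, ∀ s ∈ Ico ε T,
    ∀ ξ : Cn n, dd ξ ρ p = 0 → dd (Complex.I • ξ) ρ p = 0 →
    c' * ‖ξ‖ ^ 2 ≤ QD Ω u (p, s) ξ := by
  have hK := D.Kpos
  have hc := D.cpos
  have hε2 : 0 < ε / 2 := by linarith
  obtain ⟨A, hA1, hA⟩ := bgrad D T M (ε / 2) hε2
  obtain ⟨C1, hC11, hC1⟩ := logdet_bound D T M (ε / 2) hε2
  have hm00 : 0 ≤ 2 * M / c + A := by positivity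
  obtain ⟨C2, hC21, hC2⟩ := dn_core D T M ε (2 * M / c + A) hT hM hε hm00
  obtain ⟨C3, hC31, hC3⟩ := hess_NN D T M (ε / 2) hT hM hε2
  set Λ := 2 * (C3 * (C2 + M + 1)) with hΛ
  have hΛ0 : 0 < Λ := by positivity
  set lam := 2 * Real.exp (-(C1 + n * |Real.log (4 / (Λ + 1))|)) with hlam
  have hlam0 : 0 < lam := by positivity
  set m1 := min (ε / 4) (lam / (2 * K)) with hm1
  have hm10 : 0 < m1 := lt_min (by linarith) (by positivity)
  refine ⟨m1 * c, by positivity, ?_⟩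
  intro u φ S
  have key : ∀ p ∈ frontier Ω, ∀ s ∈ Ico ε T, ∀ ξ : Cn n, ‖ξ‖ = 1 → dd ξ ρ p = 0 →
      dd (Complex.I • ξ) ρ p = 0 → m1 * c ≤ QD Ω u (p, s) ξ := by
    intro p0 hp0 s hs ξ0 hξ0 h0 h0'
    obtain ⟨m, hm, hmin, p, hp, ξ, hξ, h1, h2, ts, hts, heq⟩ :=
      tang_min D S hε2 (by linarith [hs.1] : ε / 2 ≤ s) hs.2 hp0 hξ0 h0 h0'
    have htsT : ts < T := lt_of_le_of_lt hts.2 hs.2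
    have hts0 : ts ∈ Ioo (0 : ℝ) T := ⟨by linarith [hts.1], htsT⟩
    have hts1 : ts ∈ Ico (ε / 2) T := ⟨hts.1, htsT⟩
    have hpc := frontier_subset_closure hp
    have hQ0 : c ≤ QR ρ p0 ξ0 := by
      have := QR_ge D (frontier_subset_closure hp0) ξ0
      rw [hξ0] at this
      linarith
    have hQ1 : c ≤ QR ρ p ξ := by
      have := QR_ge D hpc ξ
      rw [hξ] at this
      linarith
    have hQ2 : QR ρ p ξ ≤ 2 * K := by
      have := QR_le D p ξ
      rw [hξ] at this
      linarith
    have hqn := QD_nonneg S hpc hts0 ξ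
    have hm_nn : 0 ≤ m := by
      by_contra hneg
      push Not at hneg
      have : 0 < ((s - ts) - m) * QR ρ p ξ := mul_pos (by linarith [hts.2]) (by linarith)
      linarith
    have hm_le : m ≤ 2 * M / c + A := by
      obtain ⟨N, hN, hcN, hIN⟩ := D.nor p0 hp0
      have hs1 : s ∈ Ico (ε / 2) T := ⟨by linarith [hs.1], hs.2⟩
      have hs0 : s ∈ Ioo (0 : ℝ) T := ⟨by linarith [hs.1], hs.2⟩
      have e1 := QD_tang D hε2 S (hA u φ S) hp0 hs1 N h0 h0'
      have e2 := (abs_le.1 (QDphi_le S (frontier_subset_closure hp0) hs0 ξ0)).2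
      have e3 := (abs_le.1 (hA u φ S p0 hp0 s hs1 N)).2
      have hNp : 0 < dd N ρ p0 := by linarith
      rw [abs_of_pos hNp] at e3
      rw [hξ0] at e2
      have e4 : dd N ρ p0 * QD Ω u (p0, s) ξ0 ≤ dd N ρ p0 * (2 * M + A * QR ρ p0 ξ0) := by
        rw [e1]
        have := mul_le_mul_of_nonneg_right e3 (by linarith : 0 ≤ QR ρ p0 ξ0)
        have := mul_le_mul_of_nonneg_left e2 hNp.le
        linarith
      have e5 := le_of_mul_le_mul_left e4 hNp
      have e6 : (m - A) * QR ρ p0 ξ0 ≤ 2 * M := by linarith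
      by_contra hcon
      push Not at hcon
      have e7 : 2 * M / c < m - A := by linarith
      rw [div_lt_iff₀ hc] at e7
      have e8 : 0 ≤ m - A := by
        have : 0 ≤ 2 * M / c := by positivity
        linarith
      have := mul_le_mul_of_nonneg_left hQ0 e8
      linarith
    have hm1m : m1 ≤ m := by
      by_cases hcase : ts < ε / 2 + ε / 4
      · have : ε / 4 ≤ m := by
          by_contra hneg
          push Not at hneg
          have : 0 < ((s - ts) - m) * QR ρ p ξ := mul_pos (by linarith [hs.1]) (by linarith)
          linarith
        exact (min_le_left _ _).trans this
      · push Not at hcase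
        obtain ⟨N, hN, hcN, hIN⟩ := D.nor p hp
        have g1 := hC2 u φ S s (by linarith [hs.1]) hs.2 m (by rw [abs_of_nonneg hm_nn]; exact hm_le)
          p hp ξ hξ h1 h2 N hN hcN hIN ts hcase hts.2 hmin heq
        have g2 := (abs_le.1 (D2phi_le S hpc hts0 N N)).2
        rw [hN] at g2
        have g3 : D2 Ω u (p, ts) N N ≤ C2 + M := by
          unfold G2 at g1
          linarith
        have g4 : ∀ X, D2 Ω u (p, ts) X X ≤ C3 * (C2 + M + 1) * ‖X‖ ^ 2 := by
          intro X
          obtain ⟨y, hy0, hy1, hy2⟩ := hC3 u φ S p hp N hN hcN hIN ts hts1 X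
          have := (abs_le.1 hy2).2
          have t1 := mul_le_mul_of_nonneg_left g3 hy0
          have t2 := mul_le_mul_of_nonneg_right hy1 (by linarith : 0 ≤ C2 + M)
          linarith
        have g5 : ∀ X, QD Ω u (p, ts) X ≤ Λ * ‖X‖ ^ 2 := by
          intro X
          have t1 := g4 X
          have t2 := g4 (Complex.I • X)
          rw [I_norm] at t2
          unfold QD
          rw [hΛ]
          linarith
        have g6 := F1_bd hε2 hΛ0 S (fun z hz t ht v μ k F H => ((hC1 u φ S).2 z hz t ht v μ k F H).1)
          hpc hts1 g5 ξ
        rw [hξ, ← hlam] at g6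
        have g7 : lam ≤ m * QR ρ p ξ := by
          have : 0 ≤ (s - ts) * QR ρ p ξ := mul_nonneg (by linarith [hts.2]) (by linarith)
          linarith
        have g8 : m * QR ρ p ξ ≤ m * (2 * K) := mul_le_mul_of_nonneg_left hQ2 hm_nn
        refine (min_le_right _ _).trans ?_
        rw [div_le_iff₀ (by positivity)]
        linarith
    have f1 : m1 * c ≤ m * QR ρ p0 ξ0 := mul_le_mul hm1m hQ0 hc.le hm_nn
    linarith
  intro p hp s hs ζ h1 h2
  by_cases hζ : ζ = 0
  · subst hζ
    have e1 := QD_smul (Ω := Ω) u (p, s) 0 0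
    simp only [zero_smul] at e1
    rw [e1]
    simp
  · have hr : 0 < ‖ζ‖ := norm_pos_iff.2 hζ
    set ζ' := ‖ζ‖⁻¹ • ζ with hζ'
    have e0 : ζ = ‖ζ‖ • ζ' := by rw [hζ', smul_smul, mul_inv_cancel₀ hr.ne', one_smul]
    have e1 : ‖ζ'‖ = 1 := by rw [hζ', norm_smul, norm_inv, norm_norm, inv_mul_cancel₀ hr.ne']
    have e2 : dd ζ' ρ p = 0 := by rw [hζ', dd_smul_v, h1, mul_zero]
    have e3 : dd (Complex.I • ζ') ρ p = 0 := by
      rw [hζ', smul_comm, dd_smul_v, h2, mul_zero]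
    have e4 := key p hp s hs ζ' e1 e2 e3
    have e5 : QD Ω u (p, s) ζ = ‖ζ‖ ^ 2 * QD Ω u (p, s) ζ' := by
      conv_lhs => rw [e0]
      rw [QD_smul]
    rw [e5]
    have := mul_le_mul_of_nonneg_left e4 (sq_nonneg ‖ζ‖)
    linarith

end

section
variable {Ω : Set (Cn n)} {ρ : Cn n → ℝ} {c K : ℝ}

theorem nb_scalar {c' C H r x y X : ℝ} (hc' : 0 < c')
    (hH : 16 * C ^ 2 / c' + c' / 2 ≤ H) (hX : 0 ≤ X) (hXr : X ≤ r + |x| + |y|)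
    {Q q a b : ℝ} (hq : c' * r ^ 2 ≤ q) (ha : |a| ≤ 2 * C * r) (hb : |b| ≤ 2 * C * r)
    (hQ : Q = q + 2 * x * a + 2 * y * b + (x ^ 2 + y ^ 2) * H) : c' / 6 * X ^ 2 ≤ Q := by
  have h1 : ∀ x a : ℝ, |a| ≤ 2 * C * r →
      -(c' / 4 * r ^ 2 + 16 * C ^ 2 / c' * x ^ 2) ≤ 2 * x * a := by
    intro x a ha
    have e1 : |2 * x * a| ≤ 2 * |x| * (2 * C * r) := by
      rw [abs_mul, abs_mul, abs_two]
      gcongr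
    have e2 : 2 * |x| * (2 * C * r) ≤ c' / 4 * r ^ 2 + 16 * C ^ 2 / c' * x ^ 2 := by
      have : c' / 4 * r ^ 2 + 16 * C ^ 2 / c' * x ^ 2 - 2 * |x| * (2 * C * r)
          = (c' * r / 2 - 4 * C * |x|) ^ 2 / c' := by
        have : x ^ 2 = |x| ^ 2 := (sq_abs x).symm
        rw [this]
        field_simp
        ring
      have h0 : 0 ≤ (c' * r / 2 - 4 * C * |x|) ^ 2 / c' := by positivity
      linarith
    have := (abs_le.1 e1).1
    linarith
  have h2 := h1 x a ha
  have h3 := h1 y b hb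
  have h4 := mul_le_mul_of_nonneg_left hH (by positivity : 0 ≤ x ^ 2 + y ^ 2)
  have h5 : X ^ 2 ≤ 3 * (r ^ 2 + x ^ 2 + y ^ 2) := by
    have e1 : X ^ 2 ≤ (r + |x| + |y|) ^ 2 := pow_le_pow_left₀ hX hXr 2
    rw [← sq_abs x, ← sq_abs y]
    nlinarith [sq_nonneg (r - |x|), sq_nonneg (r - |y|), sq_nonneg (|x| - |y|)]
  have h6 := mul_le_mul_of_nonneg_left h5 (by positivity : 0 ≤ c' / 6)
  rw [hQ]
  linarith

set_option maxHeartbeats 1600000 in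
theorem normal_bound [NeZero n] (D : Dom Ω ρ c K) (T M ε : ℝ) (hT : 0 < T) (hM : 1 ≤ M)
    (hε : 0 < ε) : ∃ C : ℝ, 1 ≤ C ∧
    ∀ u φ : Cn n × ℝ → ℝ, Sol Ω T M u φ → ∀ p ∈ frontier Ω, ∀ N : Cn n, ‖N‖ = 1 →
    c ≤ dd N ρ p → dd (Complex.I • N) ρ p = 0 → ∀ t ∈ Ico ε T,
    |D2 Ω u (p, t) N N| ≤ C := by
  have hc := D.cpos
  obtain ⟨c', hc'0, hc'⟩ := tang_lower D T M ε hT hM hε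
  obtain ⟨C1, hC11, hC1⟩ := logdet_bound D T M ε hε
  obtain ⟨C, hC01, hC⟩ := hess_split D T M ε hT hM hε
  set H0 := 16 * C ^ 2 / c' + c' / 2 with hH0
  have hH00 : 0 ≤ H0 := by positivity
  set Λ := 4 * Real.exp (C1 + n * |Real.log (4 / (c' / 6 / 2))|) + c' / 6 with hΛ
  have hΛ0 : 0 ≤ Λ := by positivity
  refine ⟨H0 + Λ + C, by linarith, ?_⟩
  intro u φ S p hp N hN hcN hIN t ht
  have hpc := frontier_subset_closure hp
  have ht0 : t ∈ Ioo (0 : ℝ) T := ⟨by linarith [ht.1], ht.2⟩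
  obtain ⟨k1, k2⟩ := hC u φ S p hp N hN hcN hIN t ht
  have hsym := S.ru.symm p hpc t ht0
  have hNp : 0 < dd N ρ p := by linarith
  have hJN := k1 _ _ hIN hIN
  rw [I_norm, hN] at hJN
  have hH : QD Ω u (p, t) N ≤ H0 + Λ := by
    by_contra hcon
    push Not at hcon
    have hF : ∀ X, c' / 6 * ‖X‖ ^ 2 ≤ QD Ω u (p, t) X := by
      intro X
      obtain ⟨x, hx⟩ : ∃ x, x = dd X ρ p / dd N ρ p := ⟨_, rfl⟩
      obtain ⟨y, hy⟩ : ∃ y, y = -(dd (Complex.I • X) ρ p / dd N ρ p) := ⟨_, rfl⟩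
      obtain ⟨ξ, hξ⟩ : ∃ ξ, ξ = X - x • N - y • (Complex.I • N) := ⟨_, rfl⟩
      have eX : X = ξ + x • N + y • (Complex.I • N) := by rw [hξ]; abel
      have eJ : Complex.I • X = Complex.I • ξ + x • (Complex.I • N) + (-y) • N := by
        conv_lhs => rw [eX]
        rw [smul_add, smul_add, smul_comm Complex.I x, smul_comm Complex.I y, I_I_smul, smul_neg,
          neg_smul]
      have d1 : dd X ρ p = dd ξ ρ p + x * dd N ρ p + y * dd (Complex.I • N) ρ p := by
        conv_lhs => rw [eX]
        unfold dd
        simp only [map_add, map_smul, smul_eq_mul]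
      have d2 : dd (Complex.I • X) ρ p =
          dd (Complex.I • ξ) ρ p + x * dd (Complex.I • N) ρ p + (-y) * dd N ρ p := by
        conv_lhs => rw [eJ]
        unfold dd
        simp only [map_add, map_smul, smul_eq_mul]
      have dx : x * dd N ρ p = dd X ρ p := by
        rw [hx]
        exact div_mul_cancel₀ _ hNp.ne'
      have dy : -y * dd N ρ p = dd (Complex.I • X) ρ p := by
        rw [hy, neg_neg]
        exact div_mul_cancel₀ _ hNp.ne'
      rw [hIN, dx] at d1
      rw [hIN, dy] at d2
      have hξ1 : dd ξ ρ p = 0 := by linarith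
      have hξ2 : dd (Complex.I • ξ) ρ p = 0 := by linarith
      have hq := hc' u φ S p hp t ht ξ hξ1 hξ2
      have b1 := k2 ξ hξ1
      have b2 := k1 _ _ hIN hξ2
      have b3 := k1 _ _ hIN hξ1
      have b4 := k2 _ hξ2
      rw [I_norm, I_norm, hN, one_mul] at b2
      rw [I_norm, hN, one_mul] at b3
      rw [I_norm] at b4
      have hn : ‖X‖ ≤ ‖ξ‖ + |x| + |y| := by
        conv_lhs => rw [eX]
        refine (norm_add₃_le).trans ?_
        rw [norm_smul, norm_smul, I_norm, hN, mul_one, mul_one, Real.norm_eq_abs, Real.norm_eq_abs]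
      refine nb_scalar (C := C) (H := QD Ω u (p, t) N) (r := ‖ξ‖) (x := x) (y := y) hc'0 (by linarith)
        (norm_nonneg _) hn hq
        (a := D2 Ω u (p, t) N ξ + D2 Ω u (p, t) (Complex.I • N) (Complex.I • ξ))
        (b := D2 Ω u (p, t) (Complex.I • N) ξ - D2 Ω u (p, t) N (Complex.I • ξ)) ?_ ?_ ?_
      · exact (abs_add_le _ _).trans (by linarith)
      · exact (abs_sub _ _).trans (by linarith)
      · have e1 : QD Ω u (p, t) X = D2 Ω u (p, t) (ξ + x • N + y • (Complex.I • N))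
            (ξ + x • N + y • (Complex.I • N)) +
            D2 Ω u (p, t) (Complex.I • ξ + x • (Complex.I • N) + (-y) • N)
              (Complex.I • ξ + x • (Complex.I • N) + (-y) • N) := by
          rw [← eJ, ← eX]
          rfl
        rw [e1]
        unfold QD
        simp only [map_add, map_smul, smul_eq_mul, ContinuousLinearMap.add_apply,
          ContinuousLinearMap.smul_apply]
        rw [hsym ξ N, hsym ξ (Complex.I • N), hsym (Complex.I • ξ) N,
          hsym (Complex.I • ξ) (Complex.I • N), hsym (Complex.I • N) N]
        ring
    have := F2_bd hε (by positivity) S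
      (fun z hz t ht v μ k F H => ((hC1 u φ S).2 z hz t ht v μ k F H).1) hpc ht hF N
    rw [hN, ← hΛ] at this
    linarith
  have hH' := QD_nonneg S hpc ht0 N
  unfold QD at hH hH'
  have := abs_le.1 hJN
  rw [abs_le]
  constructor <;> linarith

theorem hess_bound [NeZero n] (D : Dom Ω ρ c K) (T M ε : ℝ) (hT : 0 < T) (hM : 1 ≤ M)
    (hε : 0 < ε) : ∃ C : ℝ, 1 ≤ C ∧
    ∀ u φ : Cn n × ℝ → ℝ, Sol Ω T M u φ → ∀ p ∈ frontier Ω, ∀ t ∈ Ico ε T, ∀ X,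
    |D2 Ω u (p, t) X X| ≤ C * ‖X‖ ^ 2 := by
  obtain ⟨C, hC1, hC⟩ := normal_bound D T M ε hT hM hε
  obtain ⟨C3, hC31, hC3⟩ := hess_NN D T M ε hT hM hε
  refine ⟨C3 * (C + 1), by nlinarith, ?_⟩
  intro u φ S p hp t ht X
  obtain ⟨N, hN, hcN, hIN⟩ := D.nor p hp
  obtain ⟨y, hy0, hy1, hy2⟩ := hC3 u φ S p hp N hN hcN hIN t ht X
  have g := hC u φ S p hp N hN hcN hIN t ht
  have h1 : |y * D2 Ω u (p, t) N N| ≤ C3 * ‖X‖ ^ 2 * C := by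
    rw [abs_mul, abs_of_nonneg hy0]
    exact mul_le_mul hy1 g (abs_nonneg _) (by positivity)
  have h2 := abs_le.1 h1
  have h3 := abs_le.1 hy2
  rw [abs_le]
  constructor <;> linarith

theorem hess_op [NeZero n] (D : Dom Ω ρ c K) (T M ε : ℝ) (hT : 0 < T) (hM : 1 ≤ M)
    (hε : 0 < ε) : ∃ C : ℝ, 1 ≤ C ∧
    ∀ u φ : Cn n × ℝ → ℝ, Sol Ω T M u φ → ∀ p ∈ frontier Ω, ∀ t ∈ Ico ε T, ∀ X Y,
    |D2 Ω u (p, t) X Y| ≤ C * (‖X‖ * ‖Y‖) := by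
  obtain ⟨C, hC1, hC⟩ := hess_bound D T M ε hT hM hε
  refine ⟨2 * C, by linarith, ?_⟩
  intro u φ S p hp t ht
  have hpc := frontier_subset_closure hp
  have ht0 : t ∈ Ioo (0 : ℝ) T := ⟨by linarith [ht.1], ht.2⟩
  have hsym := S.ru.symm p hpc t ht0
  have hq := hC u φ S p hp t ht
  have key : ∀ X Y : Cn n, ‖X‖ = 1 → ‖Y‖ = 1 → |D2 Ω u (p, t) X Y| ≤ 2 * C := by
    intro X Y hX hY
    have e1 := hq (X + Y)
    have e2 := hq (X - Y)
    have n1 : ‖X + Y‖ ^ 2 ≤ 4 := by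
      have : ‖X + Y‖ ≤ 2 := (norm_add_le _ _).trans (by linarith)
      nlinarith [norm_nonneg (X + Y)]
    have n2 : ‖X - Y‖ ^ 2 ≤ 4 := by
      have : ‖X - Y‖ ≤ 2 := (norm_sub_le _ _).trans (by linarith)
      nlinarith [norm_nonneg (X - Y)]
    have p1 := mul_le_mul_of_nonneg_left n1 (by linarith : 0 ≤ C)
    have p2 := mul_le_mul_of_nonneg_left n2 (by linarith : 0 ≤ C)
    simp only [map_add, map_sub, ContinuousLinearMap.add_apply,
      ContinuousLinearMap.sub_apply] at e1 e2
    rw [hsym Y X] at e1 e2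
    have a1 := abs_le.1 e1
    have a2 := abs_le.1 e2
    rw [abs_le]
    constructor <;> linarith
  intro X Y
  by_cases hX : X = 0
  · subst hX; simp
  by_cases hY : Y = 0
  · subst hY; simp
  have rX : 0 < ‖X‖ := norm_pos_iff.2 hX
  have rY : 0 < ‖Y‖ := norm_pos_iff.2 hY
  have nX : ‖‖X‖⁻¹ • X‖ = 1 := by rw [norm_smul, norm_inv, norm_norm, inv_mul_cancel₀ rX.ne']
  have nY : ‖‖Y‖⁻¹ • Y‖ = 1 := by rw [norm_smul, norm_inv, norm_norm, inv_mul_cancel₀ rY.ne']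
  have e := key _ _ nX nY
  simp only [map_smul, smul_eq_mul, ContinuousLinearMap.smul_apply] at e
  rw [abs_mul, abs_mul, abs_of_pos (inv_pos.2 rX), abs_of_pos (inv_pos.2 rY)] at e
  have e2 : |D2 Ω u (p, t) X Y| = ‖X‖ * ‖Y‖ * (‖Y‖⁻¹ * (‖X‖⁻¹ * |D2 Ω u (p, t) X Y|)) := by
    field_simp
  rw [e2]
  have e' : ‖Y‖⁻¹ * (‖X‖⁻¹ * |D2 Ω u (p, t) X Y|) ≤ 2 * C := by linarith
  have := mul_le_mul_of_nonneg_left e' (by positivity : 0 ≤ ‖X‖ * ‖Y‖)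
  linarith

end

/-- **Second derivative estimates on the boundary** (Proposition 4.3): under the a priori
hypotheses, for every `ε ∈ (0,T)` there is `D₁ = D₁(Ω, ε, T, Cu, Cφv, Cf)` with
`|D²u| ≤ D₁` on `∂Ω×(ε,T)`, where `D²u` is the full real spatial Hessian. -/
theorem stmt_12 (n : ℕ) (Ω : Set (Cn n)) (T Cu Cφv Cf ε : ℝ)
    (hΩ : IsSPCDomain Ω) (hT : 0 < T) (hε : 0 < ε) (hεT : ε < T) :
    ∃ D₁ : ℝ, 0 < D₁ ∧
      ∀ (u φ : Cn n × ℝ → ℝ) (f : ℝ × Cn n × ℝ → ℝ),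
        AprioriHyps n Ω T Cu Cφv Cf u φ f →
        ∀ z ∈ frontier Ω, ∀ t ∈ Ioo ε T,
          ‖iteratedFDerivWithin ℝ 2 (fun w => u (w, t)) (closure Ω) z‖ ≤ D₁ := by
  rcases Nat.eq_zero_or_pos n with hn | hn
  · subst hn
    refine ⟨1, one_pos, ?_⟩
    intro u φ f _ z hz
    exfalso
    have hsub : Subsingleton (Cn 0) := ⟨fun a b => by ext i; exact i.elim0⟩
    have h1 : Ω = univ := by
      obtain ⟨w, hw⟩ := hΩ.2.1
      exact eq_univ_of_forall (fun x => by rw [Subsingleton.elim x w]; exact hw)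
    rw [h1, frontier_univ] at hz
    exact hz
  · haveI : NeZero n := ⟨hn.ne'⟩
    obtain ⟨ρ, c, K, D⟩ := exists_dom hΩ
    have hM : (1 : ℝ) ≤ 1 + |Cu| + |Cφv| + |Cf| := by
      linarith [abs_nonneg Cu, abs_nonneg Cφv, abs_nonneg Cf]
    obtain ⟨C, hC1, hC⟩ := hess_op D T (1 + |Cu| + |Cφv| + |Cf|) ε hT hM hε
    refine ⟨C, by linarith, ?_⟩
    intro u φ f hyp z hz t ht
    have S := sol_of D hT hyp
    have h2 := hC u φ S z hz t ⟨ht.1.le, ht.2⟩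
    have hzc := frontier_subset_closure hz
    refine ContinuousMultilinearMap.opNorm_le_bound (by linarith) (fun m => ?_)
    rw [iteratedFDerivWithin_two_apply _ D.uniqueDiff hzc, Fin.prod_univ_two]
    exact h2 (m 0) (m 1)
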